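/- In the discharging of H defined by rules R1–R5 applied to the initial charge (every j-face charged with weight j), every minor 4-face f of H has final weight w(f) ≥ 10/3. -/

import Mathlib

open scoped Classical

noncomputable section

/-- A plane embedding (drawing) of a simple graph: vertices are mapped to distinct
points of the plane, every edge is drawn as a simple arc joining the points of its two
endvertices, arcs contain no vertex points other than their endpoints, and two distinct
arcs meet only in common endpoints. -/
structure PlaneEmbedding {V : Type*} (G : SimpleGraph V) where
  pos : V → ℝ × ℝ
  arc : V → V → Set (ℝ × ℝ)
  pos_injective : Function.Injective pos
  arc_symm : ∀ u v, arc u v = arc v u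
  arc_curve : ∀ u v, G.Adj u v → ∃ γ : ℝ → ℝ × ℝ,
      ContinuousOn γ (Set.Icc 0 1) ∧ Set.InjOn γ (Set.Icc 0 1) ∧
      γ 0 = pos u ∧ γ 1 = pos v ∧ γ '' Set.Icc 0 1 = arc u v
  arc_vertex : ∀ u v, G.Adj u v → ∀ w, pos w ∈ arc u v → w = u ∨ w = v
  arc_inter : ∀ u v x y, G.Adj u v → G.Adj x y → s(u, v) ≠ s(x, y) →
      arc u v ∩ arc x y ⊆ Set.range pos

/-- A graph is planar if it admits a plane embedding. -/
def SimpleGraph.IsPlanar {V : Type*} (G : SimpleGraph V) : Prop :=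
  Nonempty (PlaneEmbedding G)

/-- A graph is 3-connected if it has at least four vertices and deleting any set of at
most two vertices leaves a connected graph. -/
def ThreeConnected {V : Type*} [Fintype V] (G : SimpleGraph V) : Prop :=
  4 ≤ Fintype.card V ∧
    ∀ S : Finset V, S.card ≤ 2 → (G.induce ((↑S : Set V)ᶜ)).Connected

/-- `S` is a separator of `G`: deleting it leaves a disconnected graph. -/
def IsSeparator {V : Type*} [Fintype V] (G : SimpleGraph V) (S : Finset V) : Prop :=
  ¬ (G.induce ((↑S : Set V)ᶜ)).Connected

/-- A separator `S` is trivial if some component of `G - S` is a single vertex, i.e.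
some vertex outside `S` has all of its neighbours inside `S`. -/
def TrivialSeparator {V : Type*} [Fintype V] (G : SimpleGraph V) (S : Finset V) : Prop :=
  ∃ v : V, v ∉ S ∧ ∀ w : V, G.Adj v w → w ∈ S

/-- A graph is essentially 4-connected if it is 3-connected and every 3-separator is
trivial. -/
def EssentiallyFourConnected {V : Type*} [Fintype V] (G : SimpleGraph V) : Prop :=
  ThreeConnected G ∧
    ∀ S : Finset V, S.card = 3 → IsSeparator G S → TrivialSeparator G S

/-- A cycle `C` of `G` is isolating if every component of `G - V(C)` is a single vertex
of degree 3 in `G`, i.e. every vertex not on `C` has degree 3 in `G` and all of its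
neighbours on `C`. -/
def IsIsolating {V : Type*} [Fintype V] (G : SimpleGraph V) {x : V} (C : G.Walk x x) : Prop :=
  ∀ v : V, v ∉ C.support →
    (Finset.univ.filter fun w => G.Adj v w).card = 3 ∧ ∀ w : V, G.Adj v w → w ∈ C.support

/-- `C` is a longest isolating cycle of `G`. -/
def IsLongestIsolatingCycle {V : Type*} [Fintype V] (G : SimpleGraph V) {x : V}
    (C : G.Walk x x) : Prop :=
  C.IsCycle ∧ IsIsolating G C ∧
    ∀ (y : V) (C' : G.Walk y y), C'.IsCycle → IsIsolating G C' → C'.length ≤ C.length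

section PlaneSetup

variable {V : Type*} [Fintype V] {G : SimpleGraph V}

/-- The chords of the cycle `C`: edges of `G` not on `C` joining two vertices of `C`. -/
def chordSet {x : V} (C : G.Walk x x) : Set (Sym2 V) :=
  {e | e ∈ G.edgeSet ∧ e ∉ C.edges ∧ ∀ v ∈ e, v ∈ C.support}

/-- The plane graph `H` obtained from `G` by deleting all chords of `C`. -/
def Hgraph {x : V} (C : G.Walk x x) : SimpleGraph V :=
  G.deleteEdges (chordSet C)

/-- The arc drawing an edge, as a function of the unordered edge. -/
def arcSet (emb : PlaneEmbedding G) : Sym2 V → Set (ℝ × ℝ) :=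
  Sym2.lift ⟨emb.arc, emb.arc_symm⟩

/-- The point set of the drawing of the subgraph of `H'` induced on the vertex set `s`
(in the embedding `emb` of `G`). -/
def drawingOn (emb : PlaneEmbedding G) (H' : SimpleGraph V) (s : Set V) : Set (ℝ × ℝ) :=
  emb.pos '' s ∪
    ⋃ (u : V) (v : V) (_ : H'.Adj u v) (_ : u ∈ s) (_ : v ∈ s), emb.arc u v

/-- The drawing of `H`. -/
def drawingH (emb : PlaneEmbedding G) {x : V} (C : G.Walk x x) : Set (ℝ × ℝ) :=
  drawingOn emb (Hgraph C) Set.univ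

/-- `f` is a face of the drawing `D`: a connected component of its complement. -/
def IsFaceOf (D : Set (ℝ × ℝ)) (f : Set (ℝ × ℝ)) : Prop :=
  ∃ z : ℝ × ℝ, z ∉ D ∧ f = connectedComponentIn Dᶜ z

/-- The drawing of the cycle `C`. -/
def drawC (emb : PlaneEmbedding G) {x : V} (C : G.Walk x x) : Set (ℝ × ℝ) :=
  ⋃ e ∈ C.edges, arcSet emb e

/-- The open region strictly inside the closed curve given by `C`: the points off the
curve whose connected component in the complement is bounded. -/
def insideC (emb : PlaneEmbedding G) {x : V} (C : G.Walk x x) : Set (ℝ × ℝ) :=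
  {z | z ∉ drawC emb C ∧ Bornology.IsBounded (connectedComponentIn (drawC emb C)ᶜ z)}

/-- The vertices of `G` strictly inside `C`. -/
def Vminus (emb : PlaneEmbedding G) {x : V} (C : G.Walk x x) : Finset V :=
  Finset.univ.filter fun v => v ∉ C.support ∧ emb.pos v ∈ insideC emb C

/-- The vertices of `G` strictly outside `C`:  `V⁺ = V - V(C) - V⁻`. -/
def Vplus (emb : PlaneEmbedding G) {x : V} (C : G.Walk x x) : Finset V :=
  Finset.univ.filter fun v => v ∉ C.support ∧ v ∉ Vminus emb C

/-- A face `f` is incident with the vertex `v`. -/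
def incVertex (emb : PlaneEmbedding G) (f : Set (ℝ × ℝ)) (v : V) : Prop :=
  emb.pos v ∈ closure f

/-- A face `f` is incident with the edge `e` (the arc of `e` lies on the boundary). -/
def incEdge (emb : PlaneEmbedding G) (f : Set (ℝ × ℝ)) (e : Sym2 V) : Prop :=
  arcSet emb e ⊆ closure f

/-- A minor face of the drawing `D`: a face incident with exactly one vertex of
`V⁻ ∪ V⁺`. -/
def MinorFaceOf (emb : PlaneEmbedding G) {x : V} (C : G.Walk x x)
    (D : Set (ℝ × ℝ)) (f : Set (ℝ × ℝ)) : Prop :=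
  IsFaceOf D f ∧ ∃! v : V, v ∈ Vminus emb C ∪ Vplus emb C ∧ incVertex emb f v

/-- `M⁻`: the minor faces of `H⁻ = H - V⁺`. -/
def Mminus (emb : PlaneEmbedding G) {x : V} (C : G.Walk x x) : Set (Set (ℝ × ℝ)) :=
  {f | MinorFaceOf emb C (drawingOn emb (Hgraph C) ((↑(Vplus emb C) : Set V)ᶜ)) f}

/-- `M⁺`: the minor faces of `H⁺ = H - V⁻`. -/
def Mplus (emb : PlaneEmbedding G) {x : V} (C : G.Walk x x) : Set (Set (ℝ × ℝ)) :=
  {f | MinorFaceOf emb C (drawingOn emb (Hgraph C) ((↑(Vminus emb C) : Set V)ᶜ)) f}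

/-- A minor face of `H`. -/
def MinorFaceH (emb : PlaneEmbedding G) {x : V} (C : G.Walk x x) (f : Set (ℝ × ℝ)) : Prop :=
  MinorFaceOf emb C (drawingH emb C) f

/-- A major face of `H`: a face of `H` that is not minor. -/
def MajorFaceH (emb : PlaneEmbedding G) {x : V} (C : G.Walk x x) (f : Set (ℝ × ℝ)) : Prop :=
  IsFaceOf (drawingH emb C) f ∧ ¬ MinorFaceH emb C f

/-- The number of `C`-edges of a face `f` (so `f` is a `j`-face when this equals `j`). -/
def numCEdges (emb : PlaneEmbedding G) {x : V} (C : G.Walk x x) (f : Set (ℝ × ℝ)) : ℕ :=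
  (C.edges.toFinset.filter fun e => incEdge emb f e).card

/-- `m_{f,f'}`: the number of common `C`-edges of the faces `f` and `f'`. -/
def mEdges (emb : PlaneEmbedding G) {x : V} (C : G.Walk x x)
    (f f' : Set (ℝ × ℝ)) : ℕ :=
  (C.edges.toFinset.filter fun e => incEdge emb f e ∧ incEdge emb f' e).card

/-- `f'` is opposite to `f` (with respect to some `C`-edge incident with both). -/
def OppositeFaces (emb : PlaneEmbedding G) {x : V} (C : G.Walk x x)
    (f f' : Set (ℝ × ℝ)) : Prop :=
  f ≠ f' ∧ ∃ e ∈ C.edges, incEdge emb f e ∧ incEdge emb f' e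

/-- `e` is the middle `C`-edge of the face `f` (for a 3-face, the `C`-edge sharing an
endvertex with every other `C`-edge of `f`). -/
def IsMiddleCEdge (emb : PlaneEmbedding G) {x : V} (C : G.Walk x x)
    (f : Set (ℝ × ℝ)) (e : Sym2 V) : Prop :=
  e ∈ C.edges ∧ incEdge emb f e ∧
    ∀ e' ∈ C.edges, incEdge emb f e' → e' ≠ e → ∃ v : V, v ∈ e ∧ v ∈ e'

/-- The total weight sent from the face `f` to the face `f'` by the discharging rules
R1–R5 (each rule applied exactly once). -/
def sendWeight (emb : PlaneEmbedding G) {x : V} (C : G.Walk x x)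
    (f f' : Set (ℝ × ℝ)) : ℚ :=
  -- R1: a major face sends `m_{f,f'}` to every opposite minor face
  (if MajorFaceH emb C f ∧ MinorFaceH emb C f' ∧ OppositeFaces emb C f f'
    then (mEdges emb C f f' : ℚ) else 0)
  -- R2: a minor face sends `(2/3)·m_{f,f'}` to every opposite minor 2-face
  + (if MinorFaceH emb C f ∧ MinorFaceH emb C f' ∧ numCEdges emb C f' = 2 ∧
        OppositeFaces emb C f f'
    then 2 / 3 * (mEdges emb C f f' : ℚ) else 0)
  -- R3: a minor face sends 1 to every minor 3-face opposite with respect to its middle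
  -- `C`-edge
  + (if MinorFaceH emb C f ∧ MinorFaceH emb C f' ∧ numCEdges emb C f' = 3 ∧ f ≠ f' ∧
        (∃ e : Sym2 V, IsMiddleCEdge emb C f' e ∧ incEdge emb f e)
    then 1 else 0)
  -- R4
  + (if MinorFaceH emb C f ∧ 4 ≤ numCEdges emb C f ∧ MinorFaceH emb C f' ∧
        numCEdges emb C f' = 4 ∧ OppositeFaces emb C f' f ∧ mEdges emb C f' f = 2 ∧
        (∃ f₂ : Set (ℝ × ℝ), MinorFaceH emb C f₂ ∧
          (numCEdges emb C f₂ = 2 ∨ numCEdges emb C f₂ = 3) ∧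
          OppositeFaces emb C f' f₂ ∧ mEdges emb C f' f₂ = 2)
    then 2 / 3 else 0)
  -- R5
  + (if MinorFaceH emb C f ∧ 4 ≤ numCEdges emb C f ∧ MinorFaceH emb C f' ∧
        numCEdges emb C f' = 5 ∧ OppositeFaces emb C f' f ∧ mEdges emb C f' f = 2 ∧
        (∃ g₁ g₂ : Set (ℝ × ℝ), g₁ ≠ g₂ ∧
          MinorFaceH emb C g₁ ∧ numCEdges emb C g₁ = 2 ∧ OppositeFaces emb C f' g₁ ∧
          MinorFaceH emb C g₂ ∧ numCEdges emb C g₂ = 2 ∧ OppositeFaces emb C f' g₂)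
    then 1 / 3 else 0)

/-- The final weight of a face `f` after discharging: the initial charge `j` of a
`j`-face, minus everything sent, plus everything received. -/
def wFace (emb : PlaneEmbedding G) {x : V} (C : G.Walk x x) (f : Set (ℝ × ℝ)) : ℚ :=
  (numCEdges emb C f : ℚ) - (∑ᶠ f' : Set (ℝ × ℝ), sendWeight emb C f f')
    + ∑ᶠ f' : Set (ℝ × ℝ), sendWeight emb C f' f

end PlaneSetup

section PlaneTopology

open Set Topology Filter

/-- `p` and `q` lie in a common preconnected set avoiding `K`. -/
def Linked {X : Type*} [TopologicalSpace X] (K : Set X) (p q : X) : Prop :=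
  ∃ S : Set X, IsPreconnected S ∧ p ∈ S ∧ q ∈ S ∧ Disjoint S K

namespace Linked

variable {X : Type*} [TopologicalSpace X] {K K' : Set X} {p q r : X}

theorem symm (h : Linked K p q) : Linked K q p :=
  let ⟨S, hS, hp, hq, hd⟩ := h
  ⟨S, hS, hq, hp, hd⟩

theorem trans (h : Linked K p q) (h' : Linked K q r) : Linked K p r := by
  obtain ⟨S, hS, hp, hq, hd⟩ := h
  obtain ⟨T, hT, hq', hr, hd'⟩ := h'
  exact ⟨S ∪ T, hS.union q hq hq' hT, Or.inl hp, Or.inr hr, by simp [hd, hd']⟩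

theorem mono (hK : K ⊆ K') (h : Linked K' p q) : Linked K p q :=
  let ⟨S, hS, hp, hq, hd⟩ := h
  ⟨S, hS, hp, hq, hd.mono_right hK⟩

theorem left_notMem (h : Linked K p q) : p ∉ K :=
  let ⟨_, _, hp, _, hd⟩ := h
  disjoint_left.1 hd hp

theorem right_notMem (h : Linked K p q) : q ∉ K := h.symm.left_notMem

theorem mem_component (h : Linked K p q) : q ∈ connectedComponentIn Kᶜ p :=
  let ⟨_, hS, hp, hq, hd⟩ := h
  hS.subset_connectedComponentIn hp (subset_compl_iff_disjoint_right.2 hd) hq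

theorem of_mem_component (h : q ∈ connectedComponentIn Kᶜ p) : Linked K p q := by
  have hp : p ∈ Kᶜ := by
    by_contra hp
    simp [connectedComponentIn_eq_empty hp] at h
  exact ⟨_, isPreconnected_connectedComponentIn, mem_connectedComponentIn hp, h,
    subset_compl_iff_disjoint_right.1 (connectedComponentIn_subset _ _)⟩

theorem map {Y : Type*} [TopologicalSpace Y] (e : X ≃ₜ Y) (h : Linked K p q) :
    Linked (e '' K) (e p) (e q) := by
  obtain ⟨S, hS, hp, hq, hd⟩ := h
  exact ⟨e '' S, hS.image e e.continuous.continuousOn, mem_image_of_mem e hp,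
    mem_image_of_mem e hq, (disjoint_image_iff e.injective).2 hd⟩

end Linked

/-- Every component of the complement of a closed set has its frontier inside that set. -/
theorem closure_component_subset {X : Type*} [TopologicalSpace X] [LocallyConnectedSpace X]
    {K : Set X} (hK : IsClosed K) (p : X) :
    closure (connectedComponentIn Kᶜ p) ⊆ connectedComponentIn Kᶜ p ∪ K := by
  intro z hz
  by_contra h
  rw [mem_union, not_or] at h
  have ho : IsOpen (connectedComponentIn Kᶜ z) := hK.isOpen_compl.connectedComponentIn
  obtain ⟨y, hy1, hy2⟩ := mem_closure_iff.1 hz _ ho (mem_connectedComponentIn h.2)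
  exact h.1 ((Linked.of_mem_component hy2).trans (Linked.of_mem_component hy1).symm).mem_component

/-- `f` has a continuous logarithm on `K`. -/
def HasLog {X : Type*} [TopologicalSpace X] (K : Set X) (f : X → ℂ) : Prop :=
  ∃ φ : X → ℂ, ContinuousOn φ K ∧ ∀ z ∈ K, Complex.exp (φ z) = f z

namespace HasLog

variable {X : Type*} [TopologicalSpace X] {K K' : Set X} {f g : X → ℂ}

theorem congr (h : HasLog K f) (hfg : ∀ z ∈ K, f z = g z) : HasLog K g :=
  let ⟨φ, hφ, hf⟩ := h
  ⟨φ, hφ, fun z hz => (hf z hz).trans (hfg z hz)⟩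

theorem mul (hf : HasLog K f) (hg : HasLog K g) : HasLog K fun z => f z * g z := by
  obtain ⟨φ, hφ, hf⟩ := hf
  obtain ⟨ψ, hψ, hg⟩ := hg
  exact ⟨fun z => φ z + ψ z, hφ.add hψ, fun z hz => by rw [Complex.exp_add, hf z hz, hg z hz]⟩

theorem inv (hf : HasLog K f) : HasLog K fun z => (f z)⁻¹ := by
  obtain ⟨φ, hφ, hf⟩ := hf
  exact ⟨fun z => - φ z, hφ.neg, fun z hz => by rw [Complex.exp_neg, hf z hz]⟩

theorem of_slitPlane (hf : ContinuousOn f K) (h : ∀ z ∈ K, f z ∈ Complex.slitPlane) :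
    HasLog K f :=
  ⟨fun z => Complex.log (f z), hf.clog h,
    fun z hz => Complex.exp_log (Complex.slitPlane_ne_zero (h z hz))⟩

end HasLog

theorem eq_of_exp_eq_const {X : Type*} [TopologicalSpace X] {S : Set X} (hS : IsPreconnected S)
    {φ : X → ℂ} (hφ : ContinuousOn φ S) {c : ℂ} (h : ∀ z ∈ S, Complex.exp (φ z) = c)
    {x y : X} (hx : x ∈ S) (hy : y ∈ S) : φ x = φ y := by
  refine hS.induction₂ (fun x y => φ x = φ y) (fun x hx => ?_) (fun _ _ _ _ _ _ => Eq.trans)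
    (fun _ _ _ _ => Eq.symm) hx hy
  have := Metric.tendsto_nhds.1 (hφ x hx) (2 * Real.pi) (by positivity)
  filter_upwards [this, self_mem_nhdsWithin] with y hy hyS
  have h1 : Complex.exp (φ y - φ x) = 1 := by
    rw [Complex.exp_sub, h y hyS, h x hx, div_self]
    rw [← h x hx]; exact Complex.exp_ne_zero _
  obtain ⟨n, hn⟩ := Complex.exp_eq_one_iff.1 h1
  rw [dist_eq_norm, hn] at hy
  have hn0 : n = 0 := by
    by_contra h0
    have h2 : (1 : ℝ) ≤ |(n : ℝ)| := by exact_mod_cast Int.one_le_abs h0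
    have h3 : ‖(n : ℂ) * (2 * Real.pi * Complex.I)‖ = |(n : ℝ)| * (2 * Real.pi) := by
      simp [abs_of_pos Real.pi_pos]
    rw [h3] at hy
    nlinarith [Real.pi_pos]
  rw [hn0] at hn
  simp only [Int.cast_zero, zero_mul, sub_eq_zero] at hn
  exact hn.symm

theorem hasLog_of_linked {K : Set ℂ} (hK : IsClosed K) {p q : ℂ} (h : Linked K p q) :
    HasLog K fun z => (z - p) / (z - q) := by
  obtain ⟨S, hS, hp, hq, hd⟩ := h
  have hne : ∀ x ∈ S, ∀ z ∈ K, z - x ≠ 0 := fun x hx z hz h0 =>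
    disjoint_left.1 hd hx (sub_eq_zero.1 h0 ▸ hz)
  refine hS.induction₂ (fun x y => HasLog K fun z => (z - x) / (z - y)) (fun x hx => ?_)
    (fun x y w hx hy hw h1 h2 => ?_) (fun x y hx hy h1 => ?_) hp hq
  · obtain ⟨r, hr, hb⟩ := Metric.isOpen_iff.1 hK.isOpen_compl x (disjoint_left.1 hd hx)
    filter_upwards [self_mem_nhdsWithin, mem_nhdsWithin_of_mem_nhds
      (Metric.ball_mem_nhds x (half_pos hr))] with y hyS hy
    rw [Metric.mem_ball, dist_eq_norm] at hy
    refine HasLog.of_slitPlane (ContinuousOn.div (by fun_prop) (by fun_prop)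
      (fun z hz => hne y hyS z hz)) fun z hz => ?_
    have h1 : r ≤ ‖z - x‖ := by
      by_contra hlt
      exact hb (Metric.mem_ball.2 (by rw [dist_eq_norm]; exact not_le.1 hlt)) hz
    have h2 : ‖z - x‖ ≤ ‖z - y‖ + ‖y - x‖ := norm_sub_le_norm_sub_add_norm_sub z y x
    have h3 : (z - x) / (z - y) = 1 + (y - x) / (z - y) := by
      have := hne y hyS z hz
      field_simp; ring
    rw [h3]
    apply Complex.mem_slitPlane_of_norm_lt_one
    rw [norm_div, div_lt_one (norm_pos_iff.2 (hne y hyS z hz))]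
    linarith
  · refine (h1.mul h2).congr fun z hz => ?_
    have := hne y hy z hz
    have := hne w hw z hz
    field_simp
  · exact h1.inv.congr fun z hz => inv_div _ _

/-- A nowhere vanishing continuous function on a contractible space has a logarithm. -/
theorem exists_log {X : Type*} [TopologicalSpace X] [ContractibleSpace X]
    [LocallyPathConnectedSpace X] {g : X → ℂ} (hg : Continuous g) (h0 : ∀ x, g x ≠ 0) :
    ∃ φ : X → ℂ, Continuous φ ∧ ∀ x, Complex.exp (φ x) = g x := by
  have : ContractibleSpace (univ : Set X) := (Homeomorph.Set.univ X).contractibleSpace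
  have hs : IsSimplyConnected (univ : Set X) := SimplyConnectedSpace.ofContractible _
  obtain ⟨φ, hφ, h⟩ := Complex.exists_continuousOn_eqOn_exp_comp hs isOpen_univ hg.continuousOn
    (by rintro ⟨x, -, hx⟩; exact h0 x hx)
  exact ⟨φ, continuousOn_univ.1 hφ, fun x => h (mem_univ x)⟩

end PlaneTopology

section PlaneTopology

open Set Topology Filter

/-- A continuous function on the plane agreeing with `(z - p) ^ k` far away vanishes somewhere
unless `k = 0`. -/
theorem zpow_eq_zero_of_log {h : ℂ → ℂ} (hc : Continuous h) (h0 : ∀ z, h z ≠ 0) {p : ℂ} {k : ℤ}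
    {R : ℝ} (hR : 0 < R) (hk : ∀ z, ‖z - p‖ = R → h z = (z - p) ^ k) : k = 0 := by
  obtain ⟨ψ, hψ, he⟩ := exists_log hc h0
  have hcirc : ∀ t : ℝ, Complex.exp (ψ (p + R * Complex.exp (t * Complex.I))
      - k * (t * Complex.I)) = (R : ℂ) ^ k := by
    intro t
    have hn : ‖p + R * Complex.exp (t * Complex.I) - p‖ = R := by
      simp [Complex.norm_exp_ofReal_mul_I, abs_of_pos hR]
    rw [Complex.exp_sub, he, hk _ hn, add_sub_cancel_left, mul_zpow, Complex.exp_int_mul]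
    exact mul_div_cancel_right₀ _ (zpow_ne_zero _ (Complex.exp_ne_zero _))
  have h1 := eq_of_exp_eq_const (isPreconnected_univ (α := ℝ))
    (φ := fun t : ℝ => ψ (p + R * Complex.exp (t * Complex.I)) - k * (t * Complex.I))
    (by fun_prop) (fun t _ => hcirc t) (mem_univ 0) (mem_univ (2 * Real.pi))
  have h2 : Complex.exp (((2 * Real.pi : ℝ) : ℂ) * Complex.I) = 1 := by
    push_cast; exact Complex.exp_two_pi_mul_I
  simp only [h2] at h1
  simp only [Complex.ofReal_zero, zero_mul, Complex.exp_zero, mul_zero, sub_zero] at h1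
  have h3 : (k : ℂ) * (((2 * Real.pi : ℝ) : ℂ) * Complex.I) = 0 := by
    linear_combination h1
  simpa [Real.pi_ne_zero] using h3

theorem exponent_eq_zero_of_hasLog {K : Set ℂ} (hK : IsCompact K) {p : ℂ} (hp : p ∉ K)
    (hb : Bornology.IsBounded (connectedComponentIn Kᶜ p)) {g : ℂ → ℂ}
    (hg : ContinuousOn g (closure (connectedComponentIn Kᶜ p)))
    (hg0 : ∀ z ∈ closure (connectedComponentIn Kᶜ p), g z ≠ 0) {k : ℤ}
    (hl : HasLog K fun z => (z - p) ^ k * g z) : k = 0 := by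
  set U := connectedComponentIn Kᶜ p with hU
  have hUo : IsOpen U := hK.isClosed.isOpen_compl.connectedComponentIn
  have hpU : p ∈ U := mem_connectedComponentIn hp
  obtain ⟨φ, hφ, he⟩ := hl
  obtain ⟨Φ, hΦ⟩ := ContinuousMap.exists_restrict_eq hK.isClosed
    (⟨K.domRestrict φ, continuousOn_iff_continuous_domRestrict.1 hφ⟩ : C(K, ℂ))
  have hΦK : ∀ z ∈ K, Φ z = φ z := fun z hz => by
    have := DFunLike.congr_fun hΦ ⟨z, hz⟩
    exact this
  let h : ℂ → ℂ := fun z => if z ∈ closure U then Complex.exp (Φ z) / g z else (z - p) ^ k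
  have hout : ∀ z ∈ Uᶜ, h z = (z - p) ^ k := by
    intro z hz
    by_cases hzc : z ∈ closure U
    · have hzK : z ∈ K := (closure_component_subset hK.isClosed p hzc).resolve_left hz
      simp only [h, if_pos hzc]
      rw [hΦK z hzK, he z hzK, mul_div_cancel_right₀ _ (hg0 z hzc)]
    · simp only [h, if_neg hzc]
  have hsub : ∀ z ∈ Uᶜ, z - p ≠ 0 := fun z hz h0 => hz (sub_eq_zero.1 h0 ▸ hpU)
  have hc : Continuous h := by
    rw [← continuousOn_univ, show (univ : Set ℂ) = closure U ∪ Uᶜ from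
      (eq_univ_of_forall fun z => (em (z ∈ U)).imp (fun hz => subset_closure hz) id).symm]
    refine ContinuousOn.union_of_isClosed ?_ ?_ isClosed_closure hUo.isClosed_compl
    · refine ContinuousOn.congr (f := fun z => Complex.exp (Φ z) / g z)
        (ContinuousOn.div (by fun_prop) hg hg0) fun z hz => by simp only [h, if_pos hz]
    · refine ContinuousOn.congr (f := fun z => (z - p) ^ k)
        (ContinuousOn.zpow₀ (by fun_prop) k fun z hz => Or.inl (hsub z hz)) hout
  have hne : ∀ z, h z ≠ 0 := by
    intro z
    by_cases hz : z ∈ closure U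
    · simp only [h, if_pos hz]
      exact div_ne_zero (Complex.exp_ne_zero _) (hg0 z hz)
    · rw [hout z fun h => hz (subset_closure h)]
      exact zpow_ne_zero _ (hsub z fun h => hz (subset_closure h))
  obtain ⟨R, hR⟩ := hb.subset_ball p
  refine zpow_eq_zero_of_log hc hne (p := p) (R := max R 1) (by positivity) fun z hz => hout z ?_
  intro hzU
  have := hR hzU
  rw [Metric.mem_ball, dist_eq_norm, hz] at this
  exact absurd this (not_lt.2 (le_max_left _ _))

theorem linked_of_norm_gt {K : Set ℂ} {R : ℝ} (hR : ∀ z ∈ K, ‖z‖ ≤ R) (hR0 : 0 ≤ R) {p q : ℂ}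
    (hp : R < ‖p‖) (hq : R < ‖q‖) : Linked K p q := by
  refine ⟨(fun x : ℝ × ℝ => (x.1 : ℂ) * Complex.exp (x.2 * Complex.I)) '' (Ioi R ×ˢ univ),
    ((isPreconnected_Ioi.prod isPreconnected_univ).image _ (by fun_prop)),
    ⟨(‖p‖, p.arg), ⟨hp, mem_univ _⟩, Complex.norm_mul_exp_arg_mul_I p⟩,
    ⟨(‖q‖, q.arg), ⟨hq, mem_univ _⟩, Complex.norm_mul_exp_arg_mul_I q⟩, ?_⟩
  rw [disjoint_left]
  rintro _ ⟨⟨r, t⟩, ⟨hr, -⟩, rfl⟩ hz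
  have := hR _ hz
  rw [mem_Ioi] at hr
  simp only [norm_mul, Complex.norm_real, Complex.norm_exp_ofReal_mul_I, mul_one,
    Real.norm_eq_abs, abs_of_pos (hR0.trans_lt hr)] at this
  linarith

theorem exists_norm_gt {s : Set ℂ} (hs : ¬ Bornology.IsBounded s) (R : ℝ) : ∃ z ∈ s, R < ‖z‖ := by
  by_contra! h
  exact hs ((isBounded_iff_forall_norm_le).2 ⟨R, h⟩)

theorem linked_of_hasLog {K : Set ℂ} (hK : IsCompact K) {p q : ℂ} (hp : p ∉ K) (hq : q ∉ K)
    (h : HasLog K fun z => (z - p) / (z - q)) : Linked K p q := by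
  have key : ∀ p q, p ∉ K → q ∉ K → HasLog K (fun z => (z - p) / (z - q)) →
      Bornology.IsBounded (connectedComponentIn Kᶜ p) → Linked K p q := by
    intro p q hp hq h hb
    by_contra hn
    have hqc : ∀ z ∈ closure (connectedComponentIn Kᶜ p), z - q ≠ 0 := by
      intro z hz h0
      rw [sub_eq_zero.1 h0] at hz
      exact (closure_component_subset hK.isClosed p hz).elim
        (fun h => hn (Linked.of_mem_component h)) hq
    have := exponent_eq_zero_of_hasLog hK hp hb (g := fun z => (z - q)⁻¹) (k := 1)
      (ContinuousOn.inv₀ (by fun_prop) hqc) (fun z hz => inv_ne_zero (hqc z hz))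
      (h.congr fun z _ => by simp [div_eq_mul_inv])
    exact one_ne_zero this
  by_cases hbp : Bornology.IsBounded (connectedComponentIn Kᶜ p)
  · exact key p q hp hq h hbp
  by_cases hbq : Bornology.IsBounded (connectedComponentIn Kᶜ q)
  · exact (key q p hq hp (h.inv.congr fun z _ => inv_div _ _) hbq).symm
  obtain ⟨R, hR⟩ := isBounded_iff_forall_norm_le.1 hK.isBounded
  obtain ⟨p', hp', hpR⟩ := exists_norm_gt hbp (max R 0)
  obtain ⟨q', hq', hqR⟩ := exists_norm_gt hbq (max R 0)
  exact ((Linked.of_mem_component hp').trans (linked_of_norm_gt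
    (fun z hz => (hR z hz).trans (le_max_left _ _)) (le_max_right _ _) hpR hqR)).trans
    (Linked.of_mem_component hq').symm

theorem HasLog.union {X : Type*} [TopologicalSpace X] {A B : Set X} {f : X → ℂ}
    (hA : IsClosed A) (hB : IsClosed B) (hAB : IsPreconnected (A ∩ B)) (h : HasLog A f)
    (h' : HasLog B f) : HasLog (A ∪ B) f := by
  obtain ⟨φ, hφ, hf⟩ := h
  obtain ⟨ψ, hψ, hf'⟩ := h'
  obtain ⟨c, hc, hc1⟩ : ∃ c : ℂ, (∀ z ∈ A ∩ B, φ z = ψ z + c) ∧ Complex.exp c = 1 := by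
    rcases (A ∩ B).eq_empty_or_nonempty with he | ⟨w, hw⟩
    · exact ⟨0, by simp [he], Complex.exp_zero⟩
    have h1 : ∀ z ∈ A ∩ B, Complex.exp (φ z - ψ z) = 1 := fun z hz => by
      rw [Complex.exp_sub, hf z hz.1, hf' z hz.2, div_self]
      rw [← hf z hz.1]; exact Complex.exp_ne_zero _
    refine ⟨φ w - ψ w, fun z hz => ?_, h1 w hw⟩
    have := eq_of_exp_eq_const hAB (φ := fun z => φ z - ψ z)
      ((hφ.mono inter_subset_left).sub (hψ.mono inter_subset_right)) h1 hz hw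
    linear_combination this
  have hon : ∀ z ∈ B, (if z ∈ A then φ z else ψ z + c) = ψ z + c := fun z hz => by
    split_ifs with hzA
    · exact hc z ⟨hzA, hz⟩
    · rfl
  refine ⟨fun z => if z ∈ A then φ z else ψ z + c, ContinuousOn.union_of_isClosed
    (hφ.congr fun z hz => if_pos hz) ((hψ.add continuousOn_const).congr hon) hA hB, ?_⟩
  rintro z (hz | hz)
  · simp only [if_pos hz]
    exact hf z hz
  · simp only [hon z hz]
    rw [Complex.exp_add, hc1, mul_one, hf' z hz]

/-- **Janiszewski's theorem**. -/
theorem janiszewski {A B : Set ℂ} (hA : IsCompact A) (hB : IsCompact B)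
    (hAB : IsPreconnected (A ∩ B)) {p q : ℂ} (h : Linked A p q) (h' : Linked B p q) :
    Linked (A ∪ B) p q :=
  linked_of_hasLog (hA.union hB) (by simp [h.left_notMem, h'.left_notMem])
    (by simp [h.right_notMem, h'.right_notMem])
    ((hasLog_of_linked hA.isClosed h).union hA.isClosed hB.isClosed hAB
      (hasLog_of_linked hB.isClosed h'))

end PlaneTopology

section PlaneTopology

open Set Topology Filter

theorem continuousOn_image_of_comp {X Y Z : Type*} [TopologicalSpace X] [TopologicalSpace Y]
    [T2Space Y] [TopologicalSpace Z] {I : Set X} (hI : IsCompact I) {γ : X → Y} {φ : Y → Z}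
    (hγ : ContinuousOn γ I) (h : ContinuousOn (φ ∘ γ) I) : ContinuousOn φ (γ '' I) := by
  rw [continuousOn_iff_isClosed]
  intro t ht
  obtain ⟨u, hu, hut⟩ := continuousOn_iff_isClosed.1 h t ht
  have hc : IsCompact ((φ ∘ γ) ⁻¹' t ∩ I) := by
    rw [hut, inter_comm]; exact hI.inter_right hu
  refine ⟨γ '' ((φ ∘ γ) ⁻¹' t ∩ I), (hc.image_of_continuousOn
    (hγ.mono inter_subset_right)).isClosed, ?_⟩
  ext y
  constructor
  · rintro ⟨hy, x, hx, rfl⟩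
    exact ⟨⟨x, ⟨hy, hx⟩, rfl⟩, x, hx, rfl⟩
  · rintro ⟨⟨x, ⟨hx, hxI⟩, rfl⟩, h⟩
    exact ⟨hx, h⟩

theorem hasLog_arc {X : Type*} [TopologicalSpace X] [T2Space X] {γ : ℝ → X} {a b : ℝ}
    (hab : a ≤ b) (hγ : ContinuousOn γ (Icc a b)) (hi : InjOn γ (Icc a b)) {f : X → ℂ}
    (hf : ContinuousOn f (γ '' Icc a b)) (h0 : ∀ z ∈ γ '' Icc a b, f z ≠ 0) :
    HasLog (γ '' Icc a b) f := by
  have hc : ContinuousOn (f ∘ γ) (Icc a b) := hf.comp hγ (mapsTo_image _ _)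
  obtain ⟨ψ, hψ, he⟩ := exists_log (g := IccExtend hab ((Icc a b).domRestrict (f ∘ γ)))
    ((continuousOn_iff_continuous_domRestrict.1 hc).Icc_extend') (fun x => by
      simp only [IccExtend, Function.comp, domRestrict_apply]
      exact h0 _ (mem_image_of_mem _ (projIcc a b hab x).2))
  have hinv : ∀ t ∈ Icc a b, Function.invFunOn γ (Icc a b) (γ t) = t := fun t ht =>
    hi.leftInvOn_invFunOn ht
  refine ⟨fun z => ψ (Function.invFunOn γ (Icc a b) z), continuousOn_image_of_comp isCompact_Icc hγ
    (hψ.continuousOn.congr fun t ht => by simp [hinv t ht]), ?_⟩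
  rintro _ ⟨t, ht, rfl⟩
  simp only [hinv t ht, he]
  rw [IccExtend_of_mem hab _ ht]
  rfl

/-- A compact plane set with connected complement. -/
def NonSep (K : Set ℂ) : Prop :=
  IsCompact K ∧ ∀ p q, p ∉ K → q ∉ K → Linked K p q

theorem NonSep.union {A B : Set ℂ} (hA : NonSep A) (hB : NonSep B)
    (hAB : IsPreconnected (A ∩ B)) : NonSep (A ∪ B) :=
  ⟨hA.1.union hB.1, fun p q hp hq => janiszewski hA.1 hB.1 hAB
    (hA.2 p q (fun h => hp (Or.inl h)) fun h => hq (Or.inl h))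
    (hB.2 p q (fun h => hp (Or.inr h)) fun h => hq (Or.inr h))⟩

theorem nonSep_arc {γ : ℝ → ℂ} {a b : ℝ} (hab : a ≤ b) (hγ : ContinuousOn γ (Icc a b))
    (hi : InjOn γ (Icc a b)) : NonSep (γ '' Icc a b) := by
  have hc := isCompact_Icc.image_of_continuousOn hγ
  refine ⟨hc, fun p q hp hq => linked_of_hasLog hc hp hq (hasLog_arc hab hγ hi
    (ContinuousOn.div (by fun_prop) (by fun_prop) ?_) ?_)⟩
  · intro z hz h0
    exact hq (sub_eq_zero.1 h0 ▸ hz)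
  · intro z hz
    exact div_ne_zero (fun h0 => hp (sub_eq_zero.1 h0 ▸ hz)) (fun h0 => hq (sub_eq_zero.1 h0 ▸ hz))

/-- If removing a small piece of `K` around `x` links `p` and `q`, then `x` is a limit of points
linked to `p`. -/
theorem exists_linked_near {K : Set ℂ} (hK : IsClosed K) {x p q : ℂ} (hp : p ∉ K)
    (hpq : ¬ Linked K p q)
    (h : ∀ ε > 0, ∃ K' ⊆ K, K \ K' ⊆ Metric.ball x ε ∧ Linked K' p q) {ε : ℝ} (hε : 0 < ε) :
    ∃ y ∈ Metric.ball x ε, Linked K y p := by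
  by_contra! hn
  obtain ⟨K', hK', hb, S, hS, hpS, hqS, hd⟩ := h ε hε
  have hU : IsOpen (connectedComponentIn Kᶜ p) := hK.isOpen_compl.connectedComponentIn
  have hsub : S ⊆ connectedComponentIn Kᶜ p := by
    refine hS.subset_of_closure_inter_subset hU ⟨p, hpS, mem_connectedComponentIn hp⟩ ?_
    rintro z ⟨hz, hzS⟩
    refine (closure_component_subset hK p hz).resolve_right fun hzK => ?_
    have hzb : z ∈ Metric.ball x ε := hb ⟨hzK, fun h => disjoint_left.1 hd hzS h⟩
    obtain ⟨y, hy, hy'⟩ := mem_closure_iff.1 hz _ Metric.isOpen_ball hzb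
    exact hn y hy (Linked.of_mem_component hy').symm
  exact hpq (Linked.of_mem_component (hsub hqS))

/-- A segment attached to a connected compact set separates the two sides of its midpoint. -/
theorem not_linked_of_segment {R : Set ℂ} (hR : IsCompact R) (hRc : IsPreconnected R) {m v : ℂ}
    (hv : v ≠ 0) (h1 : m + v ∈ R) (h2 : m - v ∈ R) {ε : ℝ} (hε : 0 < ε)
    (hb : ∀ z ∈ R, ε * ‖v‖ < ‖z - m‖) :
    ¬ Linked (R ∪ (fun s : ℝ => m + s * v) '' Icc (-1) 1)
      (m + ε * Complex.I * v) (m - ε * Complex.I * v) := by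
  intro hl
  have hcL : IsCompact ((fun s : ℝ => m + s * v) '' Icc (-1 : ℝ) 1) :=
    isCompact_Icc.image (by fun_prop)
  obtain ⟨φ, hφ, he⟩ := hasLog_of_linked (hR.union hcL).isClosed hl
  set F : ℂ → ℂ := fun z => (z - (m + ε * Complex.I * v)) / (z - (m - ε * Complex.I * v)) with hF
  -- the scaled coordinate
  have hFζ : ∀ ζ : ℂ, F (m + ζ * v) = (ζ - ε * Complex.I) / (ζ + ε * Complex.I) := by
    intro ζ
    simp only [hF]
    rw [show m + ζ * v - (m + ε * Complex.I * v) = (ζ - ε * Complex.I) * v by ring,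
      show m + ζ * v - (m - ε * Complex.I * v) = (ζ + ε * Complex.I) * v by ring,
      mul_div_mul_right _ _ hv]
  have hnorm : ∀ ζ : ℂ, ε < ‖ζ‖ → 0 < ((ζ - ε * Complex.I) / (ζ + ε * Complex.I)).re ∧
      ζ + ε * Complex.I ≠ 0 := by
    intro ζ hζ
    have hne : ζ + ε * Complex.I ≠ 0 := by
      intro h0
      rw [eq_neg_of_add_eq_zero_left h0] at hζ
      simp [abs_of_pos hε] at hζ
    refine ⟨?_, hne⟩
    have hsq : ε ^ 2 < ζ.re * ζ.re + ζ.im * ζ.im := by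
      have h3 : ‖ζ‖ ^ 2 = ζ.re * ζ.re + ζ.im * ζ.im := by
        rw [← Complex.normSq_eq_norm_sq, Complex.normSq_apply]
      rw [← h3]
      exact pow_lt_pow_left₀ hζ hε.le two_ne_zero
    rw [Complex.div_re, ← add_div]
    apply div_pos _ (Complex.normSq_pos.2 hne)
    simp
    nlinarith
  have hζR : ∀ z ∈ R, ε < ‖(z - m) / v‖ := fun z hz => by
    rw [norm_div, lt_div_iff₀ (norm_pos_iff.2 hv)]; exact hb z hz
  have hzζ : ∀ z, m + (z - m) / v * v = z := fun z => by field_simp; ring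
  have hreR : ∀ z ∈ R, 0 < (F z).re := fun z hz => by
    rw [← hzζ z, hFζ]; exact (hnorm _ (hζR z hz)).1
  have hdR : ∀ z ∈ R, z - (m - ε * Complex.I * v) ≠ 0 := fun z hz h0 => by
    have h3 := (hreR z hz)
    simp [hF, h0] at h3
  have eq1 := eq_of_exp_eq_const hRc (φ := fun z => φ z - Complex.log (F z)) (c := 1)
    ((hφ.mono subset_union_left).sub (ContinuousOn.clog
      (ContinuousOn.div (by fun_prop) (by fun_prop) hdR) fun z hz => Or.inl (hreR z hz)))
    (fun z hz => by
      have hne : F z ≠ 0 := fun h0 => by have := hreR z hz; simp [h0] at this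
      rw [Complex.exp_sub, he z (Or.inl hz), Complex.exp_log hne]
      exact div_self hne) h1 h2
  have hs1 : ∀ s : ℝ, (s : ℂ) - ε * Complex.I ∈ Complex.slitPlane := fun s =>
    Or.inr (by simpa using hε.ne')
  have hs2 : ∀ s : ℝ, (s : ℂ) + ε * Complex.I ∈ Complex.slitPlane := fun s =>
    Or.inr (by simpa using hε.ne')
  have eq2 := eq_of_exp_eq_const (isPreconnected_Icc (a := (-1 : ℝ)) (b := 1))
    (φ := fun s : ℝ => φ (m + s * v) -
      (Complex.log (s - ε * Complex.I) - Complex.log (s + ε * Complex.I))) (c := 1)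
    ((hφ.comp (f := fun s : ℝ => m + s * v) (by fun_prop)
      fun s hs => Or.inr (mem_image_of_mem _ hs)).sub
      ((ContinuousOn.clog (by fun_prop) fun s _ => hs1 s).sub
        (ContinuousOn.clog (by fun_prop) fun s _ => hs2 s)))
    (fun s hs => by
      have e1 := he (m + s * v) (Or.inr (mem_image_of_mem _ hs))
      rw [Complex.exp_sub, Complex.exp_sub, Complex.exp_log (Complex.slitPlane_ne_zero (hs1 s)),
        Complex.exp_log (Complex.slitPlane_ne_zero (hs2 s)), e1]
      change F (m + s * v) / _ = 1
      rw [hFζ]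
      exact div_self (div_ne_zero (Complex.slitPlane_ne_zero (hs1 s))
        (Complex.slitPlane_ne_zero (hs2 s))))
    (right_mem_Icc.2 (by norm_num)) (left_mem_Icc.2 (by norm_num))
  set z1 : ℂ := 1 + ε * Complex.I with hz1
  set z2 : ℂ := 1 - ε * Complex.I with hz2
  have hz10 : z1 ≠ 0 := by simpa using Complex.slitPlane_ne_zero (hs2 1)
  have hz20 : z2 ≠ 0 := by simpa using Complex.slitPlane_ne_zero (hs1 1)
  have hl1 : Complex.log (-z1) = Complex.log z1 - Real.pi * Complex.I := by
    rw [Complex.log, Complex.log, norm_neg,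
      Complex.arg_neg_eq_arg_sub_pi_of_im_pos (by simpa [hz1] using hε)]
    push_cast; ring
  have hl2 : Complex.log (-z2) = Complex.log z2 + Real.pi * Complex.I := by
    rw [Complex.log, Complex.log, norm_neg,
      Complex.arg_neg_eq_arg_add_pi_of_im_neg (by simpa [hz2] using hε)]
    push_cast; ring
  have ha1 : |(Complex.log z1).im| < Real.pi / 2 := by
    rw [Complex.log_im]
    exact Complex.abs_arg_lt_pi_div_two_iff.2 (Or.inl (by simp [hz1]))
  have ha2 : |(Complex.log z2).im| < Real.pi / 2 := by
    rw [Complex.log_im]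
    exact Complex.abs_arg_lt_pi_div_two_iff.2 (Or.inl (by simp [hz2]))
  rw [abs_lt] at ha1 ha2
  have hq1 : Complex.log (z2 / z1) = Complex.log z2 - Complex.log z1 := by
    conv_lhs => rw [← Complex.exp_log hz10, ← Complex.exp_log hz20, ← Complex.exp_sub]
    apply Complex.log_exp <;> simp only [Complex.sub_im] <;> linarith
  have hq2 : Complex.log (z1 / z2) = Complex.log z1 - Complex.log z2 := by
    conv_lhs => rw [← Complex.exp_log hz10, ← Complex.exp_log hz20, ← Complex.exp_sub]
    apply Complex.log_exp <;> simp only [Complex.sub_im] <;> linarith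
  have hF1 : F (m + v) = z2 / z1 := by
    have := hFζ 1
    rwa [one_mul] at this
  have hF2 : F (m - v) = z1 / z2 := by
    have := hFζ (-1)
    rw [show m + -1 * v = m - v by ring] at this
    rw [this, show -1 - (ε : ℂ) * Complex.I = -z1 by rw [hz1]; ring,
      show -1 + (ε : ℂ) * Complex.I = -z2 by rw [hz2]; ring, neg_div_neg_eq]
  simp only [hF1, hF2, hq1, hq2] at eq1
  push_cast at eq2
  rw [show (-1 : ℂ) - ε * Complex.I = -z1 by rw [hz1]; ring,
    show -1 + (ε : ℂ) * Complex.I = -z2 by rw [hz2]; ring, hl1, hl2, ← hz1, ← hz2,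
    show m + 1 * v = m + v by ring, show m + -1 * v = m - v by ring] at eq2
  have h3 : (2 : ℂ) * (Real.pi * Complex.I) = 0 := by linear_combination eq1 - eq2
  simp [Real.pi_ne_zero] at h3

end PlaneTopology

section PlaneTopology

open Set Topology Filter

/-- A periodic parametrization of a simple closed curve. -/
structure JordanParam {X : Type*} [TopologicalSpace X] (Γ : ℝ → X) (N : ℝ) : Prop where
  cont : Continuous Γ
  pos : 0 < N
  eq_iff : ∀ s t, Γ s = Γ t ↔ ∃ k : ℤ, s - t = k * N

namespace JordanParam

section General

variable {X : Type*} [TopologicalSpace X] {Γ : ℝ → X} {N : ℝ}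

theorem comp {Y : Type*} [TopologicalSpace Y] (h : JordanParam Γ N) (e : X ≃ₜ Y) :
    JordanParam (fun t => e (Γ t)) N :=
  ⟨e.continuous.comp h.cont, h.pos, fun s t => by rw [e.injective.eq_iff, h.eq_iff]⟩

theorem add_int_mul (h : JordanParam Γ N) (t : ℝ) (k : ℤ) : Γ (t + k * N) = Γ t :=
  (h.eq_iff _ _).2 ⟨k, by ring⟩

theorem periodic (h : JordanParam Γ N) (t : ℝ) : Γ (t + N) = Γ t := by
  simpa using h.add_int_mul t 1

theorem eq_of_lt (h : JordanParam Γ N) {s t : ℝ} (hst : Γ s = Γ t) (hlt : |s - t| < N) :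
    s = t := by
  obtain ⟨k, hk⟩ := (h.eq_iff s t).1 hst
  have hN := h.pos
  rw [hk, abs_mul, abs_of_pos hN] at hlt
  have : |(k : ℝ)| < 1 := by nlinarith
  have hk0 : k = 0 := Int.abs_lt_one_iff.1 (by exact_mod_cast this)
  rw [hk0] at hk
  simpa [sub_eq_zero] using hk

theorem injOn (h : JordanParam Γ N) {s t : ℝ} (hst : t - s < N) : InjOn Γ (Icc s t) := by
  intro x hx y hy hxy
  exact h.eq_of_lt hxy (abs_lt.2 ⟨by linarith [hx.1, hy.2], by linarith [hx.2, hy.1]⟩)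

theorem exists_mem_Ico (h : JordanParam Γ N) (a t : ℝ) : ∃ s ∈ Ico a (a + N), Γ s = Γ t := by
  obtain ⟨k, hk, -⟩ := existsUnique_add_zsmul_mem_Ico h.pos t a
  exact ⟨t + k • N, hk, by rw [zsmul_eq_mul, h.add_int_mul]⟩

theorem image_Icc (h : JordanParam Γ N) (a : ℝ) : Γ '' Icc a (a + N) = range Γ := by
  apply (image_subset_range _ _).antisymm
  rintro _ ⟨t, rfl⟩
  obtain ⟨s, hs, he⟩ := h.exists_mem_Ico a t
  exact ⟨s, Ico_subset_Icc_self hs, he⟩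

theorem isCompact (h : JordanParam Γ N) : IsCompact (range Γ) := by
  rw [← h.image_Icc 0]
  exact isCompact_Icc.image h.cont

theorem range_eq_union (h : JordanParam Γ N) {a b : ℝ} (hab : a ≤ b) (hb : b ≤ a + N) :
    range Γ = Γ '' Icc a b ∪ Γ '' Icc b (a + N) := by
  rw [← image_union, Icc_union_Icc_eq_Icc hab hb, h.image_Icc]

/-- A point of an open sub-arc is not on the complementary closed arc. -/
theorem notMem_image (h : JordanParam Γ N) {a b t : ℝ} (ht : t ∈ Ioo a b) :
    Γ t ∉ Γ '' Icc b (a + N) := by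
  rintro ⟨s, hs, hst⟩
  have := h.eq_of_lt hst (abs_lt.2 ⟨by linarith [ht.1, ht.2, hs.1, hs.2],
    by linarith [ht.1, ht.2, hs.1, hs.2]⟩)
  linarith [ht.2, hs.1]

theorem inter_arcs (h : JordanParam Γ N) {a b : ℝ} (hab : a < b) (hb : b < a + N) :
    Γ '' Icc a b ∩ Γ '' Icc b (a + N) = {Γ a, Γ b} := by
  apply Subset.antisymm
  · rintro _ ⟨⟨t, ht, rfl⟩, h2⟩
    rcases ht.1.eq_or_lt with rfl | h3
    · exact Or.inl rfl
    rcases ht.2.eq_or_lt with rfl | h4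
    · exact Or.inr rfl
    exact absurd h2 (h.notMem_image ⟨h3, h4⟩)
  · rintro _ (rfl | rfl)
    · exact ⟨⟨a, ⟨le_rfl, hab.le⟩, rfl⟩, a + N, ⟨hb.le, le_rfl⟩, h.periodic a⟩
    · exact ⟨⟨b, ⟨hab.le, le_rfl⟩, rfl⟩, b, ⟨le_rfl, hb.le⟩, rfl⟩

/-- Near a curve point, all but a small arc of the curve can be kept. -/
theorem exists_small_arc (h : JordanParam Γ N) (t : ℝ) {W : Set X} (hW : W ∈ 𝓝 (Γ t))
    {r : ℝ} (hr : 0 < r) : ∃ δ > 0, δ < r ∧ Γ '' Ioo (t - δ) (t + δ) ⊆ W := by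
  obtain ⟨δ, hδ, hb⟩ := Metric.mem_nhds_iff.1 (h.cont.continuousAt hW)
  refine ⟨min δ (r / 2), by positivity, (min_le_right _ _).trans_lt (by linarith), ?_⟩
  rintro _ ⟨s, hs, rfl⟩
  apply hb
  rw [Real.ball_eq_Ioo]
  exact ⟨by linarith [hs.1, min_le_left δ (r / 2)], by linarith [hs.2, min_le_left δ (r / 2)]⟩

end General

variable {Γ : ℝ → ℂ} {N : ℝ}

theorem nonSep (h : JordanParam Γ N) {a b : ℝ} (hab : a ≤ b) (hb : b - a < N) :
    NonSep (Γ '' Icc a b) :=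
  nonSep_arc hab h.cont.continuousOn (h.injOn hb)

theorem hasLog_of_lift (h : JordanParam Γ N) {ψ : ℝ → ℂ} (hψ : Continuous ψ)
    (hp : ∀ t, ψ (t + N) = ψ t) {f : ℂ → ℂ} (he : ∀ t, Complex.exp (ψ t) = f (Γ t)) :
    HasLog (range Γ) f := by
  have hper : Function.Periodic ψ N := hp
  have hinv : ∀ t, ψ (Function.invFun Γ (Γ t)) = ψ t := by
    intro t
    obtain ⟨k, hk⟩ := (h.eq_iff _ _).1 (Function.invFun_eq (f := Γ) ⟨t, rfl⟩)
    rw [sub_eq_iff_eq_add'.1 hk]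
    exact hper.int_mul k t
  refine ⟨fun z => ψ (Function.invFun Γ z), ?_, ?_⟩
  · rw [← h.image_Icc 0]
    exact continuousOn_image_of_comp isCompact_Icc h.cont.continuousOn
      (hψ.continuousOn.congr fun t _ => by simp [hinv t])
  · rintro _ ⟨t, rfl⟩
    simp [hinv t, he t]

/-- The winding number, via a logarithm along the parametrization. -/
theorem exists_degree (h : JordanParam Γ N) {p : ℂ} (hp : p ∉ range Γ) :
    ∃ (ψ : ℝ → ℂ) (d : ℤ), Continuous ψ ∧ (∀ t, Complex.exp (ψ t) = Γ t - p) ∧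
      ∀ t, ψ (t + N) = ψ t + d * (2 * Real.pi * Complex.I) := by
  have h0 : ∀ t, Γ t - p ≠ 0 := fun t h0 => hp ⟨t, sub_eq_zero.1 h0⟩
  obtain ⟨ψ, hψ, he⟩ := exists_log (g := fun t => Γ t - p) (h.cont.sub continuous_const) h0
  have h1 : ∀ t, Complex.exp (ψ (t + N) - ψ t) = 1 := fun t => by
    rw [Complex.exp_sub, he, he, h.periodic, div_self (h0 t)]
  obtain ⟨d, hd⟩ := Complex.exp_eq_one_iff.1 (h1 0)
  refine ⟨ψ, d, hψ, he, fun t => ?_⟩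
  have := eq_of_exp_eq_const isPreconnected_univ (φ := fun t => ψ (t + N) - ψ t)
    (by fun_prop) (fun t _ => h1 t) (mem_univ t) (mem_univ 0)
  linear_combination this + hd

theorem linked_of_bounded (h : JordanParam Γ N) {p q : ℂ} (hp : p ∉ range Γ) (hq : q ∉ range Γ)
    (hbp : Bornology.IsBounded (connectedComponentIn (range Γ)ᶜ p))
    (hbq : Bornology.IsBounded (connectedComponentIn (range Γ)ᶜ q)) : Linked (range Γ) p q := by
  by_contra hn
  obtain ⟨ψ, d, hψ, he, hd⟩ := h.exists_degree hp
  obtain ⟨ψ', d', hψ', he', hd'⟩ := h.exists_degree hq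
  have hqc : ∀ z ∈ closure (connectedComponentIn (range Γ)ᶜ p), z - q ≠ 0 := by
    intro z hz h0
    rw [sub_eq_zero.1 h0] at hz
    exact (closure_component_subset h.isCompact.isClosed p hz).elim
      (fun h => hn (Linked.of_mem_component h)) hq
  have h1 : d' = 0 := by
    refine exponent_eq_zero_of_hasLog h.isCompact hp hbp (g := fun z => (z - q) ^ (-d))
      (ContinuousOn.zpow₀ (by fun_prop) _ fun z hz => Or.inl (hqc z hz))
      (fun z hz => zpow_ne_zero _ (hqc z hz))
      (h.hasLog_of_lift (ψ := fun t => d' * ψ t + (-d : ℤ) * ψ' t) (by fun_prop) ?_ ?_)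
    · intro t
      simp only [hd, hd']
      push_cast; ring
    · intro t
      rw [Complex.exp_add, Complex.exp_int_mul, Complex.exp_int_mul, he, he']
  refine one_ne_zero (exponent_eq_zero_of_hasLog h.isCompact hq hbq (g := fun _ => 1) (k := 1)
    continuousOn_const (fun _ _ => one_ne_zero) (h.hasLog_of_lift hψ' (fun t => ?_) fun t => ?_))
  · simp [hd', h1]
  · simp [he']

theorem linked_or (h : JordanParam Γ N) {p q r : ℂ} (hr : r ∉ range Γ) (hp : p ∉ range Γ)
    (hq : q ∉ range Γ) (hpq : ¬ Linked (range Γ) p q) :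
    Linked (range Γ) r p ∨ Linked (range Γ) r q := by
  have hunb : ∀ p q, ¬ Bornology.IsBounded (connectedComponentIn (range Γ)ᶜ p) →
      ¬ Bornology.IsBounded (connectedComponentIn (range Γ)ᶜ q) → Linked (range Γ) p q := by
    intro p q hbp hbq
    obtain ⟨R, hR⟩ := isBounded_iff_forall_norm_le.1 h.isCompact.isBounded
    obtain ⟨p', hp', hpR⟩ := exists_norm_gt hbp (max R 0)
    obtain ⟨q', hq', hqR⟩ := exists_norm_gt hbq (max R 0)
    exact ((Linked.of_mem_component hp').trans (linked_of_norm_gt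
      (fun z hz => (hR z hz).trans (le_max_left _ _)) (le_max_right _ _) hpR hqR)).trans
      (Linked.of_mem_component hq').symm
  by_cases hbp : Bornology.IsBounded (connectedComponentIn (range Γ)ᶜ p) <;>
  by_cases hbq : Bornology.IsBounded (connectedComponentIn (range Γ)ᶜ q) <;>
  by_cases hbr : Bornology.IsBounded (connectedComponentIn (range Γ)ᶜ r)
  · exact absurd (h.linked_of_bounded hp hq hbp hbq) hpq
  · exact absurd (h.linked_of_bounded hp hq hbp hbq) hpq
  · exact Or.inl (h.linked_of_bounded hr hp hbr hbp)
  · exact Or.inr (hunb r q hbr hbq)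
  · exact Or.inr (h.linked_of_bounded hr hq hbr hbq)
  · exact Or.inl (hunb r p hbr hbp)
  · exact absurd (hunb p q hbp hbq) hpq
  · exact absurd (hunb p q hbp hbq) hpq

theorem linked_near (h : JordanParam Γ N) {p q : ℂ} (hp : p ∉ range Γ) (hq : q ∉ range Γ)
    (hpq : ¬ Linked (range Γ) p q) (t : ℝ) {ε : ℝ} (hε : 0 < ε) :
    ∃ y ∈ Metric.ball (Γ t) ε, Linked (range Γ) y p := by
  refine exists_linked_near h.isCompact.isClosed hp hpq (fun ε hε => ?_) hε
  have hN := h.pos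
  obtain ⟨δ, hδ, hδN, hb⟩ := h.exists_small_arc t (Metric.ball_mem_nhds _ hε) (half_pos hN)
  refine ⟨Γ '' Icc (t + δ) (t - δ + N), image_subset_range _ _, ?_, ?_⟩
  · rw [h.range_eq_union (a := t - δ) (b := t + δ) (by linarith) (by linarith), union_sdiff_right]
    rintro _ ⟨⟨s, hs, rfl⟩, hs'⟩
    apply hb
    refine ⟨s, ⟨lt_of_le_of_ne hs.1 ?_, lt_of_le_of_ne hs.2 ?_⟩, rfl⟩
    · rintro rfl
      exact hs' ⟨t - δ + N, ⟨by linarith, le_rfl⟩, h.periodic _⟩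
    · rintro rfl
      exact hs' ⟨t + δ, ⟨le_rfl, by linarith⟩, rfl⟩
  · exact (h.nonSep (by linarith) (by linarith)).2 p q
      (fun hh => hp (image_subset_range _ _ hh)) (fun hh => hq (image_subset_range _ _ hh))

end JordanParam

end PlaneTopology

section PlaneTopology

open Set Topology Filter

namespace JordanParam

variable {Γ : ℝ → ℂ} {N : ℝ}

theorem not_convex (h : JordanParam Γ N) : ¬ Convex ℝ (range Γ) := by
  intro hc
  have hN := h.pos
  obtain ⟨s, hs⟩ := h.isCompact.extremePoints_nonempty (range_nonempty Γ)
  obtain ⟨t, ht, hst⟩ : ∃ t ∈ extremePoints ℝ (range Γ), t ≠ s := by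
    by_contra! hall
    have h1 : extremePoints ℝ (range Γ) = {s} :=
      Subset.antisymm (fun t ht => hall t ht) (singleton_subset_iff.2 hs)
    have h2 := closure_convexHull_extremePoints h.isCompact hc
    rw [h1, convexHull_singleton, closure_singleton] at h2
    have h3 : Γ 0 = Γ (N / 2) := by
      have e1 : Γ 0 ∈ ({s} : Set ℂ) := h2 ▸ mem_range_self _
      have e2 : Γ (N / 2) ∈ ({s} : Set ℂ) := h2 ▸ mem_range_self _
      rw [e1, e2]
    have := h.eq_of_lt h3 (by rw [abs_lt]; constructor <;> linarith)
    linarith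
  have hcs := (hc.mem_extremePoints_iff_convex_sdiff.1 hs).2
  have hct := (hc.mem_extremePoints_iff_convex_sdiff.1 ht).2
  obtain ⟨a, rfl⟩ := hs.1
  obtain ⟨b0, rfl⟩ := ht.1
  obtain ⟨b, hb, hbe⟩ := h.exists_mem_Ico a b0
  rw [← hbe] at hst hct
  have hab : a < b := lt_of_le_of_ne hb.1 (by rintro rfl; exact hst rfl)
  have hpc := (hcs.inter hct).isPreconnected
  have hcl1 : IsClosed (Γ '' Icc a b) := (isCompact_Icc.image h.cont).isClosed
  have hcl2 : IsClosed (Γ '' Icc b (a + N)) := (isCompact_Icc.image h.cont).isClosed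
  have hne : ∀ x y, x < y → y - x < N → Γ x ≠ Γ y := fun x y hxy hlt he => by
    have := h.eq_of_lt he (abs_lt.2 ⟨by linarith, by linarith⟩)
    linarith
  obtain ⟨z, ⟨⟨-, hza⟩, -, hzb⟩, hz1, hz2⟩ := isPreconnected_closed_iff.1 hpc _ _ hcl1 hcl2
    (by rw [← h.range_eq_union hb.1 hb.2.le]; exact fun z hz => hz.1.1)
    ⟨Γ ((a + b) / 2), ⟨⟨mem_range_self _, (hne _ _ (by linarith) (by linarith [hb.2])).symm⟩,
      mem_range_self _, hne _ _ (by linarith) (by linarith [hb.2])⟩,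
      mem_image_of_mem _ ⟨by linarith, by linarith⟩⟩
    ⟨Γ ((b + (a + N)) / 2), ⟨⟨mem_range_self _, (hne _ _ (by linarith [hb.2])
      (by linarith [hb.2])).symm⟩, mem_range_self _, (hne _ _ (by linarith [hb.2])
      (by linarith [hb.2])).symm⟩, mem_image_of_mem _ ⟨by linarith [hb.2], by linarith [hb.2]⟩⟩
  have : z ∈ ({Γ a, Γ b} : Set ℂ) := h.inter_arcs hab hb.2 ▸ ⟨hz1, hz2⟩
  exact this.elim hza hzb

/-- There is a chord of the curve whose interior avoids the curve. -/
theorem exists_chord (h : JordanParam Γ N) : ∃ a b, a < b ∧ b < a + N ∧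
    ∀ s ∈ Ioo (0 : ℝ) 1, AffineMap.lineMap (Γ a) (Γ b) s ∉ range Γ := by
  have hN := h.pos
  have hnc := h.not_convex
  rw [convex_iff_segment_subset] at hnc
  push Not at hnc
  obtain ⟨x, hx, y, hy, hxy⟩ := hnc
  obtain ⟨z, hz, hzJ⟩ := not_subset.1 hxy
  rw [segment_eq_image_lineMap] at hz
  obtain ⟨s0, hs0, rfl⟩ := hz
  set ℓ : ℝ → ℂ := fun s => AffineMap.lineMap x y s with hℓ
  have hℓc : Continuous ℓ := AffineMap.lineMap_continuous
  have hTc : IsClosed (ℓ ⁻¹' range Γ) := h.isCompact.isClosed.preimage hℓc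
  obtain ⟨u, ⟨huT, hu⟩, humax⟩ := ((isCompact_Icc (a := (0 : ℝ)) (b := s0)).inter_left
    hTc).exists_isGreatest ⟨0, by simpa [hℓ] using hx, le_rfl, hs0.1⟩
  obtain ⟨w, ⟨hwT, hw⟩, hwmin⟩ := ((isCompact_Icc (a := s0) (b := (1 : ℝ))).inter_left
    hTc).exists_isLeast ⟨1, by simpa [hℓ] using hy, hs0.2, le_rfl⟩
  have hus : u < s0 := lt_of_le_of_ne hu.2 (by rintro rfl; exact hzJ huT)
  have hsw : s0 < w := lt_of_le_of_ne hw.1 (by rintro rfl; exact hzJ hwT)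
  have hgap : ∀ s ∈ Ioo u w, ℓ s ∉ range Γ := by
    intro s hs hsT
    rcases le_total s s0 with h1 | h1
    · exact absurd (humax ⟨hsT, hu.1.trans hs.1.le, h1⟩) (not_le.2 hs.1)
    · exact absurd (hwmin ⟨hsT, h1, hs.2.le.trans hw.2⟩) (not_le.2 hs.2)
  have hxy' : x ≠ y := by
    rintro rfl
    exact hzJ (by simpa using hx)
  obtain ⟨a, ha⟩ := huT
  obtain ⟨b0, hb0⟩ := hwT
  obtain ⟨b, hb, hbe⟩ := h.exists_mem_Ico a b0
  refine ⟨a, b, lt_of_le_of_ne hb.1 ?_, hb.2, ?_⟩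
  · rintro rfl
    have : ℓ u = ℓ w := by rw [← ha, ← hb0, hbe]
    exact (hus.trans hsw).ne (AffineMap.lineMap_injective ℝ hxy' this)
  · intro s hs
    rw [ha, hbe, hb0]
    have : AffineMap.lineMap (ℓ u) (ℓ w) s = ℓ (u + s * (w - u)) := by
      simp only [hℓ, AffineMap.lineMap_apply_module']
      simp only [Complex.real_smul]
      push_cast; ring
    rw [this]
    exact hgap _ ⟨by nlinarith [hs.1, hs.2], by nlinarith [hs.1, hs.2]⟩

theorem separates (h : JordanParam Γ N) :
    ∃ p q, p ∉ range Γ ∧ q ∉ range Γ ∧ ¬ Linked (range Γ) p q := by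
  by_contra! hns
  have hN := h.pos
  obtain ⟨a, b, hab, hb, hgap⟩ := h.exists_chord
  set m : ℂ := (Γ a + Γ b) / 2 with hm
  set v : ℂ := (Γ b - Γ a) / 2 with hv
  have hv0 : v ≠ 0 := by
    intro h0
    have : Γ b = Γ a := by
      have : Γ b - Γ a = 0 := by simpa [hv] using h0
      exact sub_eq_zero.1 this
    have := h.eq_of_lt this (abs_lt.2 ⟨by linarith, by linarith⟩)
    linarith
  set ℓ : ℝ → ℂ := fun s => m + s * v with hℓ
  have hℓa : ℓ (-1) = Γ a := by simp only [hℓ, hm, hv]; push_cast; ring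
  have hℓb : ℓ 1 = Γ b := by simp only [hℓ, hm, hv]; push_cast; ring
  have hℓc : Continuous ℓ := by fun_prop
  have hℓi : Function.Injective ℓ := by
    intro s t hst
    simpa [hℓ, hv0] using hst
  have hℓJ : ∀ s ∈ Ioo (-1 : ℝ) 1, ℓ s ∉ range Γ := by
    intro s hs
    have := hgap ((s + 1) / 2) ⟨by linarith [hs.1], by linarith [hs.2]⟩
    have he : AffineMap.lineMap (Γ a) (Γ b) ((s + 1) / 2) = ℓ s := by
      simp only [hℓ, hm, hv, AffineMap.lineMap_apply_module', Complex.real_smul]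
      push_cast; ring
    rwa [he] at this
  set L := ℓ '' Icc (-1) 1 with hL
  have hLJ : L ∩ range Γ = {Γ a, Γ b} := by
    apply Subset.antisymm
    · rintro _ ⟨⟨s, hs, rfl⟩, h2⟩
      rcases hs.1.eq_or_lt with rfl | h3
      · exact Or.inl hℓa
      rcases hs.2.eq_or_lt with rfl | h4
      · exact Or.inr hℓb
      exact absurd h2 (hℓJ _ ⟨h3, h4⟩)
    · rintro _ (rfl | rfl)
      · exact ⟨⟨-1, by norm_num, hℓa⟩, mem_range_self _⟩
      · exact ⟨⟨1, by norm_num, hℓb⟩, mem_range_self _⟩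
  have hLns : NonSep L := nonSep_arc (by norm_num) hℓc.continuousOn hℓi.injOn
  set A := Γ '' Icc a b with hA
  set B := Γ '' Icc b (a + N) with hB
  have hJAB : range Γ = A ∪ B := h.range_eq_union hab.le hb.le
  have hAc : IsCompact A := isCompact_Icc.image h.cont
  have hBc : IsCompact B := isCompact_Icc.image h.cont
  have hAp : IsPreconnected A := isPreconnected_Icc.image _ h.cont.continuousOn
  have hBp : IsPreconnected B := isPreconnected_Icc.image _ h.cont.continuousOn
  have haA : Γ a ∈ A := ⟨a, ⟨le_rfl, hab.le⟩, rfl⟩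
  have hbA : Γ b ∈ A := ⟨b, ⟨hab.le, le_rfl⟩, rfl⟩
  have haB : Γ a ∈ B := ⟨a + N, ⟨hb.le, le_rfl⟩, h.periodic a⟩
  have hbB : Γ b ∈ B := ⟨b, ⟨le_rfl, hb.le⟩, rfl⟩
  have key : ∀ D, D ⊆ range Γ → IsCompact D → IsPreconnected D → Γ a ∈ D → Γ b ∈ D → ∀ p q,
      p ∉ range Γ → q ∉ range Γ → Linked (D ∪ L) p q → Linked (range Γ ∪ L) p q := by
    intro D hD hDc hDp ha hb p q hp hq hl
    have h_int : (D ∪ L) ∩ range Γ = D := by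
      rw [union_inter_distrib_right, hLJ, inter_eq_left.2 hD, union_eq_left]
      rintro _ (rfl | rfl) <;> assumption
    have := janiszewski (hDc.union hLns.1) h.isCompact (by rwa [h_int]) hl (hns p q hp hq)
    exact this.mono (by
      rintro z (hz | hz)
      · exact Or.inr hz
      · exact Or.inl (Or.inr hz))
  have hAJ : A ⊆ range Γ := image_subset_range _ _
  have hBJ : B ⊆ range Γ := image_subset_range _ _
  have keyA := key A hAJ hAc hAp haA hbA
  have keyB := key B hBJ hBc hBp haB hbB
  -- midpoints of the two arcs
  set sa := (a + b) / 2 with hsa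
  set sb := (b + (a + N)) / 2 with hsb
  have hendp : ∀ s ∈ Icc (-1 : ℝ) 1, ∀ t, Γ t ≠ Γ a → Γ t ≠ Γ b → ℓ s ≠ Γ t := by
    intro s hs t h1 h2 he
    have : Γ t ∈ ({Γ a, Γ b} : Set ℂ) := hLJ ▸ ⟨⟨s, hs, he⟩, mem_range_self _⟩
    exact this.elim h1 h2
  have hneq : ∀ {x y : ℝ}, x < y → y - x < N → Γ x ≠ Γ y := fun hxy hlt he => by
    have := h.eq_of_lt he (abs_lt.2 ⟨by linarith, by linarith⟩)
    linarith
  have hsaB : Γ sa ∉ B ∪ L := by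
    rintro (hz | ⟨s, hs, hz⟩)
    · exact h.notMem_image (a := a) (b := b) ⟨by linarith, by linarith⟩ hz
    · exact hendp s hs sa (hneq (by linarith) (by linarith)).symm
        (hneq (by linarith) (by linarith)) hz
  have hsbA : Γ sb ∉ A ∪ L := by
    rintro (hz | ⟨s, hs, hz⟩)
    · refine h.notMem_image (a := b) (b := a + N) (t := sb) ⟨by linarith, by linarith⟩ ?_
      obtain ⟨t, ht, hte⟩ := hz
      exact ⟨t + N, ⟨by linarith [ht.1], by linarith [ht.2]⟩, by rw [h.periodic, hte]⟩
    · exact hendp s hs sb (by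
        rw [← h.periodic a]; exact hneq (by linarith) (by linarith))
        (hneq (by linarith) (by linarith)).symm hz
  -- removing a small piece around the midpoint of one arc
  have near : ∀ (c d : ℝ), c < d → d < c + N → ({Γ c, Γ d} : Set ℂ) = {Γ a, Γ b} →
      ∀ p q, p ∉ Γ '' Icc c d ∪ L → q ∉ Γ '' Icc c d ∪ L → ¬ Linked (Γ '' Icc c d ∪ L) p q →
      ∀ ε > 0, ∃ y ∈ Metric.ball (Γ ((c + d) / 2)) ε, Linked (Γ '' Icc c d ∪ L) y p := by
    intro c d hcd hd hends p q hp hq hpq ε hε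
    refine exists_linked_near ((isCompact_Icc.image h.cont).union hLns.1).isClosed hp hpq
      (fun ε hε => ?_) hε
    obtain ⟨δ, hδ, hδr, hsm⟩ := h.exists_small_arc ((c + d) / 2) (Metric.ball_mem_nhds _ hε)
      (r := (d - c) / 2) (by linarith)
    have hsub1 : Γ '' Icc c ((c + d) / 2 - δ) ⊆ Γ '' Icc c d :=
      image_mono (Icc_subset_Icc_right (by linarith))
    have hsub2 : Γ '' Icc ((c + d) / 2 + δ) d ⊆ Γ '' Icc c d :=
      image_mono (Icc_subset_Icc_left (by linarith))
    have hin : ∀ t ∈ Icc c d, Γ t ∈ L → t = c ∨ t = d := by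
      intro t ht htL
      have : Γ t ∈ ({Γ c, Γ d} : Set ℂ) := hends ▸ hLJ ▸ ⟨htL, mem_range_self _⟩
      exact this.imp
        (fun he => h.eq_of_lt he (abs_lt.2 ⟨by linarith [ht.1, ht.2], by linarith [ht.1, ht.2]⟩))
        (fun he => h.eq_of_lt he (abs_lt.2 ⟨by linarith [ht.1, ht.2], by linarith [ht.1, ht.2]⟩))
    have hcL : Γ c ∈ L := (hLJ.symm ▸ hends ▸ Or.inl rfl : Γ c ∈ L ∩ range Γ).1
    have hdL : Γ d ∈ L := (hLJ.symm ▸ hends ▸ Or.inr rfl : Γ d ∈ L ∩ range Γ).1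
    have ns1 : NonSep (Γ '' Icc c ((c + d) / 2 - δ)) := h.nonSep (by linarith) (by linarith)
    have ns2 : NonSep (Γ '' Icc ((c + d) / 2 + δ) d) := h.nonSep (by linarith) (by linarith)
    have i1 : Γ '' Icc c ((c + d) / 2 - δ) ∩ L = {Γ c} := by
      apply Subset.antisymm
      · rintro _ ⟨⟨t, ht, rfl⟩, htL⟩
        rcases hin t ⟨ht.1, by linarith [ht.2]⟩ htL with rfl | rfl
        · rfl
        · linarith [ht.2]
      · rintro _ rfl
        exact ⟨⟨c, ⟨le_rfl, by linarith⟩, rfl⟩, hcL⟩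
    have ns3 := ns1.union hLns (by rw [i1]; exact isPreconnected_singleton)
    have i2 : (Γ '' Icc c ((c + d) / 2 - δ) ∪ L) ∩ Γ '' Icc ((c + d) / 2 + δ) d = {Γ d} := by
      apply Subset.antisymm
      · rintro _ ⟨⟨s, hs, hse⟩ | htL, ⟨t, ht, rfl⟩⟩
        · have := h.eq_of_lt hse (abs_lt.2 ⟨by linarith [hs.1, hs.2, ht.1, ht.2],
            by linarith [hs.1, hs.2, ht.1, ht.2]⟩)
          linarith [hs.1, hs.2, ht.1, ht.2]
        · rcases hin t ⟨by linarith [ht.1], ht.2⟩ htL with rfl | rfl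
          · linarith [ht.1]
          · rfl
      · rintro _ rfl
        exact ⟨Or.inr hdL, d, ⟨by linarith, le_rfl⟩, rfl⟩
    have ns4 := ns3.union ns2 (by rw [i2]; exact isPreconnected_singleton)
    have hss : Γ '' Icc c ((c + d) / 2 - δ) ∪ L ∪ Γ '' Icc ((c + d) / 2 + δ) d ⊆
        Γ '' Icc c d ∪ L := by
      rintro z ((hz | hz) | hz)
      · exact Or.inl (hsub1 hz)
      · exact Or.inr hz
      · exact Or.inl (hsub2 hz)
    refine ⟨_, hss, ?_, ns4.2 p q (fun hh => hp (hss hh)) (fun hh => hq (hss hh))⟩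
    rintro z ⟨⟨t, ht, rfl⟩ | hzL, hz⟩
    · apply hsm
      refine ⟨t, ⟨?_, ?_⟩, rfl⟩
      · by_contra hle
        exact hz (Or.inl (Or.inl ⟨t, ⟨ht.1, not_lt.1 hle⟩, rfl⟩))
      · by_contra hle
        exact hz (Or.inr ⟨t, ⟨not_lt.1 hle, ht.2⟩, rfl⟩)
    · exact absurd (Or.inl (Or.inr hzL)) hz
  have nearA := near a b hab hb rfl
  have nearB := near b (a + N) hb (by linarith) (by rw [h.periodic, pair_comm])
  -- the two sides of the midpoint of the segment
  have hmJ : m ∉ range Γ := by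
    have := hℓJ 0 (by norm_num)
    simpa [hℓ] using this
  obtain ⟨r, hr, hrb⟩ := Metric.isOpen_iff.1 h.isCompact.isClosed.isOpen_compl m hmJ
  have hvn : 0 < ‖v‖ := norm_pos_iff.2 hv0
  set ε := r / (2 * ‖v‖) with hε
  have hε0 : 0 < ε := by positivity
  have hεv : ε * ‖v‖ = r / 2 := by rw [hε]; field_simp
  have hfar : ∀ z ∈ range Γ, ε * ‖v‖ < ‖z - m‖ := by
    intro z hz
    rw [hεv]
    by_contra hle
    exact hrb (Metric.mem_ball.2 (by rw [dist_eq_norm]; linarith)) hz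
  set p := m + ε * Complex.I * v with hp
  set q := m - ε * Complex.I * v with hq
  have hnB : ¬ Linked (B ∪ L) p q :=
    not_linked_of_segment hBc hBp hv0 (by rwa [show m + v = Γ b by rw [hm, hv]; ring])
      (by rwa [show m - v = Γ a by rw [hm, hv]; ring]) hε0 fun z hz => hfar z (hBJ hz)
  have hoff : ∀ e : ℝ, |e| = ε → m + e * Complex.I * v ∉ range Γ ∧
      m + e * Complex.I * v ∉ L := by
    intro e he
    constructor
    · intro hz
      have := hfar _ hz
      rw [add_sub_cancel_left, norm_mul, norm_mul, Complex.norm_I, Complex.norm_real,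
        Real.norm_eq_abs, he] at this
      linarith
    · rintro ⟨s, -, hs⟩
      have h1 : (s : ℂ) = e * Complex.I := by
        have : (s : ℂ) * v = e * Complex.I * v := add_left_cancel hs
        exact mul_right_cancel₀ hv0 this
      have h2 := congrArg Complex.im h1
      simp at h2
      rw [← h2] at he
      simp at he
      linarith
  have hpo : p ∉ range Γ ∧ p ∉ L := hoff ε (abs_of_pos hε0)
  have hqo : q ∉ range Γ ∧ q ∉ L := by
    have := hoff (-ε) (by rw [abs_neg, abs_of_pos hε0])
    have he : m + ((-ε : ℝ) : ℂ) * Complex.I * v = q := by rw [hq]; push_cast; ring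
    rwa [he] at this
  have hAcl : IsClosed (A ∪ L) := (hAc.union hLns.1).isClosed
  have hBcl : IsClosed (B ∪ L) := (hBc.union hLns.1).isClosed
  have hball : ∀ {K : Set ℂ}, IsClosed K → ∀ x ∉ K, ∃ e > 0, ∀ y ∈ Metric.ball x e,
      Linked K y x := by
    intro K hK x hx
    obtain ⟨e, he, hs⟩ := Metric.isOpen_iff.1 hK.isOpen_compl x hx
    exact ⟨e, he, fun y hy => ⟨_, (convex_ball x e).isPreconnected, hy, Metric.mem_ball_self he,
      subset_compl_iff_disjoint_right.1 hs⟩⟩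
  have hall : ∀ u, u ∉ range Γ → u ∉ L → Linked (B ∪ L) u (Γ sa) := by
    intro u huJ huL
    by_contra hn
    have huA : u ∉ A ∪ L := fun hh => hh.elim (fun h1 => huJ (hAJ h1)) huL
    have huB : u ∉ B ∪ L := fun hh => hh.elim (fun h1 => huJ (hBJ h1)) huL
    have tr : ∀ {x y}, Linked (A ∪ L) x y → x ∉ range Γ → y ∉ range Γ → Linked (B ∪ L) x y :=
      fun hl hx hy => (keyA _ _ hx hy hl).mono (union_subset_union_left _ hBJ)
    have hJof : ∀ {x}, x ∉ A ∪ L → x ∉ B ∪ L → x ∉ range Γ := fun h1 h2 h3 => by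
      rw [hJAB] at h3
      exact h3.elim (fun h4 => h1 (Or.inl h4)) fun h4 => h2 (Or.inl h4)
    by_cases hub : Linked (A ∪ L) u (Γ sb)
    · obtain ⟨e, he, hclose⟩ := hball hAcl _ hsbA
      obtain ⟨x, hx, hxl⟩ := nearB (Γ sa) u hsaB huB (fun hh => hn hh.symm) e he
      have hxA := hclose x hx
      have hxJ := hJof hxA.left_notMem hxl.left_notMem
      exact hn ((tr (hub.trans hxA.symm) huJ hxJ).trans hxl)
    · obtain ⟨e, he, hclose⟩ := hball hBcl _ hsaB
      obtain ⟨x, hx, hxl⟩ := nearA u (Γ sb) huA hsbA hub e he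
      have hxB := hclose x hx
      have hxJ := hJof hxl.left_notMem hxB.left_notMem
      exact hn ((tr hxl.symm huJ hxJ).trans hxB)
  exact hnB ((hall p hpo.1 hpo.2).trans (hall q hqo.1 hqo.2).symm)

end JordanParam

end PlaneTopology

section PlaneTopology

open Set Topology Filter

/-- The standard homeomorphism between the complex plane and the real plane. -/
def planeHomeo : ℂ ≃ₜ ℝ × ℝ := Complex.equivRealProdCLM.toHomeomorph

theorem Linked.of_map {X Y : Type*} [TopologicalSpace X] [TopologicalSpace Y] (e : X ≃ₜ Y)
    {K : Set Y} {p q : Y} (h : Linked (e ⁻¹' K) (e.symm p) (e.symm q)) : Linked K p q := by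
  have := h.map e
  rwa [image_preimage_eq _ e.surjective, e.apply_symm_apply, e.apply_symm_apply] at this

theorem Linked.preimage {X Y : Type*} [TopologicalSpace X] [TopologicalSpace Y] (e : X ≃ₜ Y)
    {K : Set Y} {p q : Y} (h : Linked K p q) : Linked (e ⁻¹' K) (e.symm p) (e.symm q) := by
  have := h.map e.symm
  rwa [e.symm.image_eq_preimage_symm, e.symm_symm] at this

theorem janiszewski_plane {A B : Set (ℝ × ℝ)} (hA : IsCompact A) (hB : IsCompact B)
    (hAB : IsPreconnected (A ∩ B)) {p q : ℝ × ℝ} (h : Linked A p q) (h' : Linked B p q) :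
    Linked (A ∪ B) p q := by
  refine Linked.of_map planeHomeo ?_
  rw [preimage_union]
  refine janiszewski (planeHomeo.isCompact_preimage.2 hA) (planeHomeo.isCompact_preimage.2 hB) ?_
    (h.preimage planeHomeo) (h'.preimage planeHomeo)
  have := hAB.image _ planeHomeo.symm.continuous.continuousOn
  rwa [planeHomeo.symm.image_eq_preimage_symm, Homeomorph.symm_symm] at this

/-- The two sides of a simple closed curve in the plane. -/
structure JordanSides (Γ : ℝ → ℝ × ℝ) (U : Bool → Set (ℝ × ℝ)) : Prop where
  isOpen : ∀ σ, IsOpen (U σ)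
  preconn : ∀ σ, IsPreconnected (U σ)
  disj : ∀ σ, Disjoint (U σ) (U !σ)
  cover : ∀ z, z ∉ range Γ → ∃ σ, z ∈ U σ
  off : ∀ σ, Disjoint (U σ) (range Γ)
  limit : ∀ σ t, Γ t ∈ closure (U σ)

/-- The **Jordan curve theorem**. -/
theorem JordanParam.exists_sides {Γ : ℝ → ℝ × ℝ} {N : ℝ} (h : JordanParam Γ N) :
    ∃ U, JordanSides Γ U := by
  set e := planeHomeo
  set Γ' : ℝ → ℂ := fun t => e.symm (Γ t)
  have h' : JordanParam Γ' N := h.comp e.symm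
  obtain ⟨p, q, hp, hq, hpq⟩ := h'.separates
  have hr : e '' range Γ' = range Γ := by
    rw [← range_comp]
    congr 1
  have hcl : IsClosed (range Γ) := h.isCompact.isClosed
  have hep : ∀ x, x ∉ range Γ' → e x ∉ range Γ := by
    intro x hx hh
    rw [← hr, e.injective.mem_set_image] at hh
    exact hx hh
  have tr : ∀ x y, Linked (range Γ') x y → Linked (range Γ) (e x) (e y) := fun x y hl => by
    rw [← hr]; exact hl.map e
  have tr' : ∀ x y, Linked (range Γ) (e x) (e y) → Linked (range Γ') x y := fun x y hl => by
    have := hl.map e.symm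
    rwa [← hr, ← image_comp, show (e.symm ∘ e) = id by ext x <;> simp, image_id,
      e.symm_apply_apply, e.symm_apply_apply] at this
  have hlim : ∀ p q, p ∉ range Γ' → q ∉ range Γ' → ¬ Linked (range Γ') p q → ∀ t,
      Γ t ∈ closure (connectedComponentIn (range Γ)ᶜ (e p)) := by
    intro p q hp hq hpq t
    have h1 : Γ' t ∈ closure {y | Linked (range Γ') y p} := by
      rw [Metric.mem_closure_iff]
      intro ε hε
      obtain ⟨y, hy, hl⟩ := h'.linked_near hp hq hpq t hε
      exact ⟨y, hl, by rw [dist_comm]; exact hy⟩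
    have h2 := image_closure_subset_closure_image e.continuous (mem_image_of_mem e h1)
    rw [show e (Γ' t) = Γ t by simp [Γ']] at h2
    refine closure_mono ?_ h2
    rintro _ ⟨y, hy, rfl⟩
    exact (tr _ _ hy).symm.mem_component
  let r : Bool → ℂ := fun σ => if σ then p else q
  have hr0 : ∀ σ, r σ ∉ range Γ' := by
    rintro (_ | _)
    exacts [hq, hp]
  have hrn : ∀ σ, ¬ Linked (range Γ') (r σ) (r !σ) := by
    rintro (_ | _)
    · exact fun hh => hpq hh.symm
    · exact hpq
  refine ⟨fun σ => connectedComponentIn (range Γ)ᶜ (e (r σ)), ⟨fun σ =>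
    hcl.isOpen_compl.connectedComponentIn, fun σ => isPreconnected_connectedComponentIn,
    fun σ => ?_, fun z hz => ?_, fun σ => subset_compl_iff_disjoint_right.1
      (connectedComponentIn_subset _ _), fun σ t => hlim _ _ (hr0 σ) (hr0 !σ) (hrn σ) t⟩⟩
  · rw [disjoint_left]
    intro z h1 h2
    exact hrn σ (tr' _ _ ((Linked.of_mem_component h1).trans (Linked.of_mem_component h2).symm))
  · have hz' : e.symm z ∉ range Γ' := by
      rintro ⟨t, ht⟩
      exact hz ⟨t, e.symm.injective ht⟩
    have key : ∀ x, Linked (range Γ') (e.symm z) x → z ∈ connectedComponentIn (range Γ)ᶜ (e x) :=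
      fun x hx => by
        have := (tr _ _ hx).symm.mem_component
        rwa [e.apply_symm_apply] at this
    rcases h'.linked_or hz' hp hq hpq with hl | hl
    · exact ⟨true, key _ hl⟩
    · exact ⟨false, key _ hl⟩

theorem exists_ball_linked {K : Set (ℝ × ℝ)} (hK : IsClosed K) {x : ℝ × ℝ} (hx : x ∉ K) :
    ∃ ε > 0, ∀ y ∈ Metric.ball x ε, Linked K y x := by
  obtain ⟨ε, hε, hs⟩ := Metric.isOpen_iff.1 hK.isOpen_compl x hx
  exact ⟨ε, hε, fun y hy => ⟨_, (convex_ball x ε).isPreconnected, hy, Metric.mem_ball_self hε,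
    subset_compl_iff_disjoint_right.1 hs⟩⟩

namespace JordanSides

variable {Γ : ℝ → ℝ × ℝ} {N : ℝ} {U : Bool → Set (ℝ × ℝ)}

theorem subset_of_mem (hU : JordanSides Γ U) {S : Set (ℝ × ℝ)} (hS : IsPreconnected S)
    (hd : Disjoint S (range Γ)) {z : ℝ × ℝ} (hz : z ∈ S) {σ : Bool} (hzU : z ∈ U σ) :
    S ⊆ U σ := by
  have hcov : S ⊆ U σ ∪ U !σ := by
    intro y hy
    obtain ⟨τ, hτ⟩ := hU.cover y (disjoint_left.1 hd hy)
    by_cases h : τ = σ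
    · exact Or.inl (h ▸ hτ)
    · exact Or.inr ((Bool.eq_not_of_ne h) ▸ hτ)
  exact hS.subset_left_of_subset_union (hU.isOpen _) (hU.isOpen _) (hU.disj σ) hcov ⟨z, hz, hzU⟩

theorem linked (hU : JordanSides Γ U) {σ : Bool} {p q : ℝ × ℝ} (hp : p ∈ U σ) (hq : q ∈ U σ) :
    Linked (range Γ) p q :=
  ⟨U σ, hU.preconn σ, hp, hq, hU.off σ⟩

theorem mem_of_linked (hU : JordanSides Γ U) {σ : Bool} {p q : ℝ × ℝ} (hp : p ∈ U σ)
    (h : Linked (range Γ) p q) : q ∈ U σ :=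
  let ⟨_, hS, hpS, hqS, hd⟩ := h
  hU.subset_of_mem hS hd hpS hp hqS

theorem notMem_not (hU : JordanSides Γ U) {σ : Bool} {p : ℝ × ℝ} (hp : p ∈ U σ) : p ∉ U !σ :=
  disjoint_left.1 (hU.disj σ) hp

theorem eq_of_mem (hU : JordanSides Γ U) {σ τ : Bool} {p : ℝ × ℝ} (hp : p ∈ U σ)
    (hq : p ∈ U τ) : σ = τ := by
  by_contra h
  rw [Bool.eq_not_of_ne h] at hp
  exact hU.notMem_not hq hp

theorem closure_subset (hU : JordanSides Γ U) {σ : Bool} : closure (U σ) ⊆ U σ ∪ range Γ := by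
  intro z hz
  by_contra h
  rw [mem_union, not_or] at h
  obtain ⟨τ, hτ⟩ := hU.cover z h.2
  obtain ⟨y, hy1, hy2⟩ := mem_closure_iff.1 hz _ (hU.isOpen τ) hτ
  exact h.1 (hU.eq_of_mem hy1 hy2 ▸ hτ)

/-- Points on one side of the curve which are linked off `K` without an open sub-arc of the curve
are linked off `K`. -/
theorem linked_of_linked_diff (hU : JordanSides Γ U) (h : JordanParam Γ N) {K : Set (ℝ × ℝ)}
    (hK : IsCompact K) (hJ : range Γ ⊆ K) {a b : ℝ} (hab : a ≤ b) (hb : b ≤ a + N)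
    (hT : IsClosed (K \ Γ '' Ioo a b)) {σ : Bool} {p q : ℝ × ℝ} (hp : p ∈ U σ) (hq : q ∈ U σ)
    (hl : Linked (K \ Γ '' Ioo a b) p q) : Linked K p q := by
  have h_int : range Γ ∩ (K \ Γ '' Ioo a b) = Γ '' Icc b (a + N) := by
    apply Subset.antisymm
    · rintro z ⟨hz, hzK, hzT⟩
      rw [h.range_eq_union hab hb] at hz
      rcases hz with ⟨t, ht, rfl⟩ | hz
      · rcases ht.1.eq_or_lt with rfl | h1
        · exact ⟨a + N, ⟨hb, le_rfl⟩, h.periodic a⟩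
        rcases ht.2.eq_or_lt with rfl | h2
        · exact ⟨t, ⟨le_rfl, hb⟩, rfl⟩
        exact absurd ⟨t, ⟨h1, h2⟩, rfl⟩ hzT
      · exact hz
    · intro z hz
      have hzJ := image_subset_range _ _ hz
      refine ⟨hzJ, hJ hzJ, ?_⟩
      rintro ⟨t, ht, rfl⟩
      exact h.notMem_image ht hz
  have := janiszewski_plane h.isCompact (hK.of_isClosed_subset hT sdiff_subset)
    (by rw [h_int]; exact isPreconnected_Icc.image _ h.cont.continuousOn) (hU.linked hp hq) hl
  refine this.mono ?_
  intro z hz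
  by_cases hzT : z ∈ Γ '' Ioo a b
  · exact Or.inl (image_subset_range _ _ hzT)
  · exact Or.inr ⟨hz, hzT⟩

/-- A complementary component that reaches an unobstructed open sub-arc of the curve from one side
fills that side near the whole sub-arc. -/
theorem spread (hU : JordanSides Γ U) (h : JordanParam Γ N) {K : Set (ℝ × ℝ)}
    (hK : IsCompact K) (hJ : range Γ ⊆ K) {a b : ℝ} (hb : b ≤ a + N)
    (hT : IsClosed (K \ Γ '' Ioo a b)) {σ : Bool} {z₀ : ℝ × ℝ} (hz₀ : z₀ ∈ U σ) {t : ℝ}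
    (ht : t ∈ Ioo a b) (hcl : Γ t ∈ closure (connectedComponentIn Kᶜ z₀)) {t' : ℝ}
    (ht' : t' ∈ Ioo a b) :
    ∃ ε > 0, ∀ q ∈ Metric.ball (Γ t') ε, q ∈ U σ → Linked K z₀ q := by
  have hmem : ∀ s ∈ Ioo a b, Γ s ∉ K \ Γ '' Ioo a b := fun s hs hh => hh.2 ⟨s, hs, rfl⟩
  obtain ⟨δ, hδ, hδb⟩ := exists_ball_linked hT (hmem t ht)
  obtain ⟨ε, hε, hεb⟩ := exists_ball_linked hT (hmem t' ht')
  obtain ⟨y, hy, hyd⟩ := Metric.mem_closure_iff.1 hcl δ hδ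
  have hyl := Linked.of_mem_component hy
  have hyU := hU.mem_of_linked hz₀ (hyl.mono hJ)
  refine ⟨ε, hε, fun q hq hqU => hyl.trans ?_⟩
  refine hU.linked_of_linked_diff h hK hJ (ht.1.trans ht.2).le hb hT hyU hqU ?_
  refine ((hδb y (by rwa [Metric.mem_ball, dist_comm])).trans ?_).trans (hεb q hq).symm
  exact ⟨Γ '' Ioo a b, isPreconnected_Ioo.image _ h.cont.continuousOn, mem_image_of_mem _ ht,
    mem_image_of_mem _ ht', disjoint_sdiff_right⟩

/-- A crosscut `P` of one side of the curve, from `Γ a` to `Γ b`, separates the two sub-arcs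
from each other within that side. -/
theorem crosscut (hU : JordanSides Γ U) (h : JordanParam Γ N) {a b : ℝ} (hab : a < b)
    (hb : b < a + N) {Γ₁ : ℝ → ℝ × ℝ} {N₁ : ℝ} (h₁ : JordanParam Γ₁ N₁) {P : Set (ℝ × ℝ)}
    (hP : IsClosed P) (hr : range Γ₁ = Γ '' Icc a b ∪ P) {σ : Bool}
    (hPU : P ⊆ U σ ∪ {Γ a, Γ b}) {Q : Set (ℝ × ℝ)} (hQ : IsPreconnected Q) (hQU : Q ⊆ U σ)
    (hQP : Disjoint Q P) {t t' : ℝ} (ht : t ∈ Ioo a b) (ht' : t' ∈ Ioo b (a + N))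
    (hcl : Γ t ∈ closure Q) (hcl' : Γ t' ∈ closure Q) : False := by
  obtain ⟨W, hW⟩ := h₁.exists_sides
  have hUJ : ∀ τ z, z ∈ U τ → z ∉ range Γ := fun τ z hz => disjoint_left.1 (hU.off τ) hz
  have hJab : ∀ s ∈ Ioo b (a + N), Γ s ∉ Γ '' Icc a b := by
    rintro s hs ⟨r, hr, hrs⟩
    have := h.eq_of_lt hrs (abs_lt.2 ⟨by linarith [hr.1, hr.2, hs.1, hs.2],
      by linarith [hr.1, hr.2, hs.1, hs.2]⟩)
    linarith [hr.2, hs.1]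
  have hends : ∀ s ∈ Ioo b (a + N), Γ s ∉ ({Γ a, Γ b} : Set (ℝ × ℝ)) := by
    intro s hs hh
    apply hJab s hs
    rcases hh with hh | hh
    · exact ⟨a, ⟨le_rfl, hab.le⟩, hh.symm⟩
    · exact ⟨b, ⟨hab.le, le_rfl⟩, hh.symm⟩
  -- the far side together with the far arc
  set Z := U (!σ) ∪ Γ '' Ioo b (a + N) with hZ
  have hZp : IsPreconnected Z := (hU.preconn !σ).subset_closure subset_union_left (by
    rintro z (hz | ⟨s, -, rfl⟩)
    · exact subset_closure hz
    · exact hU.limit _ s)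
  have hZd : Disjoint Z (range Γ₁) := by
    rw [hr, disjoint_left]
    rintro z (hz | ⟨s, hs, rfl⟩) (hz' | hz')
    · exact hUJ _ z hz (image_subset_range _ _ hz')
    · rcases hPU hz' with h1 | h1
      · exact hU.notMem_not h1 hz
      · apply hUJ _ z hz
        rcases h1 with rfl | rfl <;> exact mem_range_self _
    · exact hJab s hs hz'
    · rcases hPU hz' with h1 | h1
      · exact hUJ _ _ h1 (mem_range_self _)
      · exact hends s hs h1
  have hzZ : Γ t' ∈ Z := Or.inr ⟨t', ht', rfl⟩
  obtain ⟨τ, hτ⟩ := hW.cover _ (disjoint_left.1 hZd hzZ)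
  have hZW : Z ⊆ W τ := hW.subset_of_mem hZp hZd hzZ hτ
  have hWU : W (!τ) ⊆ U σ := by
    intro z hz
    have hz1 : z ∉ range Γ₁ := disjoint_left.1 (hW.off _) hz
    have hz2 : z ∉ Z := fun hh => hW.notMem_not (hZW hh) hz
    have hz3 : z ∉ range Γ := by
      intro hh
      rw [h.range_eq_union hab.le hb.le] at hh
      rcases hh with hh | ⟨s, hs, rfl⟩
      · exact hz1 (hr ▸ Or.inl hh)
      · rcases hs.1.eq_or_lt with rfl | h1
        · exact hz1 (hr ▸ Or.inl ⟨b, ⟨hab.le, le_rfl⟩, rfl⟩)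
        rcases hs.2.eq_or_lt with rfl | h2
        · exact hz1 (hr ▸ Or.inl ⟨a, ⟨le_rfl, hab.le⟩, (h.periodic a).symm⟩)
        exact hz2 (Or.inr ⟨s, ⟨h1, h2⟩, rfl⟩)
    obtain ⟨ρ, hρ⟩ := hU.cover z hz3
    by_cases hh : ρ = σ
    · exact hh ▸ hρ
    · exact absurd (Or.inl (Bool.eq_not_of_ne hh ▸ hρ)) hz2
  have hQd : Disjoint Q (range Γ₁) := by
    rw [hr, disjoint_left]
    rintro z hz (hz' | hz')
    · exact hUJ _ z (hQU hz) (image_subset_range _ _ hz')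
    · exact disjoint_left.1 hQP hz hz'
  obtain ⟨y, hyW, hyQ⟩ := mem_closure_iff.1 hcl' _ (hW.isOpen τ) hτ
  have hQW : Q ⊆ W τ := hW.subset_of_mem hQ hQd hyQ hyW
  -- near `Γ t`
  have hKT : (range Γ ∪ P) \ Γ '' Ioo a b = P ∪ Γ '' Icc b (a + N) := by
    apply Subset.antisymm
    · rintro z ⟨hz | hz, hzT⟩
      · rw [h.range_eq_union hab.le hb.le] at hz
        rcases hz with ⟨s, hs, rfl⟩ | hz
        · rcases hs.1.eq_or_lt with rfl | h1
          · exact Or.inr ⟨a + N, ⟨hb.le, le_rfl⟩, h.periodic a⟩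
          rcases hs.2.eq_or_lt with rfl | h2
          · exact Or.inr ⟨s, ⟨le_rfl, hb.le⟩, rfl⟩
          exact absurd ⟨s, ⟨h1, h2⟩, rfl⟩ hzT
        · exact Or.inr hz
      · exact Or.inl hz
    · rintro z (hz | hz)
      · refine ⟨Or.inr hz, ?_⟩
        rintro ⟨s, hs, rfl⟩
        rcases hPU hz with h1 | h1
        · exact hUJ _ _ h1 (mem_range_self _)
        · apply h.notMem_image hs
          rcases h1 with h1 | h1
          · exact ⟨a + N, ⟨hb.le, le_rfl⟩, (h.periodic a).trans h1.symm⟩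
          · exact ⟨b, ⟨le_rfl, hb.le⟩, h1.symm⟩
      · refine ⟨Or.inl (image_subset_range _ _ hz), ?_⟩
        rintro ⟨s, hs, rfl⟩
        exact h.notMem_image hs hz
  have hTc : IsClosed ((range Γ ∪ P) \ Γ '' Ioo a b) := by
    rw [hKT]
    exact hP.union (isCompact_Icc.image h.cont).isClosed
  have hPc : IsCompact P := h₁.isCompact.of_isClosed_subset hP (hr ▸ subset_union_right)
  obtain ⟨δ, hδ, hball⟩ := exists_ball_linked hTc (x := Γ t) (fun hh => hh.2 ⟨t, ht, rfl⟩)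
  obtain ⟨q, hq, hqd⟩ := Metric.mem_closure_iff.1 hcl δ hδ
  obtain ⟨t₁, ht₁⟩ : Γ t ∈ range Γ₁ := hr ▸ Or.inl ⟨t, Ioo_subset_Icc_self ht, rfl⟩
  obtain ⟨w, hw, hwd⟩ := Metric.mem_closure_iff.1 (hW.limit (!τ) t₁) δ hδ
  rw [ht₁] at hwd
  rw [dist_comm] at hqd hwd
  have hl := hU.linked_of_linked_diff h (h.isCompact.union hPc) subset_union_left hab.le hb.le hTc
    (hQU hq) (hWU hw) ((hball q hqd).trans (hball w hwd).symm)
  have hl' : Linked (range Γ₁) q w :=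
    hl.mono (by rw [hr]; exact union_subset_union_left _ (image_subset_range _ _))
  exact hW.notMem_not (hW.mem_of_linked (hQW hq) hl') hw

end JordanSides

end PlaneTopology

section GraphTopology

open Set Topology Filter

/-- A bi-infinite periodic enumeration of the vertices of a cycle of length `m`. -/
structure CycSeq {V : Type*} (G : SimpleGraph V) (v : ℤ → V) (m : ℕ) : Prop where
  three : 3 ≤ m
  eq_iff : ∀ i j, v i = v j ↔ (m : ℤ) ∣ i - j
  adj : ∀ i, G.Adj (v i) (v (i + 1))

/-- A parametrization of the closed curve drawing a cycle. -/
structure CycParam {V : Type*} {G : SimpleGraph V} (emb : PlaneEmbedding G) (v : ℤ → V) (m : ℕ)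
    (Γ : ℝ → ℝ × ℝ) : Prop extends JordanParam Γ m where
  at_int : ∀ i : ℤ, Γ i = emb.pos (v i)
  image_edge : ∀ i : ℤ, Γ '' Icc (i : ℝ) (i + 1) = emb.arc (v i) (v (i + 1))

variable {V : Type*} {G : SimpleGraph V}

theorem CycSeq.exists_param {v : ℤ → V} {m : ℕ} (h : CycSeq G v m) (emb : PlaneEmbedding G) :
    ∃ Γ, CycParam emb v m Γ := by
  choose! γ hc hi h0 h1 him using emb.arc_curve
  set g : ℤ → ℝ → ℝ × ℝ := fun i => γ (v i) (v (i + 1)) with hg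
  have gc : ∀ i, ContinuousOn (g i) (Icc 0 1) := fun i => hc _ _ (h.adj i)
  have gi : ∀ i, InjOn (g i) (Icc 0 1) := fun i => hi _ _ (h.adj i)
  have g0 : ∀ i, g i 0 = emb.pos (v i) := fun i => h0 _ _ (h.adj i)
  have g1 : ∀ i, g i 1 = emb.pos (v (i + 1)) := fun i => h1 _ _ (h.adj i)
  have gim : ∀ i, g i '' Icc 0 1 = emb.arc (v i) (v (i + 1)) := fun i => him _ _ (h.adj i)
  set Γ : ℝ → ℝ × ℝ := fun t => g ⌊t⌋ (Int.fract t) with hΓ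
  have h_int : ∀ i : ℤ, Γ i = emb.pos (v i) := fun i => by simp [hΓ, g0]
  have hon : ∀ (i : ℤ), ∀ t ∈ Icc (i : ℝ) (i + 1), Γ t = g i (t - i) := by
    intro i t ht
    rcases ht.2.eq_or_lt with rfl | h2
    · have := h_int (i + 1)
      push_cast at this
      rw [this, add_sub_cancel_left, g1]
    · have : ⌊t⌋ = i := Int.floor_eq_iff.2 ⟨ht.1, h2⟩
      simp only [hΓ, Int.fract, this]
  have hmap : ∀ i : ℤ, MapsTo (fun t : ℝ => t - i) (Icc (i : ℝ) (i + 1)) (Icc 0 1) :=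
    fun i t ht => ⟨by linarith [ht.1], by linarith [ht.2]⟩
  have hcon : ∀ i : ℤ, ContinuousOn Γ (Icc (i : ℝ) (i + 1)) := fun i =>
    ((gc i).comp (by fun_prop) (hmap i)).congr (hon i)
  have himg : ∀ i : ℤ, Γ '' Icc (i : ℝ) (i + 1) = emb.arc (v i) (v (i + 1)) := by
    intro i
    rw [image_congr (hon i), ← gim i]
    have : (fun t : ℝ => t - i) '' Icc (i : ℝ) (i + 1) = Icc 0 1 := by
      rw [image_sub_const_Icc]; simp
    rw [← this, image_image]
  have hfr : ∀ t : ℝ, Int.fract t ∈ Icc (0 : ℝ) 1 := fun t =>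
    ⟨Int.fract_nonneg t, (Int.fract_lt_one t).le⟩
  have hmem : ∀ t, Γ t ∈ emb.arc (v ⌊t⌋) (v (⌊t⌋ + 1)) := fun t => by
    rw [← gim]; exact mem_image_of_mem _ (hfr t)
  have hvert : ∀ t w, Γ t = emb.pos w → Int.fract t = 0 ∧ v ⌊t⌋ = w := by
    intro t w hw
    rcases emb.arc_vertex _ _ (h.adj ⌊t⌋) w (hw ▸ hmem t) with rfl | rfl
    · exact ⟨gi ⌊t⌋ (hfr t) ⟨le_rfl, zero_le_one⟩ (hw.trans (g0 _).symm), rfl⟩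
    · exact absurd (gi ⌊t⌋ (hfr t) ⟨zero_le_one, le_rfl⟩ (hw.trans (g1 _).symm))
        (Int.fract_lt_one t).ne
  refine ⟨Γ, ⟨continuous_iff_continuousAt.2 fun t => ?_, by
    exact_mod_cast (show 0 < m by have := h.three; omega), fun s t => ⟨fun hst => ?_, ?_⟩⟩,
    h_int, himg⟩
  · have h2 := (hcon (⌊t⌋ - 1)).union_of_isClosed (hcon ⌊t⌋) isClosed_Icc isClosed_Icc
    refine h2.continuousAt (mem_of_superset (Ioo_mem_nhds (a := (⌊t⌋ : ℝ) - 1) (b := ⌊t⌋ + 1)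
      (by linarith [Int.floor_le t]) (Int.lt_floor_add_one t)) fun x hx => ?_)
    push_cast
    rcases le_total x ⌊t⌋ with hh | hh
    · exact Or.inl ⟨hx.1.le, by linarith⟩
    · exact Or.inr ⟨hh, hx.2.le⟩
  · have key : v ⌊s⌋ = v ⌊t⌋ ∧ Int.fract s = Int.fract t := by
      by_cases hs : ∃ w, Γ s = emb.pos w
      · obtain ⟨w, hw⟩ := hs
        obtain ⟨h3, h4⟩ := hvert s w hw
        obtain ⟨h5, h6⟩ := hvert t w (hst ▸ hw)
        exact ⟨h4.trans h6.symm, h3.trans h5.symm⟩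
      · have he : s(v ⌊s⌋, v (⌊s⌋ + 1)) = s(v ⌊t⌋, v (⌊t⌋ + 1)) := by
          by_contra hne
          obtain ⟨w, hw⟩ := emb.arc_inter _ _ _ _ (h.adj _) (h.adj _) hne ⟨hmem s, hst ▸ hmem t⟩
          exact hs ⟨w, hw.symm⟩
        rcases Sym2.eq_iff.1 he with ⟨h3, h4⟩ | ⟨h3, h4⟩
        · refine ⟨h3, gi ⌊s⌋ (hfr s) (hfr t) ?_⟩
          have : g ⌊s⌋ = g ⌊t⌋ := by simp only [hg, h3, h4]
          calc g ⌊s⌋ (Int.fract s) = g ⌊t⌋ (Int.fract t) := hst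
            _ = _ := by rw [this]
        · rw [h.eq_iff] at h3 h4
          have h5 := Int.dvd_sub h4 h3
          have h6 : (m : ℤ) ∣ 2 := by ring_nf at h5; exact h5
          have := Int.le_of_dvd two_pos h6
          have := h.three
          omega
    obtain ⟨k, hk⟩ := (h.eq_iff _ _).1 key.1
    refine ⟨k, ?_⟩
    have h1 := Int.floor_add_fract s
    have h2 := Int.floor_add_fract t
    have hk' : ((⌊s⌋ : ℝ) - ⌊t⌋) = m * k := by exact_mod_cast hk
    linarith [key.2]
  · rintro ⟨k, hk⟩
    have hs : s = t + ((k * m : ℤ) : ℝ) := by push_cast; linarith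
    have h3 : v (⌊t⌋ + k * m) = v ⌊t⌋ := (h.eq_iff _ _).2 ⟨k, by ring⟩
    have h4 : v (⌊t⌋ + k * m + 1) = v (⌊t⌋ + 1) := (h.eq_iff _ _).2 ⟨k, by ring⟩
    simp only [hΓ, hs, Int.floor_add_intCast, Int.fract_add_intCast, hg, h3, h4]

/-- A list of distinct vertices, consecutively adjacent and closing up, gives a cycle. -/
theorem CycSeq.of_path {p : ℕ → V} {m : ℕ} (hm : 3 ≤ m) (hi : InjOn p (Iio m))
    (ha : ∀ r, r + 1 < m → G.Adj (p r) (p (r + 1))) (hl : G.Adj (p (m - 1)) (p 0)) :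
    CycSeq G (fun i : ℤ => p (i % m).toNat) m := by
  have hm0 : (0 : ℤ) < m := by omega
  have hr : ∀ i : ℤ, 0 ≤ i % m ∧ i % m < m := fun i =>
    ⟨Int.emod_nonneg _ hm0.ne', Int.emod_lt_of_pos _ hm0⟩
  refine ⟨hm, fun i j => ⟨fun hij => ?_, fun hij => ?_⟩, fun i => ?_⟩
  · have h1 := hr i
    have h2 := hr j
    have := hi (show (i % m).toNat < m by omega) (show (j % m).toNat < m by omega) hij
    exact Int.dvd_of_emod_eq_zero (Int.emod_eq_emod_iff_emod_sub_eq_zero.1 (by omega))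
  · have : i % m = j % m :=
      Int.emod_eq_emod_iff_emod_sub_eq_zero.2 (Int.emod_eq_zero_of_dvd hij)
    simp only [this]
  · have h1 := hr i
    rcases eq_or_ne (i % m) (m - 1) with h2 | h2
    · have h3 : (i + 1) % m = 0 := by
        rw [Int.add_emod, h2, Int.emod_eq_of_lt (a := 1) (by omega) (by omega)]; simp
      simp only [h2, h3]
      rw [show ((m : ℤ) - 1).toNat = m - 1 by omega]
      exact hl
    · have h3 : (i + 1) % m = i % m + 1 := by
        rw [Int.add_emod, Int.emod_eq_of_lt (a := 1) (by omega) (by omega)]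
        exact Int.emod_eq_of_lt (by omega) (by omega)
      simp only [h3]
      rw [show (i % m + 1).toNat = (i % m).toNat + 1 by omega]
      exact ha _ (by omega)

end GraphTopology

section GraphTopology

open Set Topology Filter

variable {V : Type*} {G : SimpleGraph V}

/-- The union of the arcs drawing a set of edges. -/
def arcUnion (emb : PlaneEmbedding G) (E : Set (Sym2 V)) : Set (ℝ × ℝ) :=
  ⋃ e ∈ E, arcSet emb e

/-- The edges of a periodically enumerated cycle. -/
def cycEdges (v : ℤ → V) : Set (Sym2 V) :=
  range fun i => s(v i, v (i + 1))

/-- The interior of the arc drawing an edge. -/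
def openArc (emb : PlaneEmbedding G) (x y : V) : Set (ℝ × ℝ) :=
  emb.arc x y \ {emb.pos x, emb.pos y}

namespace PlaneEmbedding

variable (emb : PlaneEmbedding G)

theorem mem_arcUnion {E : Set (Sym2 V)} {z : ℝ × ℝ} :
    z ∈ arcUnion emb E ↔ ∃ x y, s(x, y) ∈ E ∧ z ∈ emb.arc x y := by
  simp only [arcUnion, mem_iUnion, exists_prop, Sym2.exists, arcSet, Sym2.lift_mk]

theorem isCompact_arc {x y : V} (h : G.Adj x y) : IsCompact (emb.arc x y) := by
  obtain ⟨γ, hc, -, -, -, him⟩ := emb.arc_curve x y h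
  rw [← him]
  exact isCompact_Icc.image_of_continuousOn hc

theorem pos_mem_arc_left {x y : V} (h : G.Adj x y) : emb.pos x ∈ emb.arc x y := by
  obtain ⟨γ, hc, -, h0, -, him⟩ := emb.arc_curve x y h
  rw [← him, ← h0]
  exact mem_image_of_mem _ ⟨le_rfl, zero_le_one⟩

theorem pos_mem_arc_right {x y : V} (h : G.Adj x y) : emb.pos y ∈ emb.arc x y := by
  rw [emb.arc_symm]
  exact emb.pos_mem_arc_left h.symm

theorem isCompact_arcUnion [Finite V] {E : Set (Sym2 V)} (hE : E ⊆ G.edgeSet) :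
    IsCompact (arcUnion emb E) := by
  refine (toFinite E).isCompact_biUnion fun e he => ?_
  have := hE he
  induction e with
  | _ x y => exact emb.isCompact_arc (G.mem_edgeSet.1 this)

/-- Arcs of different edges meet only in common endpoints. -/
theorem eq_of_mem_arcs {x y x' y' : V} (h : G.Adj x y) (h' : G.Adj x' y')
    (hne : s(x, y) ≠ s(x', y')) {z : ℝ × ℝ} (hz : z ∈ emb.arc x y) (hz' : z ∈ emb.arc x' y') :
    ∃ w, z = emb.pos w ∧ (w = x ∨ w = y) ∧ (w = x' ∨ w = y') := by
  obtain ⟨w, rfl⟩ := emb.arc_inter x y x' y' h h' hne ⟨hz, hz'⟩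
  exact ⟨w, rfl, emb.arc_vertex _ _ h _ hz, emb.arc_vertex _ _ h' _ hz'⟩

theorem exists_openArc {x y : V} (h : G.Adj x y) :
    IsPreconnected (openArc emb x y) ∧ IsPreconnected (emb.arc x y \ {emb.pos y}) ∧
      emb.arc x y ⊆ closure (openArc emb x y) ∧ (openArc emb x y).Nonempty := by
  obtain ⟨γ, hc, hi, h0, h1, him⟩ := emb.arc_curve x y h
  have m0 : (0 : ℝ) ∈ Icc (0 : ℝ) 1 := ⟨le_rfl, zero_le_one⟩
  have m1 : (1 : ℝ) ∈ Icc (0 : ℝ) 1 := ⟨zero_le_one, le_rfl⟩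
  have e1 : openArc emb x y = γ '' Ioo 0 1 := by
    rw [openArc, ← him, ← h0, ← h1, ← image_pair, ← image_sdiff_of_injOn hi, Icc_sdiff_both]
    rintro z (rfl | rfl)
    exacts [m0, m1]
  have e2 : emb.arc x y \ {emb.pos y} = γ '' Ico 0 1 := by
    rw [← him, ← h1, ← image_singleton, ← image_sdiff_of_injOn hi, Icc_sdiff_right]
    rintro z rfl
    exact m1
  refine ⟨?_, ?_, ?_, ?_⟩
  · rw [e1]
    exact isPreconnected_Ioo.image _ (hc.mono Ioo_subset_Icc_self)
  · rw [e2]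
    exact isPreconnected_Ico.image _ (hc.mono Ico_subset_Icc_self)
  · rw [e1, ← him, ← closure_Ioo (zero_ne_one' ℝ)]
    rw [← closure_Ioo (zero_ne_one' ℝ)] at hc
    exact hc.image_closure
  · rw [e1]
    exact (nonempty_Ioo.2 zero_lt_one).image _

theorem pos_notMem_openArc {x y : V} (h : G.Adj x y) (w : V) : emb.pos w ∉ openArc emb x y := by
  rintro ⟨hw, hw'⟩
  rcases emb.arc_vertex _ _ h _ hw with rfl | rfl <;> simp at hw'

end PlaneEmbedding

namespace CycSeq

variable {v : ℤ → V} {m : ℕ}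

theorem cycEdges_subset (h : CycSeq G v m) : cycEdges v ⊆ G.edgeSet := by
  rintro _ ⟨i, rfl⟩
  exact h.adj i

theorem add_mul (h : CycSeq G v m) (i k : ℤ) : v (i + k * m) = v i :=
  (h.eq_iff _ _).2 ⟨k, by ring⟩

theorem mem_cycEdges (h : CycSeq G v m) {i j : ℤ} :
    s(v i, v j) ∈ cycEdges v ↔ (m : ℤ) ∣ j - i - 1 ∨ (m : ℤ) ∣ j - i + 1 := by
  constructor
  · rintro ⟨k, hk⟩
    rcases Sym2.eq_iff.1 hk with ⟨h1, h2⟩ | ⟨h1, h2⟩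
    · rw [h.eq_iff] at h1 h2
      left
      have := dvd_sub h1 h2
      ring_nf at this ⊢
      exact this
    · rw [h.eq_iff] at h1 h2
      right
      have := dvd_sub h2 h1
      ring_nf at this ⊢
      exact this
  · rintro (hd | hd)
    · exact ⟨i, by simp only [(h.eq_iff j (i + 1)).2 (by ring_nf at hd ⊢; exact hd)]⟩
    · refine ⟨j, ?_⟩
      simp only [(h.eq_iff i (j + 1)).2 (by
        have := dvd_neg.2 hd
        ring_nf at this ⊢; exact this)]
      exact Sym2.eq_swap

theorem exists_mem_Ico (h : CycSeq G v m) (a : ℤ) {w : V} (hw : w ∈ range v) :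
    ∃ i, a ≤ i ∧ i < a + m ∧ v i = w := by
  obtain ⟨j, rfl⟩ := hw
  have hm : (0 : ℤ) < m := by have := h.three; omega
  refine ⟨a + (j - a) % m, ?_, ?_, ?_⟩
  · have := Int.emod_nonneg (j - a) hm.ne'
    omega
  · have := Int.emod_lt_of_pos (j - a) hm
    omega
  · rw [h.eq_iff]
    refine ⟨-((j - a) / m), ?_⟩
    have := Int.mul_ediv_add_emod (j - a) m
    linarith

end CycSeq

namespace CycParam

variable {emb : PlaneEmbedding G} {v : ℤ → V} {m : ℕ} {Γ : ℝ → ℝ × ℝ}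

theorem exists_int (t : ℝ) : ∃ i : ℤ, t ∈ Icc (i : ℝ) (i + 1) :=
  ⟨⌊t⌋, Int.floor_le t, (Int.lt_floor_add_one t).le⟩

theorem mem_image_Icc (h : CycParam emb v m Γ) {a b : ℤ} (hab : a < b) {z : ℝ × ℝ} :
    z ∈ Γ '' Icc (a : ℝ) b ↔ ∃ i : ℤ, a ≤ i ∧ i < b ∧ z ∈ emb.arc (v i) (v (i + 1)) := by
  constructor
  · rintro ⟨t, ht, rfl⟩
    rcases ht.2.eq_or_lt with rfl | h2
    · refine ⟨b - 1, by omega, by omega, ?_⟩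
      rw [← h.image_edge]
      refine ⟨_, ⟨?_, ?_⟩, rfl⟩ <;> push_cast <;> linarith
    · refine ⟨⌊t⌋, Int.le_floor.2 ht.1, Int.floor_lt.2 h2, ?_⟩
      rw [← h.image_edge]
      exact ⟨t, ⟨Int.floor_le t, (Int.lt_floor_add_one t).le⟩, rfl⟩
  · rintro ⟨i, h1, h2, hz⟩
    rw [← h.image_edge] at hz
    refine image_mono (Icc_subset_Icc (by exact_mod_cast h1) ?_) hz
    exact_mod_cast h2

theorem range_eq (h : CycParam emb v m Γ) : range Γ = arcUnion emb (cycEdges v) := by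
  ext z
  rw [emb.mem_arcUnion]
  constructor
  · rintro ⟨t, rfl⟩
    obtain ⟨i, hi⟩ := exists_int t
    exact ⟨_, _, ⟨i, rfl⟩, h.image_edge i ▸ mem_image_of_mem _ hi⟩
  · rintro ⟨x, y, ⟨i, hi⟩, hz⟩
    have : z ∈ emb.arc (v i) (v (i + 1)) := by
      rcases Sym2.eq_iff.1 hi with ⟨rfl, rfl⟩ | ⟨rfl, rfl⟩
      · exact hz
      · rwa [emb.arc_symm]
    rw [← h.image_edge] at this
    exact image_subset_range _ _ this

theorem exists_of_pos_mem (h : CycParam emb v m Γ) (hs : CycSeq G v m) {w : V}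
    (hw : emb.pos w ∈ range Γ) : w ∈ range v := by
  rw [h.range_eq, emb.mem_arcUnion] at hw
  obtain ⟨x, y, ⟨i, hi⟩, hz⟩ := hw
  have hadj : G.Adj x y := by
    have := hs.adj i
    rcases Sym2.eq_iff.1 hi with ⟨rfl, rfl⟩ | ⟨rfl, rfl⟩
    exacts [this, this.symm]
  rcases emb.arc_vertex _ _ hadj _ hz with rfl | rfl <;>
  · rcases Sym2.eq_iff.1 hi with ⟨rfl, rfl⟩ | ⟨rfl, rfl⟩ <;> exact mem_range_self _

/-- The arc of an edge off the cycle meets the curve at most in the ends of the edge. -/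
theorem eq_pos_of_mem (h : CycParam emb v m Γ) (hs : CycSeq G v m) {x y : V} (hxy : G.Adj x y)
    (hne : s(x, y) ∉ cycEdges v) {z : ℝ × ℝ} (hz : z ∈ emb.arc x y) (hzr : z ∈ range Γ) :
    ∃ w ∈ range v, z = emb.pos w ∧ (w = x ∨ w = y) := by
  have hzr' := hzr
  rw [h.range_eq, emb.mem_arcUnion] at hzr
  obtain ⟨x', y', he, hz'⟩ := hzr
  obtain ⟨w, rfl, hw, -⟩ := emb.eq_of_mem_arcs hxy (hs.cycEdges_subset he)
    (fun hh => hne (hh ▸ he)) hz hz'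
  exact ⟨w, h.exists_of_pos_mem hs hzr', rfl, hw⟩

theorem eq_int_of_pos (h : CycParam emb v m Γ) {t : ℝ} {i : ℤ} (ht : Γ t = emb.pos (v i)) :
    ∃ k : ℤ, t = (i + k * m : ℤ) := by
  rw [← h.at_int, h.eq_iff] at ht
  obtain ⟨k, hk⟩ := ht
  exact ⟨k, by push_cast; linarith⟩

/-- Removing from a drawing an open sub-arc of a cycle which no other edge enters leaves a closed
set. -/
theorem isClosed_diff [Finite V] (h : CycParam emb v m Γ) (hs : CycSeq G v m) {E : Set (Sym2 V)}
    (hE : E ⊆ G.edgeSet) {a b : ℤ} (hab : a ≤ b) (hb : b ≤ a + m) (hcE : cycEdges v ⊆ E)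
    (hfree : ∀ e ∈ E, e ∉ cycEdges v → ∀ j, a < j → j < b → v j ∉ e) :
    IsClosed (arcUnion emb E \ Γ '' Ioo (a : ℝ) b) := by
  have hab' : (a : ℝ) ≤ b := by exact_mod_cast hab
  have hb' : (b : ℝ) ≤ a + m := by exact_mod_cast hb
  have : arcUnion emb E \ Γ '' Ioo (a : ℝ) b =
      Γ '' Icc (b : ℝ) (a + m) ∪ arcUnion emb (E \ cycEdges v) := by
    ext z
    constructor
    · rintro ⟨hz, hzT⟩
      obtain ⟨x, y, he, hz⟩ := emb.mem_arcUnion.1 hz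
      by_cases hc : s(x, y) ∈ cycEdges v
      · left
        have : z ∈ range Γ := by
          rw [h.range_eq, emb.mem_arcUnion]
          exact ⟨x, y, hc, hz⟩
        rw [h.range_eq_union hab' hb'] at this
        rcases this with ⟨t, ht, rfl⟩ | this
        · rcases ht.1.eq_or_lt with rfl | h1
          · exact ⟨a + m, ⟨hb', le_rfl⟩, h.periodic _⟩
          rcases ht.2.eq_or_lt with rfl | h2
          · exact ⟨b, ⟨le_rfl, hb'⟩, rfl⟩
          exact absurd ⟨t, ⟨h1, h2⟩, rfl⟩ hzT
        · exact this
      · exact Or.inr (emb.mem_arcUnion.2 ⟨x, y, ⟨he, hc⟩, hz⟩)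
    · rintro (hz | hz)
      · refine ⟨?_, ?_⟩
        · have := image_subset_range _ _ hz
          rw [h.range_eq] at this
          exact biUnion_subset_biUnion_left hcE this
        · rintro ⟨t, ht, rfl⟩
          exact h.notMem_image ht hz
      · refine ⟨biUnion_subset_biUnion_left sdiff_subset hz, ?_⟩
        rintro ⟨t, ht, rfl⟩
        obtain ⟨x, y, he, hz⟩ := emb.mem_arcUnion.1 hz
        obtain ⟨w, ⟨i, rfl⟩, hw, hwe⟩ := h.eq_pos_of_mem hs (hE he.1) he.2 hz (mem_range_self _)
        obtain ⟨k, rfl⟩ := h.eq_int_of_pos hw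
        refine hfree _ he.1 he.2 (i + k * m) (by exact_mod_cast ht.1) (by exact_mod_cast ht.2) ?_
        rw [hs.add_mul]
        rcases hwe with rfl | rfl <;> simp
  rw [this]
  exact (isCompact_Icc.image h.cont).isClosed.union
    (emb.isCompact_arcUnion (sdiff_subset.trans hE)).isClosed

end CycParam

end GraphTopology

section GraphTopology

open Set Topology Filter

variable {V : Type*} {G : SimpleGraph V}

theorem mem_cycEdges_of_path {p : ℕ → V} {m : ℕ} (hm : 3 ≤ m) {e : Sym2 V} :
    e ∈ cycEdges (fun i : ℤ => p (i % m).toNat) ↔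
      (∃ r, r + 1 < m ∧ e = s(p r, p (r + 1))) ∨ e = s(p (m - 1), p 0) := by
  have hm0 : (0 : ℤ) < m := by omega
  constructor
  · rintro ⟨i, rfl⟩
    have h1 : 0 ≤ i % m := Int.emod_nonneg _ hm0.ne'
    have h1' : i % m < m := Int.emod_lt_of_pos _ hm0
    rcases eq_or_ne (i % m) (m - 1) with h2 | h2
    · right
      have h3 : (i + 1) % m = 0 := by
        rw [Int.add_emod, h2, Int.emod_eq_of_lt (a := 1) (by omega) (by omega)]; simp
      simp only [h2, h3]
      rw [show ((m : ℤ) - 1).toNat = m - 1 by omega]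
      rfl
    · left
      have h3 : (i + 1) % m = i % m + 1 := by
        rw [Int.add_emod, Int.emod_eq_of_lt (a := 1) (by omega) (by omega)]
        exact Int.emod_eq_of_lt (by omega) (by omega)
      refine ⟨(i % m).toNat, by omega, ?_⟩
      simp only [h3]
      rw [show (i % m + 1).toNat = (i % m).toNat + 1 by omega]
  · rintro (⟨r, hr, rfl⟩ | rfl)
    · refine ⟨r, ?_⟩
      simp only
      rw [Int.emod_eq_of_lt (a := r) (by omega) (by omega),
        Int.emod_eq_of_lt (a := r + 1) (by omega) (by omega)]
      norm_cast
    · refine ⟨m - 1, ?_⟩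
      simp only
      rw [Int.emod_eq_of_lt (a := (m : ℤ) - 1) (by omega) (by omega), sub_add_cancel, Int.emod_self,
        show ((m : ℤ) - 1).toNat = m - 1 by omega]
      rfl

namespace CycParam

variable {emb : PlaneEmbedding G} {v : ℤ → V} {m : ℕ} {Γ : ℝ → ℝ × ℝ} {U : Bool → Set (ℝ × ℝ)}

theorem range_subset (h : CycParam emb v m Γ) {E : Set (Sym2 V)} (hcE : cycEdges v ⊆ E) :
    range Γ ⊆ arcUnion emb E := by
  rw [h.range_eq]
  exact biUnion_subset_biUnion_left hcE

section Spread

variable [Finite V] (h : CycParam emb v m Γ) (hs : CycSeq G v m) (hU : JordanSides Γ U)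
  {E : Set (Sym2 V)} (hE : E ⊆ G.edgeSet) {a b : ℤ} (hab : a < b) (hb : b ≤ a + m)
  (hcE : cycEdges v ⊆ E) (hfree : ∀ e ∈ E, e ∉ cycEdges v → ∀ j, a < j → j < b → v j ∉ e)
include h hs hU hE hab hb hcE hfree

theorem closure_spread {σ : Bool} {z₀ : ℝ × ℝ} (hz₀ : z₀ ∈ U σ) {t : ℝ}
    (ht : t ∈ Ioo (a : ℝ) b) (hcl : Γ t ∈ closure (connectedComponentIn (arcUnion emb E)ᶜ z₀)) :
    Γ '' Icc (a : ℝ) b ⊆ closure (connectedComponentIn (arcUnion emb E)ᶜ z₀) := by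
  have hab' : (a : ℝ) < b := by exact_mod_cast hab
  have h1 : Γ '' Ioo (a : ℝ) b ⊆ closure (connectedComponentIn (arcUnion emb E)ᶜ z₀) := by
    rintro _ ⟨t', ht', rfl⟩
    obtain ⟨ε, hε, hball⟩ := hU.spread h.toJordanParam (emb.isCompact_arcUnion hE)
      (h.range_subset hcE) (by exact_mod_cast hb) (h.isClosed_diff hs hE hab.le hb hcE hfree)
      hz₀ ht hcl ht'
    rw [Metric.mem_closure_iff]
    intro δ hδ
    obtain ⟨q, hq, hqd⟩ := Metric.mem_closure_iff.1 (hU.limit σ t') (min δ ε) (lt_min hδ hε)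
    refine ⟨q, (hball q ?_ hq).mem_component, hqd.trans_le (min_le_left _ _)⟩
    rw [Metric.mem_ball, dist_comm]
    exact hqd.trans_le (min_le_right _ _)
  rw [← closure_Ioo hab'.ne]
  exact (image_closure_subset_closure_image h.cont).trans (closure_minimal h1 isClosed_closure)

theorem linked_of_mem_closure {σ : Bool} {z₀ z₁ : ℝ × ℝ} (hz₀ : z₀ ∈ U σ) {t t' : ℝ}
    (ht : t ∈ Ioo (a : ℝ) b) (hcl : Γ t ∈ closure (connectedComponentIn (arcUnion emb E)ᶜ z₀))
    (hz₁ : z₁ ∈ U σ) (ht' : t' ∈ Ioo (a : ℝ) b)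
    (hcl' : Γ t' ∈ closure (connectedComponentIn (arcUnion emb E)ᶜ z₁)) :
    Linked (arcUnion emb E) z₀ z₁ := by
  obtain ⟨ε, hε, hball⟩ := hU.spread h.toJordanParam (emb.isCompact_arcUnion hE)
    (h.range_subset hcE) (by exact_mod_cast hb) (h.isClosed_diff hs hE hab.le hb hcE hfree)
    hz₀ ht hcl ht'
  obtain ⟨q, hq, hqd⟩ := Metric.mem_closure_iff.1 hcl' ε hε
  have hl := Linked.of_mem_component hq
  refine (hball q (by rwa [Metric.mem_ball, dist_comm]) ?_).trans hl.symm
  exact hU.mem_of_linked hz₁ (hl.mono (h.range_subset hcE))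

theorem exists_component (σ : Bool) : ∃ z₀ ∈ U σ, z₀ ∉ arcUnion emb E ∧
    Γ '' Icc (a : ℝ) b ⊆ closure (connectedComponentIn (arcUnion emb E)ᶜ z₀) := by
  have hab' : (a : ℝ) < b := by exact_mod_cast hab
  have hT := h.isClosed_diff hs hE hab.le hb hcE hfree
  obtain ⟨t, ht⟩ := nonempty_Ioo.2 hab'
  obtain ⟨ε, hε, hball⟩ := exists_ball_linked hT (x := Γ t) (fun hh => hh.2 ⟨t, ht, rfl⟩)
  obtain ⟨q, hq, hqd⟩ := Metric.mem_closure_iff.1 (hU.limit σ t) ε hε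
  rw [dist_comm] at hqd
  have key : ∀ q' ∈ U σ, dist q' (Γ t) < ε → Linked (arcUnion emb E) q q' := fun q' hq' hd =>
    hU.linked_of_linked_diff h.toJordanParam (emb.isCompact_arcUnion hE) (h.range_subset hcE)
      hab'.le (by exact_mod_cast hb) hT hq hq' ((hball q hqd).trans (hball q' hd).symm)
  refine ⟨q, hq, (key q hq hqd).left_notMem, h.closure_spread hs hU hE hab hb hcE hfree hq ht ?_⟩
  rw [Metric.mem_closure_iff]
  intro δ hδ
  obtain ⟨q', hq', hd'⟩ := Metric.mem_closure_iff.1 (hU.limit σ t) (min δ ε) (lt_min hδ hε)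
  refine ⟨q', (key q' hq' ?_).mem_component, hd'.trans_le (min_le_left _ _)⟩
  rw [dist_comm]
  exact hd'.trans_le (min_le_right _ _)

end Spread

/-- A chord drawn on one side of a cycle separates the two segments of the cycle within that
side. -/
theorem chord_crosscut (h : CycParam emb v m Γ) (hs : CycSeq G v m) (hU : JordanSides Γ U)
    {a b : ℤ} (hab : a + 2 ≤ b) (hb : b < a + m) (hadj : G.Adj (v a) (v b)) {σ : Bool}
    (hσ : openArc emb (v a) (v b) ⊆ U σ) {Q : Set (ℝ × ℝ)} (hQ : IsPreconnected Q)
    (hQU : Q ⊆ U σ) (hQd : Disjoint Q (openArc emb (v a) (v b))) {t t' : ℝ}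
    (ht : t ∈ Ioo (a : ℝ) b) (ht' : t' ∈ Ioo (b : ℝ) (a + m)) (hcl : Γ t ∈ closure Q)
    (hcl' : Γ t' ∈ closure Q) : False := by
  set k := (b - a).toNat with hk
  have hkb : b = a + k := by omega
  have h3 : 3 ≤ k + 1 := by omega
  have hm1 : (k : ℤ) < m := by omega
  obtain ⟨p, hp⟩ : ∃ p : ℕ → V, ∀ r : ℕ, p r = v (a + r) := ⟨_, fun _ => rfl⟩
  have hs₁ : CycSeq G _ (k + 1) := CycSeq.of_path (p := p) h3
    (fun r hr s hs' hrs => by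
      simp only [hp, hs.eq_iff, mem_Iio] at hr hs' hrs
      obtain ⟨x, hx⟩ := hrs
      have hx0 : x = 0 := by
        by_contra hne
        rcases lt_or_gt_of_ne hne with h0 | h0 <;> nlinarith
      simp [hx0] at hx
      omega)
    (fun r _ => by
      have := hs.adj (a + r)
      rw [hp, hp]
      push_cast
      rwa [← add_assoc]) (by simpa [hp, hkb] using hadj.symm)
  obtain ⟨Γ₁, h₁⟩ := hs₁.exists_param emb
  have hends : Γ a = emb.pos (v a) ∧ Γ b = emb.pos (v b) := ⟨h.at_int a, h.at_int b⟩
  refine hU.crosscut h.toJordanParam (a := a) (b := b) (by exact_mod_cast (by omega : a < b))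
    (by exact_mod_cast hb) h₁.toJordanParam (P := emb.arc (v a) (v b))
    (emb.isCompact_arc hadj).isClosed ?_ (σ := σ) ?_ hQ hQU ?_ ht ht' hcl hcl'
  · ext z
    rw [h₁.range_eq, mem_union, h.mem_image_Icc (by omega), emb.mem_arcUnion]
    simp only [mem_cycEdges_of_path h3]
    constructor
    · rintro ⟨x, y, ⟨r, hr, he⟩ | he, hz⟩
      · left
        refine ⟨a + r, by omega, by omega, ?_⟩
        rw [hp, hp] at he
        push_cast at he
        rw [← add_assoc] at he
        rcases Sym2.eq_iff.1 he with ⟨rfl, rfl⟩ | ⟨rfl, rfl⟩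
        · exact hz
        · rwa [emb.arc_symm]
      · right
        simp only [hp, add_tsub_cancel_right, ← hkb, Nat.cast_zero, add_zero] at he
        rcases Sym2.eq_iff.1 he with ⟨rfl, rfl⟩ | ⟨rfl, rfl⟩
        · rwa [emb.arc_symm]
        · exact hz
    · rintro (⟨i, h1, h2, hz⟩ | hz)
      · refine ⟨_, _, Or.inl ⟨(i - a).toNat, by omega, ?_⟩, hz⟩
        rw [hp, hp, show a + ((i - a).toNat : ℤ) = i by omega,
          show a + (((i - a).toNat + 1 : ℕ) : ℤ) = i + 1 by omega]
      · refine ⟨_, _, Or.inr ?_, hz⟩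
        simp only [hp, add_tsub_cancel_right, ← hkb, Nat.cast_zero, add_zero]
        exact Sym2.eq_swap
  · intro z hz
    by_cases hze : z ∈ ({emb.pos (v a), emb.pos (v b)} : Set (ℝ × ℝ))
    · right
      rwa [hends.1, hends.2]
    · exact Or.inl (hσ ⟨hz, hze⟩)
  · rw [disjoint_left]
    intro z hz hz'
    by_cases hze : z ∈ ({emb.pos (v a), emb.pos (v b)} : Set (ℝ × ℝ))
    · refine disjoint_left.1 (hU.off σ) (hQU hz) ?_
      rw [← hends.1, ← hends.2] at hze
      rcases hze with rfl | rfl <;> exact mem_range_self _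
    · exact disjoint_left.1 hQd hz ⟨hz', hze⟩

/-- The cycle formed by two spokes at a vertex off a given cycle and a segment of that cycle. -/
theorem _root_.CycSeq.exists_spoke_cycle (hs : CycSeq G v m) {a b : ℤ} (hab : a < b)
    (hb : b < a + m) {u : V} (hu : u ∉ range v) (hua : G.Adj u (v a)) (hub : G.Adj u (v b)) :
    ∃ v' m', CycSeq G v' m' ∧ ∀ e, e ∈ cycEdges v' ↔
      (∃ i, a ≤ i ∧ i < b ∧ e = s(v i, v (i + 1))) ∨ e = s(u, v a) ∨ e = s(u, v b) := by
  set k := (b - a).toNat with hk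
  have hkb : b = a + k := by omega
  have h3 : 3 ≤ k + 2 := by omega
  have hm1 : (k : ℤ) < m := by omega
  set p : ℕ → V := fun r => if r ≤ k then v (a + r) else u with hp
  have hpl : ∀ r, r ≤ k → p r = v (a + r) := fun r hr => if_pos hr
  have hpu : p (k + 1) = u := if_neg (by omega)
  have hpk : p k = v b := by rw [hpl k le_rfl, ← hkb]
  have hp0 : p 0 = v a := by simp [hpl]
  refine ⟨_, k + 2, CycSeq.of_path (p := p) h3
    (fun r hr s hs' hrs => by
      rw [mem_Iio] at hr hs'
      rcases Nat.lt_or_ge k r with h1 | h1 <;> rcases Nat.lt_or_ge k s with h2 | h2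
      · omega
      · obtain rfl : r = k + 1 := by omega
        rw [hpu, hpl s h2] at hrs
        exact absurd ⟨_, hrs.symm⟩ hu
      · obtain rfl : s = k + 1 := by omega
        rw [hpu, hpl r h1] at hrs
        exact absurd ⟨_, hrs⟩ hu
      · rw [hpl r h1, hpl s h2, hs.eq_iff] at hrs
        obtain ⟨x, hx⟩ := hrs
        have hx0 : x = 0 := by
          by_contra hne
          rcases lt_or_gt_of_ne hne with h0 | h0 <;> nlinarith
        simp [hx0] at hx
        omega)
    (fun r hr => by
      rcases Nat.lt_or_ge r k with h1 | h1
      · rw [hpl r (by omega), hpl (r + 1) (by omega)]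
        have := hs.adj (a + r)
        push_cast
        rwa [← add_assoc]
      · obtain rfl : r = k := by omega
        rw [hpk, hpu]
        exact hub.symm) (by
      rw [show k + 2 - 1 = k + 1 by omega, hpu, hp0]
      exact hua), fun e => ?_⟩
  rw [mem_cycEdges_of_path h3]
  constructor
  · rintro (⟨r, hr, rfl⟩ | rfl)
    · rcases Nat.lt_or_ge r k with h1 | h1
      · refine Or.inl ⟨a + r, by omega, by omega, ?_⟩
        rw [hpl r (by omega), hpl (r + 1) (by omega)]
        push_cast
        rw [← add_assoc]
      · obtain rfl : r = k := by omega
        rw [hpk, hpu]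
        exact Or.inr (Or.inr Sym2.eq_swap)
    · rw [show k + 2 - 1 = k + 1 by omega, hpu, hp0]
      exact Or.inr (Or.inl rfl)
  · rintro (⟨i, h1, h2, rfl⟩ | rfl | rfl)
    · refine Or.inl ⟨(i - a).toNat, by omega, ?_⟩
      rw [hpl _ (by omega), hpl _ (by omega), show a + ((i - a).toNat : ℤ) = i by omega,
        show a + (((i - a).toNat + 1 : ℕ) : ℤ) = i + 1 by omega]
    · right
      rw [show k + 2 - 1 = k + 1 by omega, hpu, hp0]
    · refine Or.inl ⟨k, by omega, ?_⟩
      rw [hpk, hpu]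
      exact Sym2.eq_swap

/-- Two spokes from a vertex off the cycle separate the two segments of the cycle within the side
of that vertex. -/
theorem spoke_crosscut (h : CycParam emb v m Γ) (hs : CycSeq G v m) (hU : JordanSides Γ U)
    {a b : ℤ} (hab : a < b) (hb : b < a + m) {u : V} (hu : u ∉ range v) (hua : G.Adj u (v a))
    (hub : G.Adj u (v b)) {σ : Bool}
    (hσ : ∀ w, G.Adj u w → emb.arc u w \ {emb.pos w} ⊆ U σ) {Q : Set (ℝ × ℝ)}
    (hQ : IsPreconnected Q) (hQU : Q ⊆ U σ)
    (hQd : ∀ w, G.Adj u w → Disjoint Q (emb.arc u w \ {emb.pos w})) {t t' : ℝ}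
    (ht : t ∈ Ioo (a : ℝ) b) (ht' : t' ∈ Ioo (b : ℝ) (a + m)) (hcl : Γ t ∈ closure Q)
    (hcl' : Γ t' ∈ closure Q) : False := by
  obtain ⟨v', m', hs₁, he₁⟩ := hs.exists_spoke_cycle hab hb hu hua hub
  obtain ⟨Γ₁, h₁⟩ := hs₁.exists_param emb
  have hends : Γ a = emb.pos (v a) ∧ Γ b = emb.pos (v b) := ⟨h.at_int a, h.at_int b⟩
  refine hU.crosscut h.toJordanParam (a := a) (b := b) (by exact_mod_cast hab)
    (by exact_mod_cast hb) h₁.toJordanParam (P := emb.arc u (v a) ∪ emb.arc u (v b))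
    ((emb.isCompact_arc hua).isClosed.union (emb.isCompact_arc hub).isClosed) ?_ (σ := σ) ?_ hQ
    hQU ?_ ht ht' hcl hcl'
  · have key : ∀ {x y x' y' : V} {z : ℝ × ℝ}, z ∈ emb.arc x y → s(x, y) = s(x', y') →
        z ∈ emb.arc x' y' := by
      intro x y x' y' z hz he
      rcases Sym2.eq_iff.1 he with ⟨rfl, rfl⟩ | ⟨rfl, rfl⟩
      · exact hz
      · rwa [emb.arc_symm]
    ext z
    rw [h₁.range_eq, mem_union, h.mem_image_Icc hab, emb.mem_arcUnion]
    simp only [he₁]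
    constructor
    · rintro ⟨x, y, ⟨i, h1, h2, he⟩ | he | he, hz⟩
      · exact Or.inl ⟨i, h1, h2, key hz he⟩
      · exact Or.inr (Or.inl (key hz he))
      · exact Or.inr (Or.inr (key hz he))
    · rintro (⟨i, h1, h2, hz⟩ | hz | hz)
      · exact ⟨_, _, Or.inl ⟨i, h1, h2, rfl⟩, hz⟩
      · exact ⟨_, _, Or.inr (Or.inl rfl), hz⟩
      · exact ⟨_, _, Or.inr (Or.inr rfl), hz⟩
  · rintro z (hz | hz)
    · by_cases hze : z = emb.pos (v a)
      · right; left
        rwa [hends.1]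
      · exact Or.inl (hσ _ hua ⟨hz, hze⟩)
    · by_cases hze : z = emb.pos (v b)
      · right; right
        rw [mem_singleton_iff, hze, hends.2]
      · exact Or.inl (hσ _ hub ⟨hz, hze⟩)
  · rw [disjoint_left]
    rintro z hz (hz' | hz')
    · by_cases hze : z = emb.pos (v a)
      · exact disjoint_left.1 (hU.off σ) (hQU hz) ⟨a, by rw [hze, hends.1]⟩
      · exact disjoint_left.1 (hQd _ hua) hz ⟨hz', hze⟩
    · by_cases hze : z = emb.pos (v b)
      · exact disjoint_left.1 (hU.off σ) (hQU hz) ⟨b, by rw [hze, hends.2]⟩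
      · exact disjoint_left.1 (hQd _ hub) hz ⟨hz', hze⟩

theorem exists_side_openArc (h : CycParam emb v m Γ) (hs : CycSeq G v m) (hU : JordanSides Γ U)
    {x y : V} (hxy : G.Adj x y) (hne : s(x, y) ∉ cycEdges v) :
    ∃ σ, openArc emb x y ⊆ U σ := by
  obtain ⟨hp, -, -, z, hz⟩ := emb.exists_openArc hxy
  have hd : Disjoint (openArc emb x y) (range Γ) := by
    rw [disjoint_left]
    rintro z hz hzr
    obtain ⟨w, -, rfl, hw⟩ := h.eq_pos_of_mem hs hxy hne hz.1 hzr
    exact emb.pos_notMem_openArc hxy _ hz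
  obtain ⟨σ, hσ⟩ := hU.cover z (disjoint_left.1 hd hz)
  exact ⟨σ, hU.subset_of_mem hp hd hz hσ⟩

/-- A spoke stays on the side of its end off the cycle. -/
theorem spoke_subset (h : CycParam emb v m Γ) (hs : CycSeq G v m) (hU : JordanSides Γ U)
    {u w : V} (hu : u ∉ range v) (huw : G.Adj u w) {σ : Bool} (hσ : emb.pos u ∈ U σ) :
    emb.arc u w \ {emb.pos w} ⊆ U σ := by
  refine hU.subset_of_mem (emb.exists_openArc huw).2.1 ?_ ⟨emb.pos_mem_arc_left huw,
    fun hh => huw.ne (emb.pos_injective hh)⟩ hσ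
  rw [disjoint_left]
  rintro z ⟨hz, hz'⟩ hzr
  have hne : s(u, w) ∉ cycEdges v := by
    rintro ⟨i, hi⟩
    apply hu
    rcases Sym2.eq_iff.1 hi with ⟨rfl, -⟩ | ⟨-, rfl⟩ <;> exact mem_range_self _
  obtain ⟨x, hx, rfl, rfl | rfl⟩ := h.eq_pos_of_mem hs huw hne hz hzr
  · exact hu hx
  · exact hz' rfl

end CycParam

end GraphTopology

section Faces

open Set Topology Filter

variable {V : Type*} {G : SimpleGraph V}

/-- A drawing of a cycle such that the vertices off the cycle have all their neighbours, and at
least two of them, on the cycle. -/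
structure CycDrawing (emb : PlaneEmbedding G) (v : ℤ → V) (m : ℕ) (Γ : ℝ → ℝ × ℝ)
    (U : Bool → Set (ℝ × ℝ)) : Prop where
  seq : CycSeq G v m
  par : CycParam emb v m Γ
  sides : JordanSides Γ U
  nbr_mem : ∀ u, u ∉ range v → ∀ w, G.Adj u w → w ∈ range v
  nbr_ne : ∀ u, u ∉ range v → ∀ y, ∃ z, z ≠ y ∧ G.Adj u z

/-- The edges of a cycle and the edges with an end off the cycle. -/
def hEdges (G : SimpleGraph V) (v : ℤ → V) : Set (Sym2 V) :=
  {e | e ∈ G.edgeSet ∧ (e ∈ cycEdges v ∨ ∃ u ∈ e, u ∉ range v)}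

/-- A face whose closure contains exactly one vertex off the cycle. -/
structure MinorAt (emb : PlaneEmbedding G) (v : ℤ → V) (g : Set (ℝ × ℝ)) (w : V) : Prop where
  isFace : IsFaceOf (arcUnion emb (hEdges G v)) g
  off : w ∉ range v
  mem : emb.pos w ∈ closure g
  unique : ∀ u, u ∉ range v → emb.pos u ∈ closure g → u = w

/-- The arc of the `i`-th edge of the cycle lies on the boundary of `g`. -/
def Touches (emb : PlaneEmbedding G) (v : ℤ → V) (g : Set (ℝ × ℝ)) (i : ℤ) : Prop :=
  emb.arc (v i) (v (i + 1)) ⊆ closure g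

theorem mem_Ioo_half (i : ℤ) : (i : ℝ) + 1 / 2 ∈ Ioo (i : ℝ) ((i + 1 : ℤ) : ℝ) := by
  push_cast
  constructor <;> linarith

theorem hEdges_subset {v : ℤ → V} : hEdges G v ⊆ G.edgeSet := fun _ he => he.1

theorem mem_hEdges {v : ℤ → V} {u w : V} (hu : u ∉ range v) (huw : G.Adj u w) : s(u, w) ∈ hEdges G v :=
  ⟨huw, Or.inr ⟨u, Sym2.mem_mk_left _ _, hu⟩⟩

theorem PlaneEmbedding.arc_subset_arcUnion (emb : PlaneEmbedding G) {v : ℤ → V} {u w : V}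
    (hu : u ∉ range v) (huw : G.Adj u w) : emb.arc u w ⊆ arcUnion emb (hEdges G v) :=
  fun _ hz => emb.mem_arcUnion.2 ⟨u, w, mem_hEdges hu huw, hz⟩

theorem IsFaceOf.disjoint {D g : Set (ℝ × ℝ)} (hg : IsFaceOf D g) :
    Disjoint g D := by
  obtain ⟨z, hz, rfl⟩ := hg
  exact subset_compl_iff_disjoint_right.1 (connectedComponentIn_subset _ _)

theorem IsFaceOf.isPreconnected {D g : Set (ℝ × ℝ)} (hg : IsFaceOf D g) :
    IsPreconnected g := by
  obtain ⟨z, hz, rfl⟩ := hg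
  exact isPreconnected_connectedComponentIn

namespace CycDrawing

variable {emb : PlaneEmbedding G} {v : ℤ → V} {m : ℕ} {Γ : ℝ → ℝ × ℝ} {U : Bool → Set (ℝ × ℝ)}
  (h : CycDrawing emb v m Γ U)
include h

theorem cycEdges_subset_hEdges : cycEdges v ⊆ hEdges G v :=
  fun _ he => ⟨h.seq.cycEdges_subset he, Or.inl he⟩

theorem range_subset : range Γ ⊆ arcUnion emb (hEdges G v) :=
  h.par.range_subset h.cycEdges_subset_hEdges

theorem exists_side {u : V} (hu : u ∉ range v) : ∃ σ, emb.pos u ∈ U σ :=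
  h.sides.cover _ fun hh => hu (h.par.exists_of_pos_mem h.seq hh)

theorem face_side {g : Set (ℝ × ℝ)} (hg : IsFaceOf (arcUnion emb (hEdges G v)) g) :
    ∃ σ, g ⊆ U σ := by
  obtain ⟨z, hz, rfl⟩ := hg
  obtain ⟨σ, hσ⟩ := h.sides.cover z fun hh => hz (h.range_subset hh)
  have hd := subset_compl_iff_disjoint_right.1
    (connectedComponentIn_subset (arcUnion emb (hEdges G v))ᶜ z)
  exact ⟨σ, h.sides.subset_of_mem isPreconnected_connectedComponentIn (hd.mono_right h.range_subset)
    (mem_connectedComponentIn hz) hσ⟩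

theorem mid_mem_of_touches {g : Set (ℝ × ℝ)} {i : ℤ} (ht : Touches emb v g i) :
    Γ (i + 1 / 2) ∈ closure g := by
  apply ht
  rw [← h.par.image_edge]
  exact ⟨_, ⟨by linarith, by linarith⟩, rfl⟩

theorem touches_congr {g : Set (ℝ × ℝ)} {i j : ℤ} (hd : (m : ℤ) ∣ i - j) :
    Touches emb v g i ↔ Touches emb v g j := by
  have h1 : v i = v j := (h.seq.eq_iff _ _).2 hd
  have h2 : v (i + 1) = v (j + 1) := (h.seq.eq_iff _ _).2 (by simpa using hd)
  rw [Touches, Touches, h1, h2]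

section

variable [Finite V]

/-- On each side of each edge of the cycle there is exactly one face. -/
theorem exists_faces : ∃ F : Bool → ℤ → Set (ℝ × ℝ),
    (∀ σ i, IsFaceOf (arcUnion emb (hEdges G v)) (F σ i) ∧ F σ i ⊆ U σ) ∧
    ∀ σ g, IsFaceOf (arcUnion emb (hEdges G v)) g → g ⊆ U σ → ∀ i,
      (Touches emb v g i ↔ g = F σ i) := by
  have hm : (1 : ℤ) ≤ m := by have := h.seq.three; omega
  have hex := fun (σ : Bool) (i : ℤ) => h.par.exists_component h.seq h.sides hEdges_subset
    (a := i) (b := i + 1) (by omega) (by omega) h.cycEdges_subset_hEdges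
    (fun _ _ _ j h1 h2 => by omega) σ
  choose z hzU hz hcl using hex
  have hF : ∀ σ i, IsFaceOf (arcUnion emb (hEdges G v))
      (connectedComponentIn (arcUnion emb (hEdges G v))ᶜ (z σ i)) ∧
      connectedComponentIn (arcUnion emb (hEdges G v))ᶜ (z σ i) ⊆ U σ := by
    intro σ i
    have h1 : IsFaceOf (arcUnion emb (hEdges G v))
      (connectedComponentIn (arcUnion emb (hEdges G v))ᶜ (z σ i)) := ⟨_, hz σ i, rfl⟩
    obtain ⟨τ, hτ⟩ := h.face_side h1
    obtain rfl := h.sides.eq_of_mem (hzU σ i) (hτ (mem_connectedComponentIn (hz σ i)))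
    exact ⟨h1, hτ⟩
  refine ⟨fun σ i => _, hF, ?_⟩
  rintro σ g ⟨y, hy, rfl⟩ hgU i
  have htouch : Touches emb v (connectedComponentIn (arcUnion emb (hEdges G v))ᶜ (z σ i)) i := by
    have := hcl σ i
    push_cast at this
    rwa [h.par.image_edge] at this
  constructor
  · intro ht
    have := h.par.linked_of_mem_closure h.seq h.sides hEdges_subset
      (a := i) (b := i + 1) (by omega) (by omega) h.cycEdges_subset_hEdges
      (fun _ _ _ j h1 h2 => by omega) (hgU (mem_connectedComponentIn hy)) (mem_Ioo_half i)
      (h.mid_mem_of_touches ht) (hzU σ i) (mem_Ioo_half i) (h.mid_mem_of_touches htouch)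
    exact connectedComponentIn_eq this.mem_component
  · intro he
    rw [he]
    exact htouch

/-- A minor face does not reach the spokes of the other vertices off the cycle. -/
theorem notMem_closure_of_spoke {g : Set (ℝ × ℝ)} {w : V} (hg : MinorAt emb v g w) {u y : V}
    (hu : u ∉ range v) (huw : u ≠ w) (huy : G.Adj u y) {z : ℝ × ℝ} (hz : z ∈ emb.arc u y)
    (hzy : z ≠ emb.pos y) : z ∉ closure g := by
  intro hzg
  have hzu : z ≠ emb.pos u := by
    rintro rfl
    exact huw (hg.unique u hu hzg)
  obtain ⟨z₀, hz₀, rfl⟩ := hg.isFace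
  obtain ⟨a, rfl⟩ := h.nbr_mem u hu y huy
  obtain ⟨y', hy', huy'⟩ := h.nbr_ne u hu (v a)
  obtain ⟨b, hab, hb, rfl⟩ := h.seq.exists_mem_Ico a (h.nbr_mem u hu y' huy')
  have hab' : a < b := hab.lt_of_ne (by rintro rfl; exact hy' rfl)
  obtain ⟨v', m', hs₁, he₁⟩ := h.seq.exists_spoke_cycle hab' hb hu huy huy'
  obtain ⟨Γ₁, h₁⟩ := hs₁.exists_param emb
  obtain ⟨W, hW⟩ := h₁.exists_sides
  have hsub : cycEdges v' ⊆ hEdges G v := by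
    intro e he
    rcases (he₁ e).1 he with ⟨i, -, -, rfl⟩ | rfl | rfl
    · exact h.cycEdges_subset_hEdges ⟨i, rfl⟩
    · exact mem_hEdges hu huy
    · exact mem_hEdges hu huy'
  obtain ⟨τ, hτ⟩ := hW.cover z₀ fun hh => hz₀ (h₁.range_subset hsub hh)
  obtain ⟨i, hi⟩ : s(u, v a) ∈ cycEdges v' := (he₁ _).2 (Or.inr (Or.inl rfl))
  have key : ∀ z, z ∈ emb.arc u (v a) → z ∈ Γ₁ '' Icc (i : ℝ) (i + 1) := by
    intro z hz
    rw [h₁.image_edge]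
    rcases Sym2.eq_iff.1 hi with ⟨h1, h2⟩ | ⟨h1, h2⟩
    · rwa [h1, h2]
    · rwa [h1, h2, emb.arc_symm]
  obtain ⟨t, ht, rfl⟩ := key z hz
  have hne : ∀ j : ℤ, (j = i ∨ j = i + 1) → t ≠ j := by
    rintro j hj rfl
    rw [h₁.at_int] at hzu hzy
    have : v' j ∈ s(u, v a) := by
      rw [← hi]
      rcases hj with rfl | rfl <;> simp
    rcases Sym2.mem_iff.1 this with h1 | h1
    · exact hzu (by rw [h1])
    · exact hzy (by rw [h1])
  have ht' : t ∈ Ioo (i : ℝ) ((i + 1 : ℤ) : ℝ) := by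
    refine ⟨ht.1.lt_of_ne (hne i (Or.inl rfl)).symm, lt_of_le_of_ne ?_ (hne _ (Or.inr rfl))⟩
    push_cast
    exact ht.2
  have hm' : (1 : ℤ) ≤ m' := by have := hs₁.three; omega
  have := h₁.closure_spread hs₁ hW hEdges_subset (by omega) (by omega) hsub
    (fun _ _ _ j h1 h2 => by omega) hτ ht' hzg
  push_cast at this
  exact huw (hg.unique u hu (this (key _ (emb.pos_mem_arc_left huy))))

/-- A minor face extends past every vertex of the cycle not adjacent to its vertex off the
cycle. -/
theorem touches_of_not_adj {g : Set (ℝ × ℝ)} {w : V} (hg : MinorAt emb v g w) {i j k : ℤ}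
    (hw : ¬ G.Adj w (v (i + 1))) (hj : j = i ∨ j = i + 1) (hk : k = i ∨ k = i + 1)
    (ht : Touches emb v g j) : Touches emb v g k := by
  obtain ⟨σ, hσ⟩ := h.face_side hg.isFace
  have hw0 := hg.off
  have hns : ∀ u, u ∉ range v → u ≠ w → ∀ y, G.Adj u y → ∀ z ∈ emb.arc u y, z ≠ emb.pos y →
      z ∉ closure g :=
    fun u hu huw y huy z hz hzy => h.notMem_closure_of_spoke hg hu huw huy hz hzy
  obtain ⟨z₀, hz₀, rfl⟩ := hg.isFace
  set E : Set (Sym2 V) := cycEdges v ∪ {e | e ∈ G.edgeSet ∧ w ∈ e} with hE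
  have hED : E ⊆ hEdges G v := by
    rintro e (he | ⟨he, hwe⟩)
    · exact h.cycEdges_subset_hEdges he
    · exact ⟨he, Or.inr ⟨w, hwe, hw0⟩⟩
  have hEG : E ⊆ G.edgeSet := hED.trans hEdges_subset
  have hsub : arcUnion emb E ⊆ arcUnion emb (hEdges G v) := biUnion_subset_biUnion_left hED
  set g := connectedComponentIn (arcUnion emb (hEdges G v))ᶜ z₀ with hg'
  have hz₀g : z₀ ∈ g := mem_connectedComponentIn hz₀
  have hDcl := (emb.isCompact_arcUnion (hEdges_subset (G := G) (v := v))).isClosed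
  have hgo : IsOpen g := hDcl.isOpen_compl.connectedComponentIn
  have hcomp : connectedComponentIn (arcUnion emb E)ᶜ z₀ = g := by
    apply Subset.antisymm
    · refine isPreconnected_connectedComponentIn.subset_of_closure_inter_subset hgo
        ⟨z₀, mem_connectedComponentIn fun hh => hz₀ (hsub hh), hz₀g⟩ ?_
      rintro z ⟨hzg, hzS⟩
      have hzE := connectedComponentIn_subset _ _ hzS
      rcases closure_component_subset hDcl z₀ hzg with h1 | h1
      · exact h1
      exfalso
      obtain ⟨x, y, he, hz⟩ := emb.mem_arcUnion.1 h1
      rcases he.2 with hc | ⟨u, hue, hu⟩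
      · exact hzE (emb.mem_arcUnion.2 ⟨x, y, Or.inl hc, hz⟩)
      have hE' : s(x, y) ∉ E := fun hh => hzE (emb.mem_arcUnion.2 ⟨x, y, hh, hz⟩)
      have hadj : G.Adj x y := he.1
      obtain ⟨y', huy', hzu, hee⟩ : ∃ y', G.Adj u y' ∧ z ∈ emb.arc u y' ∧ s(u, y') = s(x, y) := by
        rcases Sym2.mem_iff.1 hue with rfl | rfl
        · exact ⟨y, hadj, hz, rfl⟩
        · exact ⟨x, hadj.symm, by rwa [emb.arc_symm], Sym2.eq_swap⟩
      have huw : u ≠ w := by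
        rintro rfl
        exact hE' (Or.inr ⟨hadj, hue⟩)
      by_cases hzy : z = emb.pos y'
      · obtain ⟨i, rfl⟩ := h.nbr_mem u hu y' huy'
        refine hzE (h.par.range_subset subset_union_left ⟨i, ?_⟩)
        rw [h.par.at_int, hzy]
      · exact hns u hu huw y' huy' z hzu hzy hzg
    · exact connectedComponentIn_mono _ (compl_subset_compl.2 hsub)
  have hfree : ∀ e ∈ E, e ∉ cycEdges v → ∀ j, i < j → j < i + 2 → v j ∉ e := by
    rintro e (he | ⟨he, hwe⟩) hec j h1 h2 hj
    · exact hec he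
    · obtain rfl : j = i + 1 := by omega
      have hne : w ≠ v (i + 1) := fun hh => hw0 ⟨_, hh.symm⟩
      rw [(Sym2.mem_and_mem_iff hne).1 ⟨hwe, hj⟩] at he
      exact hw he
  have hm : (2 : ℤ) ≤ m := by have := h.seq.three; omega
  have hmid := h.mid_mem_of_touches ht
  rw [← hcomp] at hmid
  have := h.par.closure_spread h.seq h.sides hEG (a := i) (b := i + 2) (by omega) (by omega)
    subset_union_left hfree (hσ hz₀g) (t := j + 1 / 2) (by
      rcases hj with rfl | rfl <;> push_cast <;> constructor <;> linarith) hmid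
  rw [hcomp] at this
  intro z hz
  rw [← h.par.image_edge] at hz
  refine this (image_mono (Icc_subset_Icc ?_ ?_) hz) <;> rcases hk with rfl | rfl <;> push_cast <;>
    linarith

omit [Finite V] in
theorem not_adj_of_touches {g : Set (ℝ × ℝ)} (hg : IsFaceOf (arcUnion emb (hEdges G v)) g)
    {σ : Bool} (hgU : g ⊆ U σ) {j : ℤ} (h1 : Touches emb v g (j - 1)) (h2 : Touches emb v g j)
    {u : V} (hu : u ∉ range v) (huU : emb.pos u ∈ U σ) : ¬ G.Adj u (v j) := by
  intro huj
  obtain ⟨y', hy', huy'⟩ := h.nbr_ne u hu (v j)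
  obtain ⟨k, hjk, hk, rfl⟩ := h.seq.exists_mem_Ico j (h.nbr_mem u hu y' huy')
  have hjk' : j < k := hjk.lt_of_ne (by rintro rfl; exact hy' rfl)
  have h3 : Touches emb v g (j - 1 + m) := (h.touches_congr ⟨-1, by ring⟩).1 h1
  have r1 : (j : ℝ) + 1 ≤ k := by exact_mod_cast hjk'
  have r2 : (k : ℝ) + 1 ≤ j + m := by exact_mod_cast hk
  refine h.par.spoke_crosscut h.seq h.sides hjk' hk hu huj huy'
    (fun w hw => h.par.spoke_subset h.seq h.sides hu hw huU) hg.isPreconnected hgU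
    (fun w hw => hg.disjoint.mono_right (sdiff_subset.trans (emb.arc_subset_arcUnion hu hw)))
    (t := j + 1 / 2) (t' := (j - 1 + m : ℤ) + 1 / 2) ⟨by linarith, by linarith⟩
    ⟨?_, ?_⟩ (h.mid_mem_of_touches h2) (h.mid_mem_of_touches h3) <;> push_cast <;> linarith

/-- The edges of the cycle on the boundary of a minor face form a segment, whose ends are adjacent
to the vertex of the face off the cycle. -/
theorem exists_segment {g : Set (ℝ × ℝ)} {w : V} (hg : MinorAt emb v g w) {i₀ : ℤ}
    (ht : Touches emb v g i₀) : ∃ a b : ℤ, a ≤ i₀ ∧ i₀ < b ∧ b < a + m ∧ G.Adj w (v a) ∧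
      G.Adj w (v b) ∧ ∀ i, Touches emb v g i ↔ ∃ r : ℤ, a ≤ i + r * m ∧ i + r * m < b := by
  obtain ⟨σ, hσ⟩ := h.face_side hg.isFace
  have hwU : emb.pos w ∈ U σ := by
    rcases h.sides.closure_subset (closure_mono hσ hg.mem) with h1 | h1
    · exact h1
    · exact absurd (h.par.exists_of_pos_mem h.seq h1) hg.off
  obtain ⟨y, -, hy⟩ := h.nbr_ne w hg.off w
  obtain ⟨a, ⟨hai, haw⟩, hamax⟩ := Int.exists_greatest_of_bdd (P := fun i => i ≤ i₀ ∧ G.Adj w (v i))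
    ⟨i₀, fun z hz => hz.1⟩ (by
      obtain ⟨i, h1, h2, rfl⟩ := h.seq.exists_mem_Ico (i₀ - m + 1) (h.nbr_mem w hg.off y hy)
      exact ⟨i, by omega, hy⟩)
  obtain ⟨b, ⟨hib, hbw⟩, hbmin⟩ := Int.exists_least_of_bdd (P := fun i => i₀ < i ∧ G.Adj w (v i))
    ⟨i₀, fun z hz => hz.1.le⟩ (by
      obtain ⟨i, h1, h2, rfl⟩ := h.seq.exists_mem_Ico (i₀ + 1) (h.nbr_mem w hg.off y hy)
      exact ⟨i, by omega, hy⟩)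
  obtain ⟨y', hy', hwy'⟩ := h.nbr_ne w hg.off (v a)
  obtain ⟨c, hac, hc, rfl⟩ := h.seq.exists_mem_Ico a (h.nbr_mem w hg.off y' hwy')
  have hac' : a < c := hac.lt_of_ne (by rintro rfl; exact hy' rfl)
  have hic : i₀ < c := by
    by_contra hh
    exact absurd (hamax c ⟨by omega, hwy'⟩) (by omega)
  have hbc := hbmin c ⟨hic, hwy'⟩
  have hba : b < a + m := by omega
  have hup : ∀ k : ℕ, i₀ + k < b → Touches emb v g (i₀ + k) := by
    intro k
    induction k with
    | zero => intro _; simpa using ht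
    | succ k ih =>
      intro hk
      push_cast at hk ⊢
      refine h.touches_of_not_adj hg (i := i₀ + k) (fun hh => ?_) (Or.inl rfl) (Or.inr (by ring))
        (ih (by omega))
      have := hbmin _ ⟨by omega, hh⟩
      omega
  have hdown : ∀ k : ℕ, a ≤ i₀ - k → Touches emb v g (i₀ - k) := by
    intro k
    induction k with
    | zero => intro _; simpa using ht
    | succ k ih =>
      intro hk
      push_cast at hk ⊢
      refine h.touches_of_not_adj hg (i := i₀ - (k + 1)) (fun hh => ?_) (Or.inr (by ring))
        (Or.inl rfl) (ih (by omega))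
      have := hamax _ ⟨by omega, hh⟩
      omega
  have hall : ∀ i, a ≤ i → i < b → Touches emb v g i := by
    intro i h1 h2
    rcases le_total i₀ i with h3 | h3
    · have := hup (i - i₀).toNat (by omega)
      rwa [show i₀ + ((i - i₀).toNat : ℤ) = i by omega] at this
    · have := hdown (i₀ - i).toNat (by omega)
      rwa [show i₀ - ((i₀ - i).toNat : ℤ) = i by omega] at this
  refine ⟨a, b, hai, hib, hba, haw, hbw, fun i => ⟨fun hi => ?_, ?_⟩⟩
  · have hm : (0 : ℤ) < m := by omega
    obtain ⟨r, hr⟩ : ∃ r : ℤ, i + r * m = a + (i - a) % m := by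
      refine ⟨-((i - a) / m), ?_⟩
      have := Int.mul_ediv_add_emod (i - a) m
      linarith
    have h1 := Int.emod_nonneg (i - a) hm.ne'
    have h2 := Int.emod_lt_of_pos (i - a) hm
    refine ⟨r, by omega, ?_⟩
    by_contra hge
    have hi' : Touches emb v g (i + r * m) := (h.touches_congr ⟨-r, by ring⟩).1 hi
    have r1 : (a : ℝ) + 1 ≤ b := by exact_mod_cast (by omega : a + 1 ≤ b)
    have r2 : (b : ℝ) ≤ (i + r * m : ℤ) := by exact_mod_cast (by omega : b ≤ i + r * m)
    have r3 : ((i + r * m : ℤ) : ℝ) + 1 ≤ a + m := by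
      exact_mod_cast (by omega : i + r * m + 1 ≤ a + m)
    exact h.par.spoke_crosscut h.seq h.sides (by omega) hba hg.off haw hbw
      (fun w hw => h.par.spoke_subset h.seq h.sides hg.off hw hwU) hg.isFace.isPreconnected hσ
      (fun w hw => hg.isFace.disjoint.mono_right
        (sdiff_subset.trans (emb.arc_subset_arcUnion hg.off hw)))
      (t := a + 1 / 2) (t' := (i + r * m : ℤ) + 1 / 2) ⟨by linarith, by linarith⟩
      ⟨by linarith, by linarith⟩ (h.mid_mem_of_touches (hall a le_rfl (by omega)))
      (h.mid_mem_of_touches hi')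
  · rintro ⟨r, h1, h2⟩
    exact (h.touches_congr ⟨r, by ring⟩).1 (hall _ h1 h2)

end

theorem openArc_closure {x y : V} (hxy : G.Adj x y) {j : ℤ} (hj : v j = x ∨ v j = y) :
    Γ j ∈ closure (openArc emb x y) := by
  apply (emb.exists_openArc hxy).2.2.1
  rw [h.par.at_int]
  rcases hj with rfl | rfl
  exacts [emb.pos_mem_arc_left hxy, emb.pos_mem_arc_right hxy]

/-- A chord does not cross two spokes on the same side. -/
theorem not_cross_spokes {w : V} (hw : w ∉ range v) {σ : Bool} (hwU : emb.pos w ∈ U σ)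
    {a b j l : ℤ} (haw : G.Adj w (v a)) (hbw : G.Adj w (v b)) (hjl : G.Adj (v j) (v l))
    (hσ : openArc emb (v j) (v l) ⊆ U σ) (h1 : a < j) (h2 : j < b) (h3 : b < l) (h4 : l < a + m) :
    False := by
  refine h.par.spoke_crosscut h.seq h.sides (by omega) (by omega) hw haw hbw
    (fun w' hw' => h.par.spoke_subset h.seq h.sides hw hw' hwU) (emb.exists_openArc hjl).1 hσ
    (fun y hy => ?_) (t := j) (t' := l) ⟨by exact_mod_cast h1, by exact_mod_cast h2⟩
    ⟨by exact_mod_cast h3, by exact_mod_cast h4⟩ (h.openArc_closure hjl (Or.inl rfl))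
    (h.openArc_closure hjl (Or.inr rfl))
  rw [disjoint_left]
  rintro z hz ⟨hz', -⟩
  have hne : s(v j, v l) ≠ s(w, y) := by
    intro he
    apply hw
    rcases Sym2.eq_iff.1 he with ⟨rfl, -⟩ | ⟨-, rfl⟩ <;> exact mem_range_self _
  obtain ⟨x, rfl, -⟩ := emb.eq_of_mem_arcs hjl hy hne hz.1 hz'
  exact emb.pos_notMem_openArc hjl _ hz

/-- Two chords on the same side do not cross. -/
theorem not_cross_chords {σ : Bool} {a b j l : ℤ} (hab : G.Adj (v a) (v b))
    (habσ : openArc emb (v a) (v b) ⊆ U σ) (hjl : G.Adj (v j) (v l))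
    (hσ : openArc emb (v j) (v l) ⊆ U σ) (h1 : a < j) (h2 : j < b) (h3 : b < l) (h4 : l < a + m) :
    False := by
  refine h.par.chord_crosscut h.seq h.sides (by omega) (by omega) hab habσ
    (emb.exists_openArc hjl).1 hσ ?_ (t := j) (t' := l)
    ⟨by exact_mod_cast h1, by exact_mod_cast h2⟩
    ⟨by exact_mod_cast h3, by exact_mod_cast h4⟩ (h.openArc_closure hjl (Or.inl rfl))
    (h.openArc_closure hjl (Or.inr rfl))
  rw [disjoint_left]
  rintro z hz ⟨hz', -⟩
  have hne : s(v j, v l) ≠ s(v a, v b) := by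
    intro he
    have : v j = v a ∨ v j = v b := by
      rcases Sym2.eq_iff.1 he with ⟨h1, -⟩ | ⟨h1, -⟩
      exacts [Or.inl h1, Or.inr h1]
    rcases this with he | he
    · rw [h.seq.eq_iff] at he
      have := Int.le_of_dvd (by omega) he
      omega
    · rw [h.seq.eq_iff, ← dvd_neg] at he
      have := Int.le_of_dvd (by omega) he
      omega
  obtain ⟨x, rfl, -⟩ := emb.eq_of_mem_arcs hjl hab hne hz.1 hz'
  exact emb.pos_notMem_openArc hjl _ hz

end CycDrawing

end Faces

section Config

open Set Topology Filter

variable {V : Type*} {G : SimpleGraph V}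

/-- The combinatorial data of a longest isolating cycle in a plane graph: the vertices off the
cycle and the chords are distributed to the two sides of the cycle. -/
structure CycleConfig (G : SimpleGraph V) (c : ℤ → V) (n : ℕ) (side : Bool → V → Prop)
    (K : Bool → V → V → Prop) : Prop where
  seq : CycSeq G c n
  eight : 8 ≤ n
  nbr_mem : ∀ u, u ∉ range c → ∀ w, G.Adj u w → w ∈ range c
  deg_le : ∀ u, u ∉ range c → ∃ x y z, ∀ w, G.Adj u w → w = x ∨ w = y ∨ w = z
  off : ∀ σ u, side σ u → u ∉ range c
  side_unique : ∀ σ τ u, side σ u → side τ u → σ = τ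
  side_exists : ∀ u, u ∉ range c → ∃ σ, side σ u
  K_symm : ∀ σ x y, K σ x y → K σ y x
  K_exists : ∀ i j, G.Adj (c i) (c j) → s(c i, c j) ∉ cycEdges c → ∃ σ, K σ (c i) (c j)
  not_cross_spokes : ∀ σ w a b j l, side σ w → G.Adj w (c a) → G.Adj w (c b) →
    G.Adj (c j) (c l) → K σ (c j) (c l) → a < j → j < b → b < l → l < a + n → False
  not_cross_chords : ∀ σ a b j l, G.Adj (c a) (c b) → K σ (c a) (c b) →
    G.Adj (c j) (c l) → K σ (c j) (c l) → a < j → j < b → b < l → l < a + n → False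
  connected : ∀ (A : Set V) (x y : V), A.Nonempty → x ∉ A → y ∉ A →
    (∃ b, b ∉ A ∧ b ≠ x ∧ b ≠ y) → ∃ a ∈ A, ∃ b, b ∉ A ∧ b ≠ x ∧ b ≠ y ∧ G.Adj a b
  longest : ∀ (m : ℕ) (v : ℤ → V), CycSeq G v m → range c ⊆ range v → m ≤ n

theorem CycSeq.shift {c : ℤ → V} {n : ℕ} (h : CycSeq G c n) (s : ℤ) :
    CycSeq G (fun i => c (i + s)) n :=
  ⟨h.three, fun i j => by rw [h.eq_iff]; ring_nf, fun i => by
    rw [add_right_comm]; exact h.adj _⟩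

theorem CycSeq.neg {c : ℤ → V} {n : ℕ} (h : CycSeq G c n) : CycSeq G (fun i => c (-i)) n :=
  ⟨h.three, fun i j => by rw [h.eq_iff, ← dvd_neg]; ring_nf, fun i => by
    have := (h.adj (-(i + 1))).symm
    rwa [show -(i + 1) + 1 = -i by ring] at this⟩

theorem range_shift (c : ℤ → V) (s : ℤ) : range (fun i => c (i + s)) = range c :=
  (Equiv.addRight s).surjective.range_comp c

theorem range_neg_comp (c : ℤ → V) : range (fun i => c (-i)) = range c :=
  (Equiv.neg ℤ).surjective.range_comp c

theorem cycEdges_shift (c : ℤ → V) (s : ℤ) : cycEdges (fun i => c (i + s)) = cycEdges c := by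
  rw [cycEdges, cycEdges, ← range_shift (fun i => s(c i, c (i + 1))) s]
  simp only [add_right_comm]

theorem cycEdges_neg (c : ℤ → V) : cycEdges (fun i => c (-i)) = cycEdges c := by
  have := (Equiv.subRight (-1 : ℤ)).surjective.range_comp (fun i => s(c (-i), c (-(i - 1))))
  rw [cycEdges, cycEdges]
  ext e
  constructor
  · rintro ⟨i, rfl⟩
    exact ⟨-(i + 1), by simp [Sym2.eq_swap]⟩
  · rintro ⟨i, rfl⟩
    exact ⟨-(i + 1), by simp [Sym2.eq_swap]⟩

namespace CycleConfig

variable {c : ℤ → V} {n : ℕ} {side : Bool → V → Prop} {K : Bool → V → V → Prop}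
  (h : CycleConfig G c n side K)
include h

theorem shift (s : ℤ) : CycleConfig G (fun i => c (i + s)) n side K where
  seq := h.seq.shift s
  eight := h.eight
  nbr_mem := by rw [range_shift]; exact h.nbr_mem
  deg_le := by rw [range_shift]; exact h.deg_le
  off := by rw [range_shift]; exact h.off
  side_unique := h.side_unique
  side_exists := by rw [range_shift]; exact h.side_exists
  K_symm := h.K_symm
  K_exists := by rw [cycEdges_shift]; exact fun i j => h.K_exists _ _
  not_cross_spokes := fun σ w a b j l h1 h2 h3 h4 h5 _ _ _ _ =>
    h.not_cross_spokes σ w _ _ _ _ h1 h2 h3 h4 h5 (by omega) (by omega) (by omega) (by omega)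
  not_cross_chords := fun σ a b j l h1 h2 h3 h4 _ _ _ _ =>
    h.not_cross_chords σ _ _ _ _ h1 h2 h3 h4 (by omega) (by omega) (by omega) (by omega)
  connected := h.connected
  longest := by rw [range_shift]; exact h.longest

theorem neg : CycleConfig G (fun i => c (-i)) n side K where
  seq := h.seq.neg
  eight := h.eight
  nbr_mem := by rw [range_neg_comp]; exact h.nbr_mem
  deg_le := by rw [range_neg_comp]; exact h.deg_le
  off := by rw [range_neg_comp]; exact h.off
  side_unique := h.side_unique
  side_exists := by rw [range_neg_comp]; exact h.side_exists
  K_symm := h.K_symm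
  K_exists := by rw [cycEdges_neg]; exact fun i j => h.K_exists _ _
  not_cross_spokes := fun σ w a b j l h1 h2 h3 h4 h5 _ _ _ _ => by
    have e : c (-l) = c (-l + n) := (h.seq.eq_iff _ _).2 ⟨-1, by ring⟩
    rw [e] at h4 h5
    exact h.not_cross_spokes σ w (-b) (-a) (-j) (-l + n) h1 h3 h2 h4 h5 (by omega) (by omega)
      (by omega) (by omega)
  not_cross_chords := fun σ a b j l h1 h2 h3 h4 _ _ _ _ => by
    have e : c (-l) = c (-l + n) := (h.seq.eq_iff _ _).2 ⟨-1, by ring⟩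
    rw [e] at h3 h4
    exact h.not_cross_chords σ (-b) (-a) (-j) (-l + n) h1.symm (h.K_symm _ _ _ h2) h3 h4
      (by omega) (by omega) (by omega) (by omega)
  connected := h.connected
  longest := by rw [range_neg_comp]; exact h.longest

theorem ne {i j : ℤ} (h1 : i < j) (h2 : j < i + n) : c i ≠ c j := by
  rw [Ne, h.seq.eq_iff, ← dvd_neg]
  intro hd
  have := Int.le_of_dvd (by omega) hd
  omega

theorem add_period (i : ℤ) : c (i + n) = c i := (h.seq.eq_iff _ _).2 ⟨1, by ring⟩

/-- A path with more than `b - a` vertices cannot replace the segment from `a` to `b` of the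
cycle if it contains all vertices of this segment. -/
theorem reroute {k : ℕ} {e : Fin k → V} (he : Function.Injective e) (heoff : ∀ i, e i ∉ range c)
    {a b : ℤ} (ts : List (ℤ ⊕ Fin k)) (hb : b ≤ a + n)
    (hts : (Sum.inl a :: ts).Nodup ∧ (∀ i ∈ Finset.Ico a b, ∃ t ∈ Sum.inl a :: ts, t = Sum.inl i) ∧
      (Sum.inl a :: ts).all (Sum.elim (fun i => decide (a ≤ i ∧ i < b)) fun _ => true) = true ∧
      b - a ≤ ts.length)
    (hch : ((Sum.inl a :: ts).map (Sum.elim c e) ++ [c b]).IsChain G.Adj) : False := by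
  obtain ⟨hnd, hmem', hall, hlen⟩ := hts
  have hmem : ∀ i ∈ Finset.Ico a b, Sum.inl i ∈ Sum.inl a :: ts := by
    intro i hi
    obtain ⟨t, ht, rfl⟩ := hmem' i hi
    exact ht
  have hlt : ∀ i, Sum.inl i ∈ Sum.inl a :: ts → i ∈ Finset.Ico a b := by
    intro i hi
    have := List.all_eq_true.1 hall _ hi
    simpa using this
  set T : List (ℤ ⊕ Fin k) := Sum.inl a :: ts with hT
  set L : List V := T.map (Sum.elim c e) with hL
  have hLl : L.length = ts.length + 1 := by simp [hL, hT]
  have hab : a < b := by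
    have := hlt a (by simp [hT])
    simpa using this
  obtain ⟨r, hr⟩ : ∃ r : ℕ, (r : ℤ) = a + n - b := ⟨(a + n - b).toNat, by omega⟩
  set p : ℕ → V := fun i => if hi : i < L.length then L[i] else c (b + (i - L.length : ℕ)) with hp
  have hinjT : ∀ x ∈ T, ∀ y ∈ T, Sum.elim c e x = Sum.elim c e y → x = y := by
    rintro (i | i) hi (j | j) hj hij
    · have h1 := Finset.mem_Ico.1 (hlt i hi)
      have h2 := Finset.mem_Ico.1 (hlt j hj)
      rcases lt_trichotomy i j with h3 | h3 | h3
      · exact absurd hij (h.ne h3 (by omega))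
      · rw [h3]
      · exact absurd hij.symm (h.ne h3 (by omega))
    · exact absurd ⟨i, hij⟩ (heoff j)
    · exact absurd ⟨j, hij.symm⟩ (heoff i)
    · rw [he hij]
  have hcyc : CycSeq G (fun i : ℤ => p (i % (L.length + r : ℕ)).toNat) (L.length + r) := by
    have hn := h.eight
    have hLp : ∀ i (hi : i < L.length), p i = L[i] := fun i hi => by simp [hp, hi]
    have hcp : ∀ i, p (L.length + i) = c (b + i) := fun i => by simp [hp]
    have hLT : ∀ i (hi : i < L.length), L[i] = Sum.elim c e (T[i]'(by simpa [hL] using hi)) :=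
      fun i hi => by simp [hL]
    have hcL : ∀ i (hi : i < L.length) (j : ℕ), j < r → L[i] ≠ c (b + j) := by
      intro i hi j hj hij
      rw [hLT] at hij
      have hm := List.getElem_mem (l := T) (n := i) (by simpa [hL] using hi)
      rcases hx : T[i]'(by simpa [hL] using hi) with x | x
      · rw [hx] at hij hm
        have h1 := Finset.mem_Ico.1 (hlt x hm)
        exact h.ne (by omega) (by omega) hij
      · rw [hx] at hij
        exact heoff x ⟨_, hij.symm⟩
    refine CycSeq.of_path (by omega) ?_ ?_ ?_
    · intro i hi j hj hij
      simp only [mem_Iio] at hi hj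
      rcases lt_or_ge i L.length with hi' | hi' <;> rcases lt_or_ge j L.length with hj' | hj'
      · rw [hLp i hi', hLp j hj', hLT, hLT] at hij
        have := hinjT _ (List.getElem_mem _) _ (List.getElem_mem _) hij
        exact (List.Nodup.getElem_inj_iff hnd).1 this
      · obtain ⟨j, rfl⟩ := Nat.exists_eq_add_of_le hj'
        rw [hLp i hi', hcp] at hij
        exact absurd hij (hcL i hi' j (by omega))
      · obtain ⟨i, rfl⟩ := Nat.exists_eq_add_of_le hi'
        rw [hLp j hj', hcp] at hij
        exact absurd hij.symm (hcL j hj' i (by omega))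
      · obtain ⟨j, rfl⟩ := Nat.exists_eq_add_of_le hj'
        obtain ⟨i, rfl⟩ := Nat.exists_eq_add_of_le hi'
        rw [hcp, hcp] at hij
        rcases lt_trichotomy i j with h3 | h3 | h3
        · exact absurd hij (h.ne (by omega) (by omega))
        · rw [h3]
        · exact absurd hij.symm (h.ne (by omega) (by omega))
    · intro i hi
      rcases lt_or_ge i L.length with hi' | hi'
      · have := List.isChain_iff_getElem.1 hch i (by simp; omega)
        rw [hLp i hi']
        rw [List.getElem_append_left hi'] at this
        rcases lt_or_ge (i + 1) L.length with hi2 | hi2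
        · rwa [List.getElem_append_left hi2, ← hLp _ hi2] at this
        · rw [List.getElem_append_right hi2] at this
          obtain hi3 | hi3 : i + 1 = L.length ∨ L.length < i + 1 := by omega
          · have h0 := hcp 0
            simp only [List.getElem_singleton] at this
            have e1 : i + 1 = L.length + 0 := by omega
            rw [e1, h0]
            simpa using this
          · omega
      · obtain ⟨i, rfl⟩ := Nat.exists_eq_add_of_le hi'
        rw [add_assoc, hcp, hcp]
        push_cast
        rw [← add_assoc]
        exact h.seq.adj _
    · have h0 : p 0 = c a := by
        rw [hLp 0 (by omega)]
        simp [hL, hT]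
      rw [h0]
      rcases Nat.eq_zero_or_pos r with hr0 | hr0
      · have := List.isChain_iff_getElem.1 hch (L.length - 1) (by simp; omega)
        rw [List.getElem_append_left (by omega), List.getElem_append_right (by omega)] at this
        rw [hr0, add_zero, hLp _ (by omega)]
        simp only [List.getElem_singleton] at this
        have hb' : b = a + n := by omega
        rwa [hb', h.add_period] at this
      · have e1 : L.length + r - 1 = L.length + (r - 1) := by omega
        rw [e1, hcp]
        have := h.seq.adj (b + (r - 1 : ℕ))
        rwa [show b + ((r - 1 : ℕ) : ℤ) + 1 = a + n by omega, h.add_period] at this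
  have hmr : ∀ i, i < L.length + r → p i ∈ range (fun i : ℤ => p (i % (L.length + r : ℕ)).toNat) := by
    intro i hi
    refine ⟨i, ?_⟩
    simp only
    rw [Int.emod_eq_of_lt (by omega) (by exact_mod_cast hi), Int.toNat_natCast]
  have := h.longest _ _ hcyc (by
    rintro _ ⟨i, rfl⟩
    obtain ⟨j, hj1, hj2, hj⟩ := h.seq.exists_mem_Ico a (w := c i) ⟨i, rfl⟩
    rw [← hj]
    rcases lt_or_ge j b with hjb | hjb
    · obtain ⟨q, hq, hq'⟩ := List.getElem_of_mem (hmem j (Finset.mem_Ico.2 ⟨hj1, hjb⟩))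
      have hq2 : q < L.length := by simpa [hL] using hq
      have : p q = c j := by rw [hp]; simp only [hq2, dite_true]; simp [hL, hq']
      rw [← this]
      exact hmr q (by omega)
    · have : p (L.length + (j - b).toNat) = c j := by
        simp only [hp, add_lt_iff_neg_left, not_lt_zero, dite_false, add_tsub_cancel_left]
        congr 1
        omega
      rw [← this]
      exact hmr _ (by omega))
  omega

theorem not_extendable {u : V} (hu : u ∉ range c) (i : ℤ) (h1 : G.Adj u (c i))
    (h2 : G.Adj u (c (i + 1))) : False := by
  have hn := h.eight
  have h' := h.shift i
  refine h'.reroute (k := 1) (e := ![u]) (a := 0) (b := 1) (Function.injective_of_subsingleton _)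
    ?_ [Sum.inr 0] (by omega) (by decide) ?_
  · rw [range_shift]
    simpa using hu
  · simp [h1.symm, add_comm, h2]

end CycleConfig

end Config

section Segments

open Set Topology Filter

variable {V : Type*} {G : SimpleGraph V}

/-- The vertex `w` on the side `σ` of the cycle is adjacent to the ends of the segment from `a` to
`b`, and no vertex on this side is adjacent to an inner vertex of the segment. -/
structure MinorSegment (G : SimpleGraph V) (c : ℤ → V) (n : ℕ) (side : Bool → V → Prop) (σ : Bool)
    (w : V) (a b : ℤ) : Prop where
  mem_side : side σ w
  left : G.Adj w (c a)
  right : G.Adj w (c b)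
  lt : a < b
  lt_add : b < a + n
  inner : ∀ j u, a < j → j < b → side σ u → ¬ G.Adj u (c j)

namespace MinorSegment

variable {c : ℤ → V} {n : ℕ} {side : Bool → V → Prop} {σ : Bool} {w : V} {a b : ℤ}

theorem shift (h : MinorSegment G c n side σ w a b) (s : ℤ) {a' b' : ℤ} (ha : a' + s = a)
    (hb : b' + s = b) : MinorSegment G (fun i => c (i + s)) n side σ w a' b' where
  mem_side := h.mem_side
  left := by simpa only [ha] using h.left
  right := by simpa only [hb] using h.right
  lt := by have := h.lt; omega
  lt_add := by have := h.lt_add; omega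
  inner := fun j u h1 h2 hu => h.inner (j + s) u (by omega) (by omega) hu

theorem reflect (h : MinorSegment G c n side σ w a b) (s : ℤ) {a' b' : ℤ} (ha : s - a' = b)
    (hb : s - b' = a) : MinorSegment G (fun i => c (s - i)) n side σ w a' b' where
  mem_side := h.mem_side
  left := by simpa only [ha] using h.right
  right := by simpa only [hb] using h.left
  lt := by have := h.lt; omega
  lt_add := by have := h.lt_add; omega
  inner := fun j u h1 h2 hu => h.inner (s - j) u (by omega) (by omega) hu

end MinorSegment

namespace CycleConfig

variable {c : ℤ → V} {n : ℕ} {side : Bool → V → Prop} {K : Bool → V → V → Prop}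
  (h : CycleConfig G c n side K)
include h

theorem reflect (s : ℤ) : CycleConfig G (fun i => c (s - i)) n side K := by
  have := h.neg.shift (-s)
  have e : (fun i => c (s - i)) = fun i => c (-(i + -s)) := by
    ext i
    ring_nf
  rwa [e]

theorem next (i j : ℤ) (hij : j = i + 1 ∨ i = j + 1) : G.Adj (c i) (c j) := by
  rcases hij with rfl | rfl
  exacts [h.seq.adj _, (h.seq.adj _).symm]

theorem reroute₁ {u : V} (hu : u ∉ range c) {a b : ℤ} (ts : List (ℤ ⊕ Fin 1)) (hb : b ≤ a + n)
    (hts : (Sum.inl a :: ts).Nodup ∧ (∀ i ∈ Finset.Ico a b, ∃ t ∈ Sum.inl a :: ts, t = Sum.inl i) ∧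
      (Sum.inl a :: ts).all (Sum.elim (fun i => decide (a ≤ i ∧ i < b)) fun _ => true) = true ∧
      b - a ≤ ts.length)
    (hch : ((Sum.inl a :: ts).map (Sum.elim c ![u]) ++ [c b]).IsChain G.Adj) : False :=
  h.reroute (Function.injective_of_subsingleton _) (by simpa using hu) ts hb hts hch

theorem reroute₂ {u w : V} (hu : u ∉ range c) (hw : w ∉ range c) (huw : u ≠ w) {a b : ℤ}
    (ts : List (ℤ ⊕ Fin 2)) (hb : b ≤ a + n)
    (hts : (Sum.inl a :: ts).Nodup ∧ (∀ i ∈ Finset.Ico a b, ∃ t ∈ Sum.inl a :: ts, t = Sum.inl i) ∧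
      (Sum.inl a :: ts).all (Sum.elim (fun i => decide (a ≤ i ∧ i < b)) fun _ => true) = true ∧
      b - a ≤ ts.length)
    (hch : ((Sum.inl a :: ts).map (Sum.elim c ![u, w]) ++ [c b]).IsChain G.Adj) : False :=
  h.reroute (by
    intro i j hij
    fin_cases i <;> fin_cases j <;> simp_all) (by rw [Fin.forall_fin_two]; exact ⟨hu, hw⟩)
    ts hb hts hch

theorem reroute₃ {u w z : V} (hu : u ∉ range c) (hw : w ∉ range c) (hz : z ∉ range c)
    (huw : u ≠ w) (huz : u ≠ z) (hwz : w ≠ z) {a b : ℤ}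
    (ts : List (ℤ ⊕ Fin 3)) (hb : b ≤ a + n)
    (hts : (Sum.inl a :: ts).Nodup ∧ (∀ i ∈ Finset.Ico a b, ∃ t ∈ Sum.inl a :: ts, t = Sum.inl i) ∧
      (Sum.inl a :: ts).all (Sum.elim (fun i => decide (a ≤ i ∧ i < b)) fun _ => true) = true ∧
      b - a ≤ ts.length)
    (hch : ((Sum.inl a :: ts).map (Sum.elim c ![u, w, z]) ++ [c b]).IsChain G.Adj) : False := by
  refine h.reroute ?_ ?_ ts hb hts hch
  · intro i j hij
    fin_cases i <;> fin_cases j <;> simp_all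
  · intro i
    fin_cases i <;> assumption

theorem ne_of_side {σ τ : Bool} {u w : V} (hστ : σ ≠ τ) (hu : side σ u) (hw : side τ w) : u ≠ w := by
  rintro rfl
  exact hστ (h.side_unique _ _ _ hu hw)

/-- A vertex off the cycle does not have four neighbours. -/
theorem not_four {u : V} (hu : u ∉ range c) {i j k l : ℤ} (h1 : G.Adj u (c i)) (h2 : G.Adj u (c j))
    (h3 : G.Adj u (c k)) (h4 : G.Adj u (c l)) (hij : i < j) (hjk : j < k) (hkl : k < l)
    (hl : l < i + n) : False := by
  obtain ⟨x, y, z, hxyz⟩ := h.deg_le u hu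
  have e1 := h.ne (i := i) (j := j) (by omega) (by omega)
  have e2 := h.ne (i := i) (j := k) (by omega) (by omega)
  have e3 := h.ne (i := i) (j := l) (by omega) (by omega)
  have e4 := h.ne (i := j) (j := k) (by omega) (by omega)
  have e5 := h.ne (i := j) (j := l) (by omega) (by omega)
  have e6 := h.ne (i := k) (j := l) (by omega) (by omega)
  rcases hxyz _ h1 with h1 | h1 | h1 <;> rcases hxyz _ h2 with h2 | h2 | h2 <;>
    rcases hxyz _ h3 with h3 | h3 | h3 <;> rcases hxyz _ h4 with h4 | h4 | h4 <;> simp_all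

/-- A chord at an inner vertex of a minor segment on the same side stays in the segment. -/
theorem chord_confined {σ : Bool} {v : V} {a b : ℤ} (hv : MinorSegment G c n side σ v a b) {j : ℤ}
    (h1 : a < j) (h2 : j < b) {x : V} (hx : x ∈ range c) (hadj : G.Adj (c j) x)
    (hK : K σ (c j) x) : ∃ l, a ≤ l ∧ l ≤ b ∧ x = c l := by
  obtain ⟨l, hl, hl', rfl⟩ := h.seq.exists_mem_Ico a hx
  refine ⟨l, hl, ?_, rfl⟩
  by_contra hlb
  exact h.not_cross_spokes σ v a b j l hv.mem_side hv.left hv.right hadj hK h1 h2 (by omega) hl'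

/-- A neighbour of an inner vertex of two minor segments on different sides. -/
theorem neighbor_confined {σ τ : Bool} (hστ : σ ≠ τ) {v u : V} {a b a' b' j : ℤ}
    (hv : MinorSegment G c n side σ v a b) (hu : MinorSegment G c n side τ u a' b') (h1 : a < j)
    (h2 : j < b) (h1' : a' < j) (h2' : j < b') {x : V} (hx : G.Adj (c j) x) (hx1 : x ≠ c (j - 1))
    (hx2 : x ≠ c (j + 1)) :
    (∃ l, a ≤ l ∧ l ≤ b ∧ x = c l ∧ K σ (c j) x) ∨ ∃ l, a' ≤ l ∧ l ≤ b' ∧ x = c l ∧ K τ (c j) x := by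
  have hB : ∀ ρ, ρ = σ ∨ ρ = τ := by
    intro ρ
    cases ρ <;> cases σ <;> cases τ <;> simp_all
  have hxr : x ∈ range c := by
    by_contra hxr
    obtain ⟨ρ, hρ⟩ := h.side_exists x hxr
    rcases hB ρ with rfl | rfl
    · exact hv.inner j x h1 h2 hρ hx.symm
    · exact hu.inner j x h1' h2' hρ hx.symm
  obtain ⟨l, rfl⟩ := hxr
  obtain ⟨ρ, hρ⟩ := h.K_exists j l hx (by
    rw [h.seq.mem_cycEdges]
    rintro (hd | hd)
    · exact hx2 ((h.seq.eq_iff _ _).2 (by rwa [← sub_sub]))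
    · exact hx1 ((h.seq.eq_iff _ _).2 (by rwa [show l - (j - 1) = l - j + 1 by ring])))
  rcases hB ρ with rfl | rfl
  · obtain ⟨l', h3, h4, h5⟩ := h.chord_confined hv h1 h2 ⟨l, rfl⟩ hx hρ
    exact Or.inl ⟨l', h3, h4, h5, hρ⟩
  · obtain ⟨l', h3, h4, h5⟩ := h.chord_confined hu h1' h2' ⟨l, rfl⟩ hx hρ
    exact Or.inr ⟨l', h3, h4, h5, hρ⟩

/-- An inner vertex of two minor segments on different sides has a chord in one of them. -/
theorem exists_chord {σ τ : Bool} (hστ : σ ≠ τ) {v u : V} {a b a' b' : ℤ}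
    (hv : MinorSegment G c n side σ v a b) (hu : MinorSegment G c n side τ u a' b') (j : ℤ)
    (h1 : a < j) (h2 : j < b) (h1' : a' < j) (h2' : j < b') :
    ∃ l, G.Adj (c j) (c l) ∧ l ≠ j - 1 ∧ l ≠ j ∧ l ≠ j + 1 ∧
      ((a ≤ l ∧ l ≤ b ∧ K σ (c j) (c l)) ∨ (a' ≤ l ∧ l ≤ b' ∧ K τ (c j) (c l))) := by
  have hn := h.eight
  have hne : c (j - 1) ≠ c j ∧ c j ≠ c (j + 1) ∧ c j ≠ c (j + 2) ∧ c (j - 1) ≠ c (j + 2) ∧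
      c (j + 1) ≠ c (j + 2) :=
    ⟨h.ne (by omega) (by omega), h.ne (by omega) (by omega), h.ne (by omega) (by omega),
      h.ne (by omega) (by omega), h.ne (by omega) (by omega)⟩
  obtain ⟨_, rfl, x, -, hx1, hx2, hadj⟩ := h.connected {c j} (c (j - 1)) (c (j + 1))
    (singleton_nonempty _) hne.1 hne.2.1.symm
    ⟨c (j + 2), hne.2.2.1.symm, hne.2.2.2.1.symm, hne.2.2.2.2.symm⟩
  have key : ∀ l, x = c l → l ≠ j - 1 ∧ l ≠ j ∧ l ≠ j + 1 := by
    rintro l rfl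
    refine ⟨?_, ?_, ?_⟩ <;> rintro rfl
    · exact hx1 rfl
    · exact hadj.ne rfl
    · exact hx2 rfl
  rcases h.neighbor_confined hστ hv hu h1 h2 h1' h2' hadj hx1 hx2 with
    ⟨l, h3, h4, rfl, h5⟩ | ⟨l, h3, h4, rfl, h5⟩ <;> obtain ⟨k1, k2, k3⟩ := key l rfl
  exacts [⟨l, hadj, k1, k2, k3, Or.inl ⟨h3, h4, h5⟩⟩, ⟨l, hadj, k1, k2, k3, Or.inr ⟨h3, h4, h5⟩⟩]

theorem two_le {σ : Bool} {v : V} {a b : ℤ} (hv : MinorSegment G c n side σ v a b) : a + 2 ≤ b := by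
  by_contra hh
  have := hv.lt
  obtain rfl : b = a + 1 := by omega
  exact h.not_extendable (h.off _ _ hv.mem_side) a hv.left hv.right

end CycleConfig

end Segments

section Exclusions

open Set Topology Filter

variable {V : Type*} {G : SimpleGraph V}

namespace CycleConfig

variable {c : ℤ → V} {n : ℕ} {side : Bool → V → Prop} {K : Bool → V → V → Prop}
  (h : CycleConfig G c n side K) {σ τ : Bool} (hστ : σ ≠ τ) {v : V}
include h hστ

theorem false_of_one_three (hv : MinorSegment G c n side σ v 0 4) {u : V}
    (hu : MinorSegment G c n side τ u 1 3) : False := by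
  have hn := h.eight
  obtain ⟨l, hl, h1, h2, h3, h4⟩ := h.exists_chord hστ hv hu 2
    (by decide) (by decide) (by decide) (by decide)
  obtain rfl | rfl : l = 0 ∨ l = 4 := by omega
  · refine h.reroute₁ (h.off _ _ hu.mem_side) (a := 0) (b := 3) [.inl 2, .inl 1, .inr 0] (by omega)
      (by decide) ?_
    simp [hl.symm, h.next, hu.left.symm, hu.right]
  · refine h.reroute₁ (h.off _ _ hu.mem_side) (a := 1) (b := 4) [.inr 0, .inl 3, .inl 2] (by omega)
      (by decide) ?_
    simp [hl, h.next, hu.left.symm, hu.right]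

theorem false_of_one_four (hv : MinorSegment G c n side σ v 0 4) {u : V}
    (hu : MinorSegment G c n side τ u 1 4) : False := by
  have hn := h.eight
  have e : ∀ i j : ℤ, i < j → j < i + 8 → c i ≠ c j := fun i j h1 h2 => h.ne h1 (by omega)
  obtain ⟨x, hx, y, hy, hy1, hy4, hxy⟩ := h.connected {c 2, c 3} (c 1) (c 4) ⟨c 2, by simp⟩
    (by simp [e 1 2, e 1 3]) (by simp [(e 2 4 (by decide) (by decide)).symm,
      (e 3 4 (by decide) (by decide)).symm])
    ⟨c 5, by simp [(e 2 5 (by decide) (by decide)).symm, (e 3 5 (by decide) (by decide)).symm],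
      (e 1 5 (by decide) (by decide)).symm, (e 4 5 (by decide) (by decide)).symm⟩
  simp only [mem_insert_iff, mem_singleton_iff, not_or] at hx hy
  have key : ∀ j, (j = 2 ∨ j = 3) → x = c j → ∃ l : ℤ, 0 ≤ l ∧ l ≤ 4 ∧ y = c l := by
    rintro j hj rfl
    have hyj : y ≠ c (j - 1) ∧ y ≠ c (j + 1) := by
      rcases hj with rfl | rfl
      exacts [⟨hy1, hy.2⟩, ⟨hy.1, hy4⟩]
    rcases h.neighbor_confined hστ hv hu (j := j) (by omega) (by omega) (by omega) (by omega) hxy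
      hyj.1 hyj.2 with ⟨l, h1, h2, h3, -⟩ | ⟨l, h1, h2, h3, -⟩
    exacts [⟨l, h1, h2, h3⟩, ⟨l, by omega, h2, h3⟩]
  have h0 : y = c 0 := by
    obtain ⟨l, h1, h2, rfl⟩ : ∃ l : ℤ, 0 ≤ l ∧ l ≤ 4 ∧ y = c l := by
      rcases hx with hx | hx
      exacts [key _ (Or.inl rfl) hx, key _ (Or.inr rfl) hx]
    interval_cases l
    · rfl
    · exact absurd rfl hy1
    · exact absurd rfl hy.1
    · exact absurd rfl hy.2
    · exact absurd rfl hy4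
  subst h0
  have h03 : ¬ G.Adj (c 0) (c 3) := by
    intro h03
    refine h.reroute₁ (h.off _ _ hu.mem_side) (a := 0) (b := 4) [.inl 3, .inl 2, .inl 1, .inr 0]
      (by omega) (by decide) ?_
    simp [h03, h.next, hu.left.symm, hu.right]
  rcases hx with rfl | rfl
  · obtain ⟨l, hl, h1, h2, h3, h4⟩ := h.exists_chord hστ hv hu 3
      (by decide) (by decide) (by decide) (by decide)
    obtain rfl | rfl : l = 0 ∨ l = 1 := by omega
    · exact h03 hl.symm
    · refine h.reroute₁ (h.off _ _ hu.mem_side) (a := 0) (b := 4) [.inl 2, .inl 3, .inl 1, .inr 0]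
        (by omega) (by decide) ?_
      simp [hxy.symm, hl, h.next, hu.left.symm, hu.right]
  · exact h03 hxy.symm

/-- The chord at the middle of a minor segment with two edges. -/
theorem chord_of_zero_two (hv : MinorSegment G c n side σ v 0 4) {u : V}
    (hu : MinorSegment G c n side τ u 0 2) :
    G.Adj (c 1) (c 4) ∧ K σ (c 1) (c 4) ∧ ¬ G.Adj (c 1) (c 3) := by
  have hn := h.eight
  have h13 : ¬ G.Adj (c 1) (c 3) := by
    intro h13
    refine h.reroute₁ (h.off _ _ hu.mem_side) (a := 0) (b := 3) [.inr 0, .inl 2, .inl 1] (by omega)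
      (by decide) ?_
    simp [h13, h.next, hu.left.symm, hu.right]
  obtain ⟨l, hl, h1, h2, h3, h4⟩ := h.exists_chord hστ hv hu 1
    (by decide) (by decide) (by decide) (by decide)
  obtain rfl | rfl : l = 3 ∨ l = 4 := by omega
  · exact absurd hl h13
  · refine ⟨hl, ?_, h13⟩
    rcases h4 with h4 | h4
    exacts [h4.2.2, by omega]

theorem false_of_two_two (hv : MinorSegment G c n side σ v 0 4) {u w : V}
    (hu : MinorSegment G c n side τ u 0 2) (hw : MinorSegment G c n side τ w 2 4) : False := by
  have hn := h.eight
  obtain ⟨h14, hK, -⟩ := h.chord_of_zero_two hστ hv hu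
  obtain ⟨h30, hK', -⟩ := (h.reflect 4).chord_of_zero_two hστ (hv.reflect 4 rfl rfl)
    (hw.reflect 4 rfl rfl)
  simp only [Int.reduceSub] at h30 hK'
  exact h.not_cross_chords σ 0 3 1 4 h30.symm (h.K_symm _ _ _ hK') h14 hK (by decide) (by decide)
    (by decide) (by omega)

/-- The chords at the other inner vertex of the segment opposite to a minor segment with two
edges. -/
theorem chord_of_zero_two_right (hv : MinorSegment G c n side σ v 0 4) {u w : V} {b : ℤ}
    (hu : MinorSegment G c n side τ u 0 2) (hw : MinorSegment G c n side τ w 2 b) (hb : 4 < b) :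
    ∃ l, 6 ≤ l ∧ l ≤ b ∧ G.Adj (c 3) (c l) ∧ K τ (c 3) (c l) := by
  have hn := h.eight
  obtain ⟨h14, hK, h13⟩ := h.chord_of_zero_two hστ hv hu
  obtain ⟨l, hl, h1, h2, h3, h4⟩ := h.exists_chord hστ hv hw 3
    (by decide) (by decide) (by decide) (by omega)
  rcases h4 with ⟨h4, h5, h6⟩ | ⟨h4, h5, h6⟩
  · obtain rfl | rfl : l = 0 ∨ l = 1 := by omega
    · exact (h.not_cross_chords σ 0 3 1 4 hl.symm (h.K_symm _ _ _ h6) h14 hK (by decide) (by decide)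
        (by decide) (by omega)).elim
    · exact absurd hl.symm h13
  · by_cases hl5 : l = 5
    · subst hl5
      exfalso
      refine h.reroute₁ (h.off _ _ hu.mem_side) (a := 0) (b := 5)
        [.inr 0, .inl 2, .inl 1, .inl 4, .inl 3] (by omega) (by decide) ?_
      simp [hl, h14, h.next, hu.left.symm, hu.right]
    · exact ⟨l, by omega, h5, hl, h6⟩

theorem false_of_two_three (hv : MinorSegment G c n side σ v 0 4) {u w : V}
    (hu : MinorSegment G c n side τ u 0 2) (hw : MinorSegment G c n side τ w 2 5) : False := by
  obtain ⟨l, h1, h2, -⟩ := h.chord_of_zero_two_right hστ hv hu hw (by decide)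
  omega

theorem false_of_zero_two_of_three_five (hv : MinorSegment G c n side σ v 0 4) {u w : V}
    (hu : MinorSegment G c n side τ u 0 2) (hw : MinorSegment G c n side τ w 3 5) : False := by
  have hn := h.eight
  obtain ⟨h14, -, -⟩ := h.chord_of_zero_two hστ hv hu
  have huw : u ≠ w := by
    rintro rfl
    exact h.not_four (h.off _ _ hu.mem_side) hu.left hu.right hw.left hw.right (by decide)
      (by decide) (by decide) (by omega)
  refine h.reroute₂ (h.off _ _ hu.mem_side) (h.off _ _ hw.mem_side) huw (a := 0) (b := 5)
    [.inr 0, .inl 2, .inl 1, .inl 4, .inl 3, .inr 1] (by omega) (by decide) ?_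
  simp [h14, h.next, hu.left.symm, hu.right, hw.left.symm, hw.right]

theorem false_of_three_three (hv : MinorSegment G c n side σ v 0 4) {u w : V}
    (hu : MinorSegment G c n side τ u (-1) 2) (hw : MinorSegment G c n side τ w 2 5) : False := by
  have hn := h.eight
  have hvw := h.ne_of_side hστ hv.mem_side hw.mem_side
  obtain ⟨l, hl, h1, h2, h3, h4⟩ := h.exists_chord hστ hv hu 1
    (by decide) (by decide) (by decide) (by decide)
  obtain rfl | rfl | rfl : l = 3 ∨ l = 4 ∨ l = -1 := by omega
  · refine h.reroute₂ (h.off _ _ hv.mem_side) (h.off _ _ hw.mem_side) hvw (a := -1) (b := 5)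
      [.inl 0, .inr 0, .inl 4, .inl 3, .inl 1, .inl 2, .inr 1] (by omega) (by decide) ?_
    simp [hl.symm, h.next, hv.left.symm, hv.right, hw.left.symm, hw.right]
  · refine h.reroute₂ (h.off _ _ hv.mem_side) (h.off _ _ hw.mem_side) hvw (a := -1) (b := 5)
      [.inl 0, .inl 1, .inl 4, .inl 3, .inl 2, .inr 1] (by omega) (by decide) ?_
    simp [hl, h.next, hw.left.symm, hw.right]
  · refine h.reroute₂ (h.off _ _ hv.mem_side) (h.off _ _ hw.mem_side) hvw (a := -1) (b := 5)
      [.inl 1, .inl 0, .inr 0, .inl 4, .inl 3, .inl 2, .inr 1] (by omega) (by decide) ?_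
    simp [hl.symm, h.next, hv.left.symm, hv.right, hw.left.symm, hw.right]

theorem false_of_two_four (hv : MinorSegment G c n side σ v 0 4) {u w z : V} {b : ℤ}
    (hu : MinorSegment G c n side τ u 0 2) (hw : MinorSegment G c n side τ w 2 6)
    (hz : MinorSegment G c n side σ z 4 b) (hb : b = 6 ∨ b = 7) : False := by
  have hn := h.eight
  obtain ⟨h14, -, -⟩ := h.chord_of_zero_two hστ hv hu
  obtain ⟨l, h1, h2, hl, hK⟩ := h.chord_of_zero_two_right hστ hv hu hw (by decide)
  obtain rfl : l = 6 := by omega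
  obtain ⟨l', hl', h1', h2', h3', h4'⟩ := h.exists_chord hστ.symm hw hz 5
    (by decide) (by decide) (by decide) (by omega)
  by_cases h7 : l' = 7
  · subst h7
    refine h.reroute₁ (h.off _ _ hu.mem_side) (a := 0) (b := 7)
      [.inr 0, .inl 2, .inl 1, .inl 4, .inl 3, .inl 6, .inl 5] (by omega) (by decide) ?_
    simp [hl, hl', h14, h.next, hu.left.symm, hu.right]
  rcases h4' with ⟨h4, h5, h6⟩ | ⟨h4, h5, h6⟩
  · obtain rfl | rfl : l' = 2 ∨ l' = 3 := by omega
    · exact h.not_cross_chords τ 2 5 3 6 hl'.symm (h.K_symm _ _ _ h6) hl hK (by decide) (by decide)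
        (by decide) (by omega)
    · refine h.reroute₁ (h.off _ _ hu.mem_side) (a := 0) (b := 5)
        [.inr 0, .inl 2, .inl 1, .inl 4, .inl 3] (by omega) (by decide) ?_
      simp [hl'.symm, h14, h.next, hu.left.symm, hu.right]
  · omega

theorem false_of_two_five (hv : MinorSegment G c n side σ v 0 4) {u w z₁ z₂ : V}
    (hu : MinorSegment G c n side τ u 0 2) (hw : MinorSegment G c n side τ w 2 7)
    (hz₁ : MinorSegment G c n side σ z₁ 4 6) (hz₂ : MinorSegment G c n side σ z₂ 6 8) : False := by
  have hn := h.eight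
  have huz := h.ne_of_side hστ.symm hu.mem_side hz₂.mem_side
  obtain ⟨h14, -, -⟩ := h.chord_of_zero_two hστ hv hu
  obtain ⟨l, h1, h2, hl, hK⟩ := h.chord_of_zero_two_right hστ hv hu hw (by decide)
  obtain ⟨l', hl', h1', h2', h3', h4'⟩ := h.exists_chord hστ.symm hw hz₁ 5
    (by decide) (by decide) (by decide) (by decide)
  obtain ⟨h6, h4, h5⟩ : K τ (c 5) (c l') ∧ 2 ≤ l' ∧ l' ≤ 7 := by
    rcases h4' with ⟨h4, h5, h6⟩ | ⟨h4, h5, h6⟩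
    exacts [⟨h6, h4, h5⟩, by omega]
  obtain rfl | rfl | rfl : l' = 2 ∨ l' = 3 ∨ l' = 7 := by omega
  · exact h.not_cross_chords τ 2 5 3 l hl'.symm (h.K_symm _ _ _ h6) hl hK (by decide) (by decide)
      (by omega) (by omega)
  · refine h.reroute₁ (h.off _ _ hu.mem_side) (a := 0) (b := 5)
      [.inr 0, .inl 2, .inl 1, .inl 4, .inl 3] (by omega) (by decide) ?_
    simp [hl'.symm, h14, h.next, hu.left.symm, hu.right]
  obtain rfl | rfl : l = 6 ∨ l = 7 := by omega
  · refine h.reroute₁ (h.off _ _ hu.mem_side) (a := 0) (b := 7)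
      [.inr 0, .inl 2, .inl 1, .inl 4, .inl 3, .inl 6, .inl 5] (by omega) (by decide) ?_
    simp [hl, hl', h14, h.next, hu.left.symm, hu.right]
  · refine h.reroute₂ (h.off _ _ hu.mem_side) (h.off _ _ hz₂.mem_side) huz (a := 0) (b := 8)
      [.inr 0, .inl 2, .inl 1, .inl 4, .inl 3, .inl 7, .inl 5, .inl 6, .inr 1] (by omega)
      (by decide) ?_
    simp [hl, hl'.symm, h14, h.next, hu.left.symm, hu.right, hz₂.left.symm, hz₂.right]

end CycleConfig

end Exclusions

section FourExclusions

open Set Topology Filter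

variable {V : Type*} {G : SimpleGraph V}

namespace CycleConfig

variable {c : ℤ → V} {n : ℕ} {side : Bool → V → Prop} {K : Bool → V → V → Prop}
  (h : CycleConfig G c n side K) {σ τ : Bool} (hστ : σ ≠ τ) {v : V}
include h hστ

theorem not_adj_of_three_four (hv : MinorSegment G c n side σ v 0 4) {w z : V}
    (hw : MinorSegment G c n side τ w 2 6) (hz : MinorSegment G c n side σ z 4 7) :
    ¬ G.Adj (c 1) (c 3) := by
  intro h13
  have hn := h.eight
  have hvw := h.ne_of_side hστ hv.mem_side hw.mem_side
  obtain ⟨l, hl, h1, h2, h3, h4⟩ := h.exists_chord hστ.symm hw hz 5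
    (by decide) (by decide) (by decide) (by decide)
  obtain rfl | rfl | rfl : l = 7 ∨ l = 2 ∨ l = 3 := by omega
  · refine h.reroute₂ (h.off _ _ hv.mem_side) (h.off _ _ hw.mem_side) hvw (a := -1) (b := 7)
      [.inl 0, .inr 0, .inl 4, .inl 3, .inl 1, .inl 2, .inr 1, .inl 6, .inl 5] (by omega)
      (by decide) ?_
    simp [hl, h13.symm, h.next, hv.left.symm, hv.right, hw.left.symm, hw.right]
  · refine h.reroute₁ (h.off _ _ hv.mem_side) (a := -1) (b := 6)
      [.inl 0, .inr 0, .inl 4, .inl 3, .inl 1, .inl 2, .inl 5] (by omega) (by decide) ?_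
    simp [hl.symm, h13.symm, h.next, hv.left.symm, hv.right]
  · refine h.reroute₂ (h.off _ _ hv.mem_side) (h.off _ _ hw.mem_side) hvw (a := -1) (b := 6)
      [.inl 0, .inr 0, .inl 4, .inl 5, .inl 3, .inl 1, .inl 2, .inr 1] (by omega) (by decide) ?_
    simp [hl, h13.symm, h.next, hv.left.symm, hv.right, hw.left.symm, hw.right]

theorem not_adj_of_three_four' (hv : MinorSegment G c n side σ v 0 4) {u w : V}
    (hu : MinorSegment G c n side τ u (-1) 2) (hw : MinorSegment G c n side τ w 2 6) :
    ¬ G.Adj (c 5) (c 3) :=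
  (h.reflect 6).not_adj_of_three_four hστ.symm (hw.reflect 6 rfl rfl) (hv.reflect 6 rfl rfl)
    (hu.reflect 6 rfl rfl)

theorem not_adj_end_of_three_four (hv : MinorSegment G c n side σ v 0 4) {u w z : V}
    (hu : MinorSegment G c n side τ u (-1) 2) (hw : MinorSegment G c n side τ w 2 6)
    (hz : MinorSegment G c n side σ z 4 7) (hK : K σ (c 1) (c 4)) : ¬ G.Adj (c 1) (c 4) := by
  intro h14
  have hn := h.eight
  have h13 := h.not_adj_of_three_four hστ hv hw hz
  have h53 := h.not_adj_of_three_four' hστ hv hu hw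
  obtain ⟨l, hl, h1, h2, h3, h4⟩ := h.exists_chord hστ hv hw 3
    (by decide) (by decide) (by decide) (by decide)
  obtain rfl | rfl | rfl | rfl : l = 0 ∨ l = 1 ∨ l = 5 ∨ l = 6 := by omega
  · have hK' : K σ (c 3) (c 0) := by
      rcases h4 with h4 | h4
      exacts [h4.2.2, by omega]
    exact h.not_cross_chords σ 0 3 1 4 hl.symm (h.K_symm _ _ _ hK') h14 hK (by decide) (by decide)
      (by decide) (by omega)
  · exact h13 hl.symm
  · exact h53 hl.symm
  have hK' : K τ (c 3) (c 6) := by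
    rcases h4 with h4 | h4
    exacts [by omega, h4.2.2]
  obtain ⟨l, hl', h1, h2, h3, h4⟩ := h.exists_chord hστ.symm hw hz 5
    (by decide) (by decide) (by decide) (by decide)
  obtain rfl | rfl | rfl : l = 7 ∨ l = 2 ∨ l = 3 := by omega
  · refine h.reroute₁ (h.off _ _ hw.mem_side) (a := -1) (b := 7)
      [.inl 0, .inl 1, .inl 4, .inl 3, .inl 2, .inr 0, .inl 6, .inl 5] (by omega)
      (by decide) ?_
    simp [hl', h14, h.next, hw.left.symm, hw.right]
  · have hK'' : K τ (c 5) (c 2) := by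
      rcases h4 with h4 | h4
      exacts [h4.2.2, by omega]
    exact h.not_cross_chords τ 2 5 3 6 hl'.symm (h.K_symm _ _ _ hK'') hl hK' (by decide) (by decide)
      (by decide) (by omega)
  · exact h53 hl'

theorem false_of_three_four (hv : MinorSegment G c n side σ v 0 4) {u w z : V}
    (hu : MinorSegment G c n side τ u (-1) 2) (hw : MinorSegment G c n side τ w 2 6)
    (hz : MinorSegment G c n side σ z 4 7) : False := by
  have hn := h.eight
  have hvw := h.ne_of_side hστ hv.mem_side hw.mem_side
  obtain ⟨l, hl, h1, h2, h3, h4⟩ := h.exists_chord hστ hv hu 1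
    (by decide) (by decide) (by decide) (by decide)
  obtain ⟨l', hl', h1', h2', h3', h4'⟩ := h.exists_chord hστ.symm hw hz 5
    (by decide) (by decide) (by decide) (by decide)
  obtain rfl | rfl | rfl : l = -1 ∨ l = 3 ∨ l = 4 := by omega
  · obtain rfl | rfl | rfl : l' = 7 ∨ l' = 2 ∨ l' = 3 := by omega
    · refine h.reroute₂ (h.off _ _ hv.mem_side) (h.off _ _ hw.mem_side) hvw (a := -1) (b := 7)
        [.inl 1, .inl 0, .inr 0, .inl 4, .inl 3, .inl 2, .inr 1, .inl 6, .inl 5] (by omega)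
        (by decide) ?_
      simp [hl.symm, hl', h.next, hv.left.symm, hv.right, hw.left.symm, hw.right]
    · have hK : K τ (c 5) (c 2) := by
        rcases h4' with h4 | h4
        exacts [h4.2.2, by omega]
      exact (h.reflect 6).not_adj_end_of_three_four hστ.symm (hw.reflect 6 rfl rfl)
        (hz.reflect 6 rfl rfl) (hv.reflect 6 rfl rfl) (hu.reflect 6 rfl rfl) hK hl'
    · exact h.not_adj_of_three_four' hστ hv hu hw hl'
  · exact h.not_adj_of_three_four hστ hv hw hz hl
  · have hK : K σ (c 1) (c 4) := by
      rcases h4 with h4 | h4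
      exacts [h4.2.2, by omega]
    exact h.not_adj_end_of_three_four hστ hv hu hw hz hK hl

/-- The chords at the inner vertices `c 3` and `c 5`, when the segment on the side `τ` starting
at `2` has four or five edges and is followed by short segments on the other side. -/
theorem chords_of_four_or_five {y u w : V} {a b : ℤ} (ha : a = -2 ∨ a = -3)
    (hy : MinorSegment G c n side σ y a 0) (hu : MinorSegment G c n side τ u (-2) 2)
    (hw : MinorSegment G c n side τ w 2 b)
    (hz : (b = 6 ∧ ∃ z, MinorSegment G c n side σ z 4 6 ∨ MinorSegment G c n side σ z 4 7) ∨
      (b = 7 ∧ ∃ z₁ z₂, MinorSegment G c n side σ z₁ 4 6 ∧ MinorSegment G c n side σ z₂ 6 8))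
    {l : ℤ} (h6 : 6 ≤ l) (hlb : l ≤ b) (hl : G.Adj (c 3) (c l)) (hK : K τ (c 3) (c l))
    (h35 : ¬ G.Adj (c 3) (c 5)) :
    G.Adj (c 5) (c 7) ∧ ((G.Adj (c 3) (c 6) ∧ 7 ≤ a + n) ∨
      (G.Adj (c 3) (c 7) ∧ 8 ≤ a + n ∧ ∃ z₂, MinorSegment G c n side σ z₂ 6 8)) := by
  have hn := h.eight
  have hadj : ∀ (i k : ℤ) (z : V), side σ z → G.Adj z (c i) →
      ¬ (a < k ∧ k < 0 ∧ i = k + n) := by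
    rintro i k z hz hzi ⟨h1, h2, rfl⟩
    exact hy.inner k z h1 h2 hz (by rwa [h.add_period] at hzi)
  have h2' : ∀ l', G.Adj (c 5) (c l') → K τ (c 5) (c l') → l' ≠ 2 := by
    rintro l' h1 h2 rfl
    exact h.not_cross_chords τ 2 5 3 l h1.symm (h.K_symm _ _ _ h2) hl hK (by decide) (by decide)
      (by omega) (by omega)
  rcases hz with ⟨rfl, z, hz⟩ | ⟨rfl, z₁, z₂, hz₁, hz₂⟩
  · obtain ⟨b', hb', hz⟩ : ∃ b', (b' = 6 ∨ b' = 7) ∧ MinorSegment G c n side σ z 4 b' := by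
      rcases hz with hz | hz
      exacts [⟨6, Or.inl rfl, hz⟩, ⟨7, Or.inr rfl, hz⟩]
    obtain ⟨l', hl', k1, k2, k3, k4⟩ := h.exists_chord hστ.symm hw hz 5
      (by decide) (by decide) (by decide) (by omega)
    have h3' : l' ≠ 3 := by
      rintro rfl
      exact h35 hl'.symm
    have := h2' l' hl'
    obtain rfl : l' = 7 := by
      rcases k4 with ⟨k4, k5, k6⟩ | k4
      · have := this k6
        omega
      · omega
    obtain rfl : b' = 7 := by omega
    obtain rfl : l = 6 := by omega
    have e1 := hadj 7 (-1) z hz.mem_side hz.right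
    have e2 := hadj 7 (-2) z hz.mem_side hz.right
    exact ⟨hl', Or.inl ⟨hl, by omega⟩⟩
  · obtain ⟨l', hl', k1, k2, k3, k4⟩ := h.exists_chord hστ.symm hw hz₁ 5
      (by decide) (by decide) (by decide) (by decide)
    have h3' : l' ≠ 3 := by
      rintro rfl
      exact h35 hl'.symm
    have := h2' l' hl'
    obtain rfl : l' = 7 := by
      rcases k4 with ⟨k4, k5, k6⟩ | k4
      · have := this k6
        omega
      · omega
    have e0 : (n : ℤ) ≠ 8 := by
      intro e
      refine hu.inner (-1) w (by decide) (by decide) hw.mem_side ?_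
      have := hw.right
      rwa [show (7 : ℤ) = -1 + n by omega, h.add_period] at this
    have e1 := hadj 8 (-1) z₂ hz₂.mem_side hz₂.right
    have e2 := hadj 8 (-2) z₂ hz₂.mem_side hz₂.right
    obtain rfl | rfl : l = 6 ∨ l = 7 := by omega
    · exact ⟨hl', Or.inl ⟨hl, by omega⟩⟩
    · exact ⟨hl', Or.inr ⟨hl, by omega, z₂, hz₂⟩⟩

theorem false_of_four_four_left (hv : MinorSegment G c n side σ v 0 4) {y u w : V} {b : ℤ}
    (hy : MinorSegment G c n side σ y (-3) 0) (hu : MinorSegment G c n side τ u (-2) 2)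
    (hw : MinorSegment G c n side τ w 2 b)
    (hz : (b = 6 ∧ ∃ z, MinorSegment G c n side σ z 4 6 ∨ MinorSegment G c n side σ z 4 7) ∨
      (b = 7 ∧ ∃ z₁ z₂, MinorSegment G c n side σ z₁ 4 6 ∧ MinorSegment G c n side σ z₂ 6 8))
    (h13 : G.Adj (c (-1)) (c (-3))) : False := by
  have hn := h.eight
  have huv := h.ne_of_side hστ.symm hu.mem_side hv.mem_side
  obtain ⟨l, hl, h1, h2, h3, h4⟩ := h.exists_chord hστ hv hw 3
    (by decide) (by decide) (by decide) (by omega)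
  have h35 : ¬ G.Adj (c 3) (c 5) := by
    intro h35
    refine h.reroute₂ (h.off _ _ hu.mem_side) (h.off _ _ hv.mem_side) huv (a := -3) (b := 5)
      [.inl (-1), .inl (-2), .inr 0, .inl 2, .inl 1, .inl 0, .inr 1, .inl 4, .inl 3] (by omega)
      (by decide) ?_
    simp [h13.symm, h35, h.next, hu.left.symm, hu.right, hv.left.symm, hv.right]
  rcases h4 with ⟨h4, h5, h6⟩ | ⟨h4, h5, h6⟩
  · obtain rfl | rfl : l = 0 ∨ l = 1 := by omega
    · refine h.reroute₁ (h.off _ _ hu.mem_side) (a := -3) (b := 4)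
        [.inl (-1), .inl (-2), .inr 0, .inl 2, .inl 1, .inl 0, .inl 3] (by omega) (by decide) ?_
      simp [h13.symm, hl.symm, h.next, hu.left.symm, hu.right]
    · refine h.reroute₂ (h.off _ _ hu.mem_side) (h.off _ _ hv.mem_side) huv (a := -3) (b := 4)
        [.inl (-1), .inl (-2), .inr 0, .inl 2, .inl 3, .inl 1, .inl 0, .inr 1] (by omega)
        (by decide) ?_
      simp [h13.symm, hl, h.next, hu.left.symm, hu.right, hv.left.symm, hv.right]
  have h5' : l ≠ 5 := by
    rintro rfl
    exact h35 hl
  obtain ⟨h57, ⟨h36, hb⟩ | ⟨h37, hb, z₂, hz₂⟩⟩ := h.chords_of_four_or_five hστ (Or.inr rfl) hy hu hw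
    hz (by omega) h5 hl h6 h35
  · refine h.reroute₂ (h.off _ _ hu.mem_side) (h.off _ _ hv.mem_side) huv (a := -3) (b := 7)
      [.inl (-1), .inl (-2), .inr 0, .inl 2, .inl 1, .inl 0, .inr 1, .inl 4, .inl 3, .inl 6, .inl 5]
      hb (by decide) ?_
    simp [h13.symm, h36, h57, h.next, hu.left.symm, hu.right, hv.left.symm, hv.right]
  · have hvz : v ≠ z₂ := by
      rintro rfl
      exact h.not_four (h.off _ _ hv.mem_side) hv.left hv.right hz₂.left hz₂.right (by decide)
        (by decide) (by decide) (by omega)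
    refine h.reroute₃ (h.off _ _ hu.mem_side) (h.off _ _ hv.mem_side) (h.off _ _ hz₂.mem_side) huv
      (h.ne_of_side hστ.symm hu.mem_side hz₂.mem_side) hvz (a := -3) (b := 8)
      [.inl (-1), .inl (-2), .inr 0, .inl 2, .inl 1, .inl 0, .inr 1, .inl 4, .inl 3, .inl 7, .inl 5,
        .inl 6, .inr 2] hb (by decide) ?_
    simp [h13.symm, h37, h57.symm, h.next, hu.left.symm, hu.right, hv.left.symm, hv.right,
      hz₂.left.symm, hz₂.right]

theorem false_of_four_four_right (hv : MinorSegment G c n side σ v 0 4) {y u w : V} {a b : ℤ}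
    (ha : a = -2 ∨ a = -3)
    (hy : MinorSegment G c n side σ y a 0) (hu : MinorSegment G c n side τ u (-2) 2)
    (hw : MinorSegment G c n side τ w 2 b)
    (hz : (b = 6 ∧ ∃ z, MinorSegment G c n side σ z 4 6 ∨ MinorSegment G c n side σ z 4 7) ∨
      (b = 7 ∧ ∃ z₁ z₂, MinorSegment G c n side σ z₁ 4 6 ∧ MinorSegment G c n side σ z₂ 6 8))
    (h11 : ¬ G.Adj (c (-1)) (c 1)) (h12 : G.Adj (c (-1)) (c 2)) (hK : K τ (c (-1)) (c 2)) :
    False := by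
  have hn := h.eight
  have h13 : ¬ G.Adj (c 1) (c 3) := by
    intro h13
    refine h.reroute₁ (h.off _ _ hu.mem_side) (a := -2) (b := 3)
      [.inr 0, .inl 2, .inl (-1), .inl 0, .inl 1] (by omega) (by decide) ?_
    simp [h13, h12.symm, h.next, hu.left.symm, hu.right]
  obtain ⟨h14, hK'⟩ : G.Adj (c 1) (c 4) ∧ K σ (c 1) (c 4) := by
    obtain ⟨l, hl, h1, h2, h3, h4⟩ := h.exists_chord hστ hv hu 1
      (by decide) (by decide) (by decide) (by decide)
    obtain rfl | rfl | rfl | rfl : l = -2 ∨ l = -1 ∨ l = 3 ∨ l = 4 := by omega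
    · have hK'' : K τ (c 1) (c (-2)) := by
        rcases h4 with h4 | h4
        exacts [by omega, h4.2.2]
      exact (h.not_cross_chords τ (-2) 1 (-1) 2 hl.symm (h.K_symm _ _ _ hK'') h12 hK (by decide)
        (by decide) (by decide) (by omega)).elim
    · exact absurd hl.symm h11
    · exact absurd hl h13
    · refine ⟨hl, ?_⟩
      rcases h4 with h4 | h4
      exacts [h4.2.2, by omega]
  have h35 : ¬ G.Adj (c 3) (c 5) := by
    intro h35
    refine h.reroute₁ (h.off _ _ hu.mem_side) (a := -2) (b := 5)
      [.inr 0, .inl 2, .inl (-1), .inl 0, .inl 1, .inl 4, .inl 3] (by omega) (by decide) ?_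
    simp [h35, h14, h12.symm, h.next, hu.left.symm, hu.right]
  obtain ⟨l, hl, h1, h2, h3, h4⟩ := h.exists_chord hστ hv hw 3
    (by decide) (by decide) (by decide) (by omega)
  rcases h4 with ⟨h4, h5, h6⟩ | ⟨h4, h5, h6⟩
  · obtain rfl | rfl : l = 0 ∨ l = 1 := by omega
    · exact h.not_cross_chords σ 0 3 1 4 hl.symm (h.K_symm _ _ _ h6) h14 hK' (by decide) (by decide)
        (by decide) (by omega)
    · exact h13 hl.symm
  have h5' : l ≠ 5 := by
    rintro rfl
    exact h35 hl
  obtain ⟨h57, ⟨h36, hb⟩ | ⟨h37, hb, z₂, hz₂⟩⟩ := h.chords_of_four_or_five hστ ha hy hu hw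
    hz (by omega) h5 hl h6 h35
  · refine h.reroute₁ (h.off _ _ hu.mem_side) (a := -2) (b := 7)
      [.inr 0, .inl 2, .inl (-1), .inl 0, .inl 1, .inl 4, .inl 3, .inl 6, .inl 5] (by omega)
      (by decide) ?_
    simp [h36, h57, h14, h12.symm, h.next, hu.left.symm, hu.right]
  · refine h.reroute₂ (h.off _ _ hu.mem_side) (h.off _ _ hz₂.mem_side)
      (h.ne_of_side hστ.symm hu.mem_side hz₂.mem_side) (a := -2) (b := 8)
      [.inr 0, .inl 2, .inl (-1), .inl 0, .inl 1, .inl 4, .inl 3, .inl 7, .inl 5, .inl 6, .inr 1]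
      (by omega) (by decide) ?_
    simp [h37, h57.symm, h14, h12.symm, h.next, hu.left.symm, hu.right, hz₂.left.symm, hz₂.right]

theorem false_of_four_four (hv : MinorSegment G c n side σ v 0 4) {y u w : V} {a b : ℤ}
    (ha : a = -2 ∨ a = -3)
    (hy : MinorSegment G c n side σ y a 0) (hu : MinorSegment G c n side τ u (-2) 2)
    (hw : MinorSegment G c n side τ w 2 b)
    (hz : (b = 6 ∧ ∃ z, MinorSegment G c n side σ z 4 6 ∨ MinorSegment G c n side σ z 4 7) ∨
      (b = 7 ∧ ∃ z₁ z₂, MinorSegment G c n side σ z₁ 4 6 ∧ MinorSegment G c n side σ z₂ 6 8)) :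
    False := by
  have hn := h.eight
  have huy := h.ne_of_side hστ hy.mem_side hu.mem_side
  have h11 : ¬ G.Adj (c (-1)) (c 1) := by
    intro h11
    rcases ha with rfl | rfl
    · refine h.reroute₁ (h.off _ _ hy.mem_side) (a := -2) (b := 1)
        [.inr 0, .inl 0, .inl (-1)] (by omega) (by decide) ?_
      simp [h11, h.next, hy.left.symm, hy.right]
    · refine h.reroute₂ (h.off _ _ hy.mem_side) (h.off _ _ hu.mem_side) huy (a := -3) (b := 2)
        [.inr 0, .inl 0, .inl 1, .inl (-1), .inl (-2), .inr 1] (by omega) (by decide) ?_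
      simp [h11.symm, h.next, hy.left.symm, hy.right, hu.left.symm, hu.right]
  obtain ⟨l, hl, h1, h2, h3, h4⟩ := h.exists_chord hστ hy hu (-1)
    (by omega) (by decide) (by decide) (by decide)
  rcases h4 with ⟨h4, h5, h6⟩ | ⟨h4, h5, h6⟩
  · obtain rfl : l = -3 := by omega
    obtain rfl : a = -3 := by omega
    exact h.false_of_four_four_left hστ hv hy hu hw hz hl
  · obtain rfl | rfl : l = 1 ∨ l = 2 := by omega
    · exact h11 hl
    · exact h.false_of_four_four_right hστ hv ha hy hu hw hz h11 hl h6

end CycleConfig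

end FourExclusions

section Bridge

open Set Topology Filter

variable {V : Type*} {G : SimpleGraph V}

/-- A periodic enumeration of a cycle traces a closed walk. -/
theorem CycSeq.exists_walk {v : ℤ → V} {m : ℕ} (h : CycSeq G v m) :
    ∃ C : G.Walk (v 0) (v 0), C.IsCycle ∧ C.length = m ∧ ∀ u, u ∈ range v → u ∈ C.support := by
  have hm := h.three
  have key : ∀ k : ℕ, ∃ p : G.Walk (v 0) (v k), p.length = k ∧ ∀ i : ℕ, i ≤ k → p.getVert i = v i := by
    intro k
    induction k with
    | zero =>
      refine ⟨.nil, rfl, fun i hi => ?_⟩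
      obtain rfl : i = 0 := by omega
      simp
    | succ k ih =>
      obtain ⟨p, hp, hpv⟩ := ih
      have ha : G.Adj (v k) (v ((k + 1 : ℕ) : ℤ)) := by
        push_cast
        exact h.adj k
      refine ⟨p.concat ha, by simp [hp], fun i hi => ?_⟩
      rcases hi.lt_or_eq with hi | rfl
      · rw [SimpleGraph.Walk.concat_eq_append, SimpleGraph.Walk.getVert_append, hp]
        split_ifs with h1
        · exact hpv i (by omega)
        · obtain rfl : i = k := by omega
          simp
      · rw [SimpleGraph.Walk.getVert_of_length_le _ (by simp [hp])]
  obtain ⟨p, hp, hpv⟩ := key m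
  have hm0 : v (m : ℤ) = v 0 := (h.eq_iff _ _).2 (by simp)
  refine ⟨p.copy rfl hm0, ?_, by simpa using hp, ?_⟩
  · rw [SimpleGraph.Walk.isCycle_iff_isPath_tail_and_le_length,
      ← SimpleGraph.Walk.IsPath.getVert_injOn_iff]
    refine ⟨fun i hi j hj hij => ?_, by simpa [hp] using hm⟩
    have ht : (p.copy rfl hm0).tail.length + 1 = m := by
      rw [SimpleGraph.Walk.length_tail_add_one]
      · simpa using hp
      · rw [SimpleGraph.Walk.not_nil_iff_lt_length]
        simp [hp]
        omega
    simp only [Set.mem_ofPred_eq] at hi hj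
    rw [SimpleGraph.Walk.getVert_tail, SimpleGraph.Walk.getVert_tail,
      SimpleGraph.Walk.getVert_copy, SimpleGraph.Walk.getVert_copy, hpv _ (by omega),
      hpv _ (by omega), h.eq_iff] at hij
    obtain ⟨r, hr⟩ := hij
    push_cast at hr
    have : r = 0 := by
      by_contra h0
      rcases lt_or_gt_of_ne h0 with h0 | h0
      · nlinarith
      · nlinarith
    subst this
    omega
  · rintro u ⟨i, rfl⟩
    obtain ⟨j, h1, h2, h3⟩ := h.exists_mem_Ico 0 (mem_range_self i)
    rw [← h3, SimpleGraph.Walk.mem_support_iff_exists_getVert]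
    refine ⟨j.toNat, ?_, ?_⟩
    · rw [SimpleGraph.Walk.getVert_copy, hpv _ (by omega), Int.toNat_of_nonneg h1]
    · simp only [SimpleGraph.Walk.length_copy, hp]
      omega

/-- The periodic enumeration of a cycle. -/
theorem exists_cycSeq {x : V} {C : G.Walk x x} (hC : C.IsCycle) :
    ∃ c : ℤ → V, CycSeq G c C.length ∧ (∀ u, u ∈ C.support ↔ u ∈ range c) ∧
      ∀ e, e ∈ C.edges ↔ e ∈ cycEdges c := by
  have h3 := hC.three_le_length
  have hl : C.getVert C.length = C.getVert 0 := by simp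
  have hi : InjOn C.getVert (Iio C.length) := by
    intro i hi j hj hij
    exact hC.getVert_injOn' (by simp only [Set.mem_ofPred_eq, Set.mem_Iio] at hi ⊢; omega)
      (by simp only [Set.mem_ofPred_eq, Set.mem_Iio] at hj ⊢; omega) hij
  have hs := CycSeq.of_path (G := G) h3 hi (fun r hr => C.adj_getVert_succ (by omega)) (by
    have := C.adj_getVert_succ (i := C.length - 1) (by omega)
    rwa [show C.length - 1 + 1 = C.length by omega, hl] at this)
  refine ⟨_, hs, fun u => ?_, fun e => ?_⟩
  · rw [SimpleGraph.Walk.mem_support_iff_exists_getVert]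
    constructor
    · rintro ⟨k, rfl, hk⟩
      rcases hk.lt_or_eq with hk | rfl
      · refine ⟨k, ?_⟩
        have : ((k : ℤ) % (C.length : ℤ)) = k := Int.emod_eq_of_lt (by omega) (by omega)
        simp only [this, Int.toNat_natCast]
      · exact ⟨0, by simp⟩
    · rintro ⟨i, rfl⟩
      have h1 : i % (C.length : ℤ) < C.length := Int.emod_lt_of_pos _ (by omega)
      exact ⟨_, rfl, by omega⟩
  · rw [mem_cycEdges_of_path h3]
    induction e with
    | _ y z =>
    rw [SimpleGraph.Walk.mk_mem_edges_iff_exists]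
    constructor
    · rintro ⟨r, hr, he⟩
      rcases (show r + 1 ≤ C.length by omega).lt_or_eq with h1 | h1
      · exact Or.inl ⟨r, h1, he.symm⟩
      · right
        rw [← he, h1, hl, show r = C.length - 1 by omega]
    · rintro (⟨r, hr, he⟩ | he)
      · exact ⟨r, by omega, he.symm⟩
      · refine ⟨C.length - 1, by omega, ?_⟩
        rw [show C.length - 1 + 1 = C.length by omega, hl, he]

section

variable {x : V} {C : G.Walk x x} {c : ℤ → V}

theorem drawingH_eq (emb : PlaneEmbedding G) (hsupp : ∀ u, u ∈ C.support ↔ u ∈ range c)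
    (hedge : ∀ e, e ∈ C.edges ↔ e ∈ cycEdges c) {n : ℕ} (hs : CycSeq G c n)
    (hadj : ∀ u, u ∉ range c → ∃ w, G.Adj u w) :
    drawingH emb C = arcUnion emb (hEdges G c) := by
  have hH : ∀ u w, (Hgraph C).Adj u w ↔ s(u, w) ∈ hEdges G c := by
    intro u w
    simp only [Hgraph, SimpleGraph.deleteEdges_adj, chordSet, hEdges, mem_ofPred_eq, hedge, hsupp,
      SimpleGraph.mem_edgeSet]
    grind
  ext z
  simp only [drawingH, drawingOn, mem_union, mem_iUnion, mem_univ, exists_prop, true_and, image_univ,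
    emb.mem_arcUnion, hH]
  constructor
  · rintro (⟨u, rfl⟩ | h)
    · by_cases hu : u ∈ range c
      · obtain ⟨i, rfl⟩ := hu
        exact ⟨_, _, ⟨hs.adj i, Or.inl ⟨i, rfl⟩⟩, emb.pos_mem_arc_left (hs.adj i)⟩
      · obtain ⟨w, hw⟩ := hadj u hu
        exact ⟨u, w, mem_hEdges hu hw, emb.pos_mem_arc_left hw⟩
    · exact h
  · exact Or.inr

variable [Fintype V]

theorem mem_Vminus_union_Vplus (emb : PlaneEmbedding G) {u : V} :
    u ∈ Vminus emb C ∪ Vplus emb C ↔ u ∉ C.support := by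
  simp only [Finset.mem_union, Vplus, Finset.mem_filter, Finset.mem_univ, true_and]
  constructor
  · rintro (h | h)
    · exact (Finset.mem_filter.1 h).2.1
    · exact h.1
  · intro h
    by_cases h' : u ∈ Vminus emb C
    exacts [Or.inl h', Or.inr ⟨h, h'⟩]

theorem ThreeConnected.exists_adj (h : ThreeConnected G) (A : Set V) (y z : V) (hA : A.Nonempty)
    (hy : y ∉ A) (hz : z ∉ A) (hb : ∃ b, b ∉ A ∧ b ≠ y ∧ b ≠ z) :
    ∃ a ∈ A, ∃ b, b ∉ A ∧ b ≠ y ∧ b ≠ z ∧ G.Adj a b := by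
  obtain ⟨a, ha⟩ := hA
  obtain ⟨b, hb, hby, hbz⟩ := hb
  have hc := h.2 {y, z} Finset.card_le_two
  have hay : a ∈ ((↑({y, z} : Finset V) : Set V)ᶜ) := by
    simp only [Finset.coe_insert, Finset.coe_singleton, mem_compl_iff, mem_insert_iff,
      mem_singleton_iff, not_or]
    exact ⟨by rintro rfl; exact hy ha, by rintro rfl; exact hz ha⟩
  have hbyz : b ∈ ((↑({y, z} : Finset V) : Set V)ᶜ) := by
    simp [hby, hbz]
  obtain ⟨p⟩ := hc.preconnected ⟨a, hay⟩ ⟨b, hbyz⟩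
  obtain ⟨d, -, h1, h2⟩ := p.exists_boundary_dart {u | (u : V) ∈ A} ha hb
  have h3 := d.snd.2
  simp only [Finset.coe_insert, Finset.coe_singleton, mem_compl_iff, mem_insert_iff,
    mem_singleton_iff, not_or] at h3
  exact ⟨_, h1, _, h2, h3.1, h3.2, d.adj⟩

end

end Bridge

section Layouts

open Set Topology Filter

variable {V : Type*} [Fintype V] {G : SimpleGraph V} {x : V}

/-- The faces of the drawing of `H` along a longest isolating cycle: `F σ i` is the face on the side
`σ` of the `i`-th edge of the cycle. -/
structure Layout (emb : PlaneEmbedding G) (C : G.Walk x x) (c : ℤ → V) (n : ℕ)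
    (side : Bool → V → Prop) (K : Bool → V → V → Prop) (F : Bool → ℤ → Set (ℝ × ℝ)) : Prop
    extends CycleConfig G c n side K where
  mem_edges : ∀ e, e ∈ C.edges ↔ e ∈ cycEdges c
  isFace : ∀ σ i, IsFaceOf (drawingH emb C) (F σ i)
  inc : ∀ g, IsFaceOf (drawingH emb C) g → ∀ i,
    (incEdge emb g s(c i, c (i + 1)) ↔ ∃ σ, g = F σ i)
  F_side : ∀ σ τ i j, F σ i = F τ j → σ = τ
  seg : ∀ σ i, MinorFaceH emb C (F σ i) → ∃ w a b, a ≤ i ∧ i < b ∧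
    MinorSegment G c n side σ w a b ∧ ∀ j, F σ j = F σ i ↔ ∃ r : ℤ, a ≤ j + r * n ∧ j + r * n < b

theorem exists_layout (h4 : ThreeConnected G) (emb : PlaneEmbedding G) {C : G.Walk x x}
    (hC : IsLongestIsolatingCycle G C) (hc : 8 ≤ C.length) :
    ∃ c n side K F, Layout emb C c n side K F := by
  obtain ⟨hcyc, hiso, hlong⟩ := hC
  obtain ⟨c, hs, hsupp, hedge⟩ := exists_cycSeq hcyc
  obtain ⟨Γ, hΓ⟩ := hs.exists_param emb
  obtain ⟨U, hU⟩ := hΓ.exists_sides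
  have hd : CycDrawing emb c C.length Γ U := by
    refine ⟨hs, hΓ, hU, fun u hu w huw => ?_, fun u hu y => ?_⟩
    · rw [← hsupp] at hu ⊢
      exact (hiso u hu).2 w huw
    · rw [← hsupp] at hu
      obtain ⟨y', h1, h2⟩ := Finset.exists_mem_ne
        (show 1 < (Finset.univ.filter fun w => G.Adj u w).card by rw [(hiso u hu).1]; decide) y
      exact ⟨y', h2, by simpa using h1⟩
  have hD : drawingH emb C = arcUnion emb (hEdges G c) :=
    drawingH_eq emb hsupp hedge hs fun u hu => by
      obtain ⟨w, -, hw⟩ := hd.nbr_ne u hu u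
      exact ⟨w, hw⟩
  obtain ⟨F, hF, hFt⟩ := hd.exists_faces
  have hne : ∀ σ i, (F σ i).Nonempty := fun σ i => by
    obtain ⟨z, hz, he⟩ := (hF σ i).1
    rw [he]
    exact ⟨z, mem_connectedComponentIn hz⟩
  refine ⟨c, C.length, fun σ u => u ∉ range c ∧ emb.pos u ∈ U σ,
    fun σ y z => openArc emb y z ⊆ U σ, F, ⟨?_, hedge, ?_, ?_, ?_, ?_⟩⟩
  · refine ⟨hs, hc, hd.nbr_mem, ?_, fun σ u hu => hu.1, ?_, ?_, ?_, ?_, ?_, ?_, ?_, ?_⟩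
    · intro u hu
      rw [← hsupp] at hu
      obtain ⟨y₁, y₂, y₃, -, -, -, h3⟩ := Finset.card_eq_three.1 (hiso u hu).1
      refine ⟨y₁, y₂, y₃, fun w hw => ?_⟩
      have : w ∈ Finset.univ.filter fun w => G.Adj u w := by simpa using hw
      rw [h3] at this
      simpa using this
    · rintro σ τ u ⟨-, h1⟩ ⟨-, h2⟩
      exact hU.eq_of_mem h1 h2
    · intro u hu
      obtain ⟨σ, hσ⟩ := hd.exists_side hu
      exact ⟨σ, hu, hσ⟩
    · intro σ y z hyz
      rwa [openArc, emb.arc_symm, pair_comm]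
    · intro i j hij hne
      exact hΓ.exists_side_openArc hs hU hij hne
    · intro σ w a b j l hw haw hbw hjl hK h1 h2 h3 h4
      exact hd.not_cross_spokes hw.1 hw.2 haw hbw hjl hK h1 h2 h3 h4
    · intro σ a b j l hab hK hjl hK' h1 h2 h3 h4
      exact hd.not_cross_chords hab hK hjl hK' h1 h2 h3 h4
    · intro A y z hA hy hz hb
      exact h4.exists_adj A y z hA hy hz hb
    · intro m v hv hsub
      obtain ⟨C', h1, rfl, h3⟩ := hv.exists_walk
      refine hlong _ C' h1 fun u hu => ?_
      have hu' : ∀ w, w ∈ C.support → w ∈ C'.support := fun w hw => h3 _ (hsub ((hsupp w).1 hw))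
      obtain ⟨h5, h6⟩ := hiso u fun hh => hu (hu' u hh)
      exact ⟨h5, fun w hw => hu' w (h6 w hw)⟩
  · intro σ i
    rw [hD]
    exact (hF σ i).1
  · intro g hg i
    rw [hD] at hg
    have hT : incEdge emb g s(c i, c (i + 1)) ↔ Touches emb c g i := Iff.rfl
    rw [hT]
    constructor
    · intro ht
      obtain ⟨σ, hσ⟩ := hd.face_side hg
      exact ⟨σ, (hFt σ g hg hσ i).1 ht⟩
    · rintro ⟨σ, rfl⟩
      exact (hFt σ _ hg (hF σ i).2 i).2 rfl
  · intro σ τ i j hij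
    obtain ⟨z, hz⟩ := hne σ i
    exact hU.eq_of_mem ((hF σ i).2 hz) ((hF τ j).2 (hij ▸ hz))
  · rintro σ i ⟨hf, w, ⟨hw1, hw2⟩, hw3⟩
    rw [mem_Vminus_union_Vplus, hsupp] at hw1
    have hm : MinorAt emb c (F σ i) w :=
      ⟨(hF σ i).1, hw1, hw2, fun u hu hu' => hw3 u
        ⟨by rwa [mem_Vminus_union_Vplus, hsupp], hu'⟩⟩
    have ht : ∀ j, Touches emb c (F σ i) j ↔ F σ i = F σ j := hFt σ _ (hF σ i).1 (hF σ i).2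
    obtain ⟨a, b, hai, hib, hba, haw, hbw, hj⟩ := hd.exists_segment hm ((ht i).2 rfl)
    refine ⟨w, a, b, hai, hib, ⟨⟨hw1, ?_⟩, haw, hbw, by omega, hba, ?_⟩, fun j => ?_⟩
    · rcases hU.closure_subset (closure_mono (hF σ i).2 hw2) with h1 | h1
      · exact h1
      · exact absurd (hΓ.exists_of_pos_mem hs h1) hw1
    · intro j u h1 h2 hu
      exact hd.not_adj_of_touches (hF σ i).1 (hF σ i).2
        ((hj _).2 ⟨0, by omega, by omega⟩) ((hj _).2 ⟨0, by omega, by omega⟩) hu.1 hu.2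
    · rw [eq_comm, ← ht, hj]

end Layouts

section LayoutCounting

open Set Topology Filter

variable {V : Type*} [Fintype V] {G : SimpleGraph V} {x : V}

namespace Layout

variable {emb : PlaneEmbedding G} {C : G.Walk x x} {c : ℤ → V} {n : ℕ} {side : Bool → V → Prop}
  {K : Bool → V → V → Prop} {F : Bool → ℤ → Set (ℝ × ℝ)} (L : Layout emb C c n side K F)
include L

theorem shift (s : ℤ) :
    Layout emb C (fun i => c (i + s)) n side K (fun σ i => F σ (i + s)) where
  toCycleConfig := L.toCycleConfig.shift s
  mem_edges := by rw [cycEdges_shift]; exact L.mem_edges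
  isFace := fun σ i => L.isFace σ _
  inc := fun g hg i => by
    have := L.inc g hg (i + s)
    rwa [add_right_comm] at this
  F_side := fun σ τ i j => L.F_side σ τ _ _
  seg := fun σ i hi => by
    obtain ⟨w, a, b, h1, h2, h3, h4⟩ := L.seg σ (i + s) hi
    refine ⟨w, a - s, b - s, by omega, by omega, h3.shift s (by ring) (by ring), fun j => ?_⟩
    rw [h4]
    exact exists_congr fun r => by constructor <;> rintro ⟨h5, h6⟩ <;> constructor <;> linarith

theorem reflect (s : ℤ) :
    Layout emb C (fun i => c (s - i)) n side K (fun σ i => F σ (s - 1 - i)) where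
  toCycleConfig := L.toCycleConfig.reflect s
  mem_edges := by
    have e : (fun i => c (s - i)) = fun i => (fun k => c (-k)) (i + -s) := by
      ext i
      ring_nf
    have h1 := cycEdges_shift (fun k => c (-k)) (-s)
    rw [e, h1, cycEdges_neg]
    exact L.mem_edges
  isFace := fun σ i => L.isFace σ _
  inc := fun g hg i => by
    have := L.inc g hg (s - 1 - i)
    rw [Sym2.eq_swap, show s - 1 - i + 1 = s - i by ring] at this
    rwa [show s - (i + 1) = s - 1 - i by ring]
  F_side := fun σ τ i j => L.F_side σ τ _ _
  seg := fun σ i hi => by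
    obtain ⟨w, a, b, h1, h2, h3, h4⟩ := L.seg σ (s - 1 - i) hi
    refine ⟨w, s - b, s - a, by omega, by omega, h3.reflect s (by ring) (by ring), fun j => ?_⟩
    rw [h4]
    constructor
    · rintro ⟨r, h5, h6⟩
      refine ⟨-r, ?_, ?_⟩ <;> rw [neg_mul] <;> linarith
    · rintro ⟨r, h5, h6⟩
      refine ⟨-r, ?_, ?_⟩ <;> rw [neg_mul] <;> linarith

theorem inc_iff (σ : Bool) (i j : ℤ) :
    incEdge emb (F σ i) s(c j, c (j + 1)) ↔ F σ i = F σ j := by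
  rw [L.inc _ (L.isFace σ i)]
  constructor
  · rintro ⟨τ, hτ⟩
    obtain rfl := L.F_side _ _ _ _ hτ
    exact hτ
  · exact fun hh => ⟨σ, hh⟩

theorem F_congr (σ : Bool) {i j : ℤ} (hij : (n : ℤ) ∣ i - j) : F σ i = F σ j := by
  have h1 : c i = c j := (L.seq.eq_iff _ _).2 hij
  have h2 : c (i + 1) = c (j + 1) := (L.seq.eq_iff _ _).2 (by simpa using hij)
  rw [← L.inc_iff, ← h1, ← h2, L.inc_iff]

theorem card_filter_edges (P : Sym2 V → Prop) [DecidablePred P] (a : ℤ) :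
    (C.edges.toFinset.filter P).card =
      ((Finset.Ico a (a + n)).filter fun i => P s(c i, c (i + 1))).card := by
  have hn := L.eight
  symm
  refine Finset.card_bij (fun i _ => s(c i, c (i + 1))) (fun i hi => ?_) (fun i hi j hj hij => ?_)
    fun e he => ?_
  · rw [Finset.mem_filter, List.mem_toFinset, L.mem_edges]
    exact ⟨⟨i, rfl⟩, (Finset.mem_filter.1 hi).2⟩
  · rw [Finset.mem_filter, Finset.mem_Ico] at hi hj
    have hlt : ∀ k : ℤ, (n : ℤ) ∣ k → |k| < n → k = 0 := fun k h1 h2 =>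
      Int.eq_zero_of_abs_lt_dvd h1 h2
    rcases Sym2.eq_iff.1 hij with ⟨h1, h2⟩ | ⟨h1, h2⟩
    · have := hlt _ ((L.seq.eq_iff _ _).1 h1) (by rw [abs_lt]; omega)
      omega
    · obtain ⟨r, hr⟩ := (L.seq.eq_iff _ _).1 h1
      obtain ⟨r', hr'⟩ := (L.seq.eq_iff _ _).1 h2
      have h3 : (n : ℤ) ∣ 2 := ⟨r' - r, by rw [mul_sub]; omega⟩
      have := Int.le_of_dvd (by decide) h3
      omega
  · rw [Finset.mem_filter, List.mem_toFinset, L.mem_edges] at he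
    obtain ⟨⟨i, rfl⟩, hP⟩ := he
    have h0 : (0 : ℤ) < n := by omega
    have h1 : c i = c (a + (i - a) % n) := (L.seq.eq_iff _ _).2 (by
      rw [show i - (a + (i - a) % n) = (i - a) - (i - a) % n by ring]
      exact Int.dvd_self_sub_emod)
    have h2 : c (i + 1) = c (a + (i - a) % n + 1) := (L.seq.eq_iff _ _).2 (by
      rw [show i + 1 - (a + (i - a) % n + 1) = (i - a) - (i - a) % n by ring]
      exact Int.dvd_self_sub_emod)
    refine ⟨a + (i - a) % n, ?_, by rw [← h1, ← h2]⟩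
    have h3 := Int.emod_nonneg (i - a) h0.ne'
    have h4 := Int.emod_lt_of_pos (i - a) h0
    rw [Finset.mem_filter, Finset.mem_Ico, ← h1, ← h2]
    exact ⟨⟨by omega, by omega⟩, hP⟩

theorem numCEdges_eq {σ : Bool} {i a b : ℤ} (hab : a ≤ b) (hba : b < a + n)
    (h : ∀ j, F σ j = F σ i ↔ ∃ r : ℤ, a ≤ j + r * n ∧ j + r * n < b) :
    (numCEdges emb C (F σ i) : ℤ) = b - a := by
  have hn := L.eight
  rw [numCEdges, L.card_filter_edges (fun e => incEdge emb (F σ i) e) a]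
  have : (Finset.Ico a (a + n)).filter (fun j => incEdge emb (F σ i) s(c j, c (j + 1))) =
      Finset.Ico a b := by
    ext j
    rw [Finset.mem_filter, Finset.mem_Ico, Finset.mem_Ico, L.inc_iff, eq_comm, h]
    constructor
    · rintro ⟨⟨h1, h2⟩, r, h3, h4⟩
      have : r = 0 := by
        rcases lt_trichotomy r 0 with h | h | h
        · nlinarith
        · exact h
        · nlinarith
      subst this
      omega
    · rintro ⟨h1, h2⟩
      exact ⟨⟨h1, by omega⟩, 0, by omega, by omega⟩
  rw [this, Int.card_Ico]
  omega

theorem mEdges_eq {σ τ : Bool} {i a b : ℤ} (hba : b < a + n)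
    (h : ∀ j, F σ j = F σ i ↔ ∃ r : ℤ, a ≤ j + r * n ∧ j + r * n < b) (k : ℤ) :
    mEdges emb C (F σ i) (F τ k) = ((Finset.Ico a b).filter fun j => F τ j = F τ k).card := by
  have hn := L.eight
  rw [mEdges, L.card_filter_edges (fun e => incEdge emb (F σ i) e ∧ incEdge emb (F τ k) e) a]
  congr 1
  ext j
  rw [Finset.mem_filter, Finset.mem_filter, Finset.mem_Ico, Finset.mem_Ico, L.inc_iff, L.inc_iff,
    eq_comm, h, eq_comm (a := F τ k)]
  constructor
  · rintro ⟨⟨h1, h2⟩, ⟨r, h3, h4⟩, h5⟩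
    have : r = 0 := by
      rcases lt_trichotomy r 0 with h | h | h
      · nlinarith
      · exact h
      · nlinarith
    subst this
    exact ⟨by omega, h5⟩
  · rintro ⟨⟨h1, h2⟩, h3⟩
    exact ⟨⟨h1, by omega⟩, ⟨0, by omega, by omega⟩, h3⟩

/-- The faces opposite to a minor face lie on the other side of the cycle. -/
theorem opposite_iff {σ τ : Bool} (hστ : σ ≠ τ) {i a b : ℤ}
    (h : ∀ j, F σ j = F σ i ↔ ∃ r : ℤ, a ≤ j + r * n ∧ j + r * n < b) {g : Set (ℝ × ℝ)}
    (hg : IsFaceOf (drawingH emb C) g) :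
    OppositeFaces emb C (F σ i) g ↔ ∃ j, a ≤ j ∧ j < b ∧ g = F τ j := by
  constructor
  · rintro ⟨hne, e, he, h1, h2⟩
    obtain ⟨j, rfl⟩ := (L.mem_edges e).1 he
    have h1' := (L.inc_iff σ i j).1 h1
    obtain ⟨ρ, rfl⟩ := (L.inc g hg j).1 h2
    obtain ⟨r, h3, h4⟩ := (h j).1 h1'.symm
    obtain rfl : ρ = τ := by
      have : ρ ≠ σ := by
        rintro rfl
        exact hne h1'
      cases ρ <;> cases σ <;> cases τ <;> simp_all
    exact ⟨_, h3, h4, L.F_congr _ (by simp)⟩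
  · rintro ⟨j, h1, h2, rfl⟩
    refine ⟨fun hh => hστ (L.F_side _ _ _ _ hh), s(c j, c (j + 1)), (L.mem_edges _).2 ⟨j, rfl⟩, ?_,
      (L.inc_iff _ _ _).2 rfl⟩
    rw [L.inc_iff, eq_comm, h]
    exact ⟨0, by omega, by omega⟩

end Layout

end LayoutCounting

section NetFlow

open Set Topology Filter

variable {V : Type*} [Fintype V] {G : SimpleGraph V} {x : V}

/-- The weight sent from `f` to `g` minus the weight sent from `g` to `f`. -/
def netFlow (emb : PlaneEmbedding G) (C : G.Walk x x) (f g : Set (ℝ × ℝ)) : ℚ :=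
  sendWeight emb C f g - sendWeight emb C g f

variable {emb : PlaneEmbedding G} {C : G.Walk x x} {f g : Set (ℝ × ℝ)}

omit [Fintype V] in
theorem OppositeFaces.symm (h : OppositeFaces emb C f g) : OppositeFaces emb C g f := by
  obtain ⟨h1, e, h2, h3, h4⟩ := h
  exact ⟨h1.symm, e, h2, h4, h3⟩

omit [Fintype V] in
theorem mEdges_comm (f g : Set (ℝ × ℝ)) : mEdges emb C f g = mEdges emb C g f := by
  rw [mEdges, mEdges]
  congr 1
  ext e
  simp only [Finset.mem_filter, and_comm (a := incEdge emb f e)]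

theorem opposite_of_sendWeight_ne_zero (h : sendWeight emb C f g ≠ 0) :
    IsFaceOf (drawingH emb C) f ∧ IsFaceOf (drawingH emb C) g ∧ OppositeFaces emb C f g := by
  by_contra hh
  apply h
  rw [sendWeight, if_neg, if_neg, if_neg, if_neg, if_neg]
  · norm_num
  · exact fun h' => hh ⟨h'.1.1, h'.2.2.1.1, h'.2.2.2.2.1.symm⟩
  · exact fun h' => hh ⟨h'.1.1, h'.2.2.1.1, h'.2.2.2.2.1.symm⟩
  · rintro ⟨h1, h2, -, h3, e, h4, h5⟩
    exact hh ⟨h1.1, h2.1, h3, e, h4.1, h5, h4.2.1⟩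
  · exact fun h' => hh ⟨h'.1.1, h'.2.1.1, h'.2.2.2⟩
  · exact fun h' => hh ⟨h'.1.1, h'.2.1.1, h'.2.2⟩

theorem ite_nonneg' {p : Prop} [Decidable p] {q : ℚ} (hq : 0 ≤ q) : 0 ≤ if p then q else 0 := by
  split_ifs
  · exact hq
  · exact le_rfl

theorem sendWeight_nonneg (f g : Set (ℝ × ℝ)) : 0 ≤ sendWeight emb C f g := by
  have hm : (0 : ℚ) ≤ mEdges emb C f g := Nat.cast_nonneg _
  rw [sendWeight]
  refine add_nonneg (add_nonneg (add_nonneg (add_nonneg ?_ ?_) ?_) ?_) ?_ <;>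
    apply ite_nonneg' <;> positivity

/-- Only major faces lose weight by the first rule, and they receive none. -/
theorem netFlow_of_major (hf : MinorFaceH emb C f) (hg : MajorFaceH emb C g)
    (h : OppositeFaces emb C f g) : netFlow emb C f g = -mEdges emb C f g := by
  have h1 : ¬ MajorFaceH emb C f := fun h' => h'.2 hf
  rw [netFlow, sendWeight, sendWeight]
  simp only [hg.2, h1, hf, hg, h.symm, mEdges_comm g f, false_and, and_false, true_and, if_false,
    and_self, if_true]
  norm_num

theorem sendWeight_of_two (hf : MinorFaceH emb C f) (hg : numCEdges emb C g = 2) :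
    sendWeight emb C f g ≤ 2 / 3 * mEdges emb C f g := by
  have h1 : ¬ MajorFaceH emb C f := fun h' => h'.2 hf
  have hm : (0 : ℚ) ≤ mEdges emb C f g := Nat.cast_nonneg _
  rw [sendWeight]
  simp only [h1, hg, false_and, and_false, if_false, Nat.reduceEqDiff]
  split_ifs <;> linarith

theorem sendWeight_of_three (hf : MinorFaceH emb C f) (hg : numCEdges emb C g = 3) :
    sendWeight emb C f g ≤ 1 ∧
      (0 < sendWeight emb C f g → ∃ e, IsMiddleCEdge emb C g e ∧ incEdge emb f e) := by
  have h1 : ¬ MajorFaceH emb C f := fun h' => h'.2 hf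
  rw [sendWeight]
  simp only [h1, hg, false_and, and_false, if_false, Nat.reduceEqDiff]
  split_ifs with h
  · exact ⟨by norm_num, fun _ => h.2.2.2.2⟩
  · norm_num

theorem sendWeight_of_four (hf : MinorFaceH emb C f) (hg : 4 ≤ numCEdges emb C g) :
    sendWeight emb C f g ≤ 0 ∨ mEdges emb C g f = 2 ∧
      ((sendWeight emb C f g ≤ 2 / 3 ∧ numCEdges emb C g = 4 ∧
        ∃ f₂ : Set (ℝ × ℝ), MinorFaceH emb C f₂ ∧
          (numCEdges emb C f₂ = 2 ∨ numCEdges emb C f₂ = 3) ∧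
          OppositeFaces emb C g f₂ ∧ mEdges emb C g f₂ = 2) ∨
      (sendWeight emb C f g ≤ 1 / 3 ∧ numCEdges emb C g = 5 ∧
        ∃ g₁ g₂ : Set (ℝ × ℝ), g₁ ≠ g₂ ∧
          MinorFaceH emb C g₁ ∧ numCEdges emb C g₁ = 2 ∧ OppositeFaces emb C g g₁ ∧
          MinorFaceH emb C g₂ ∧ numCEdges emb C g₂ = 2 ∧ OppositeFaces emb C g g₂)) := by
  have h1 : ¬ MajorFaceH emb C f := fun h' => h'.2 hf
  have h2 : numCEdges emb C g ≠ 2 := by omega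
  have h3 : numCEdges emb C g ≠ 3 := by omega
  rw [sendWeight]
  simp only [h1, h2, h3, false_and, and_false, if_false]
  by_cases h4 : numCEdges emb C g = 4
  · simp only [h4, false_and, and_false, if_false, Nat.reduceEqDiff]
    split_ifs with h
    · exact Or.inr ⟨h.2.2.2.2.2.1, Or.inl ⟨by norm_num, trivial, h.2.2.2.2.2.2⟩⟩
    · exact Or.inl (by norm_num)
  · simp only [h4, false_and, and_false, if_false]
    split_ifs with h
    · exact Or.inr ⟨h.2.2.2.2.2.1, Or.inr ⟨by norm_num, h.2.2.2.1, h.2.2.2.2.2.2⟩⟩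
    · exact Or.inl (by norm_num)

/-- A minor `4`-face with a suitable opposite `2`- or `3`-face receives weight by the fourth
rule. -/
theorem two_thirds_le_sendWeight {f₂ : Set (ℝ × ℝ)} (hf : MinorFaceH emb C f)
    (hf4 : numCEdges emb C f = 4) (hg : MinorFaceH emb C g) (hg4 : 4 ≤ numCEdges emb C g)
    (h : OppositeFaces emb C f g) (hm : mEdges emb C f g = 2) (hf₂ : MinorFaceH emb C f₂)
    (h23 : numCEdges emb C f₂ = 2 ∨ numCEdges emb C f₂ = 3) (h₂ : OppositeFaces emb C f f₂)
    (hm₂ : mEdges emb C f f₂ = 2) : 2 / 3 ≤ sendWeight emb C g f := by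
  have h1 : ¬ MajorFaceH emb C g := fun h' => h'.2 hg
  rw [sendWeight]
  simp only [h1, hf4, false_and, and_false, if_false, true_and, Nat.reduceEqDiff]
  rw [if_pos ⟨hg, hg4, hf, h, hm, f₂, hf₂, h23, h₂, hm₂⟩]
  norm_num

end NetFlow

section FourFaceShares

open Set Topology Filter

variable {V : Type*} [Fintype V] {G : SimpleGraph V} {x : V}

namespace Layout

variable {emb : PlaneEmbedding G} {C : G.Walk x x} {c : ℤ → V} {n : ℕ} {side : Bool → V → Prop}
  {K : Bool → V → V → Prop} {F : Bool → ℤ → Set (ℝ × ℝ)} (L : Layout emb C c n side K F)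
include L

omit [Fintype V] L in
theorem eq_of_mem {σ : Bool} {i a b : ℤ}
    (h : ∀ j, F σ j = F σ i ↔ ∃ r : ℤ, a ≤ j + r * n ∧ j + r * n < b) {j : ℤ} (h1 : a ≤ j)
    (h2 : j < b) : F σ j = F σ i :=
  (h j).2 ⟨0, by omega, by omega⟩

/-- Inside a window shorter than the cycle, the faces agree only within the segment. -/
theorem mem_of_eq {σ : Bool} {i a b : ℤ}
    (h : ∀ j, F σ j = F σ i ↔ ∃ r : ℤ, a ≤ j + r * n ∧ j + r * n < b) {j : ℤ} (hj : F σ j = F σ i)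
    (h1 : b - n ≤ j) (h2 : j < a + n) : a ≤ j ∧ j < b := by
  have hn := L.eight
  obtain ⟨r, h3, h4⟩ := (h j).1 hj
  have : r = 0 := by
    rcases lt_trichotomy r 0 with h | h | h
    · nlinarith
    · exact h
    · nlinarith
  subst this
  omega

theorem middle_mem {σ τ : Bool} {i k a : ℤ}
    (h : ∀ j, F τ j = F τ k ↔ ∃ r : ℤ, a ≤ j + r * n ∧ j + r * n < a + 3) {e : Sym2 V}
    (he : IsMiddleCEdge emb C (F τ k) e) (hi : incEdge emb (F σ i) e) :
    F σ i = F σ (a + 1) := by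
  have hn := L.eight
  have key : ∀ r s : ℤ, c r = c s → |r - s| < 8 → r = s := fun r s h1 h2 => by
    have := Int.eq_zero_of_abs_lt_dvd ((L.seq.eq_iff _ _).1 h1) (by omega)
    omega
  obtain ⟨h1, h2, h3⟩ := he
  obtain ⟨j, rfl⟩ := (L.mem_edges e).1 h1
  obtain ⟨r, h4, h5⟩ := (h j).1 ((L.inc_iff _ _ _).1 h2).symm
  have e1 : c j = c (j + r * n) := (L.seq.eq_iff _ _).2 (by simp)
  have e2 : c (j + 1) = c (j + r * n + 1) := (L.seq.eq_iff _ _).2 (by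
    rw [show j + 1 - (j + r * n + 1) = -(r * n) by ring]
    simp)
  have h6 := (L.inc_iff _ _ _).1 hi
  rw [h6]
  beta_reduce at h3
  rw [e1, e2] at h3
  have h7 : j + r * n = a + 1 := by
    generalize j + r * n = m at *
    by_contra hh
    have h8 : ∃ p, a ≤ p ∧ p < a + 3 ∧ (p = m + 2 ∨ p = m - 2) := by
      rcases lt_or_ge m (a + 1) with h | h
      · exact ⟨m + 2, by omega, by omega, Or.inl rfl⟩
      · exact ⟨m - 2, by omega, by omega, Or.inr rfl⟩
    obtain ⟨p, hp1, hp2, hp3⟩ := h8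
    obtain ⟨u, hu1, hu2⟩ := h3 _ ((L.mem_edges _).2 ⟨p, rfl⟩)
      ((L.inc_iff _ _ _).2 ((h p).2 ⟨0, by omega, by omega⟩).symm) (fun hh => by
        rcases Sym2.eq_iff.1 hh with ⟨h8, -⟩ | ⟨h8, -⟩
        · have := key _ _ h8 (by rw [abs_lt]; omega)
          omega
        · have := key _ _ h8 (by rw [abs_lt]; omega)
          omega)
    rw [Sym2.mem_iff] at hu1 hu2
    rcases hu1 with rfl | rfl <;> rcases hu2 with hu2 | hu2 <;>
      · have := key _ _ hu2 (by rw [abs_lt]; omega)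
        omega
  rw [← h7]
  exact L.F_congr _ (by simp)

end Layout

/-- A minor `4`-face occupying the first four edges of the cycle. -/
structure FourFace (emb : PlaneEmbedding G) (C : G.Walk x x) (c : ℤ → V) (n : ℕ)
    (side : Bool → V → Prop) (K : Bool → V → V → Prop) (F : Bool → ℤ → Set (ℝ × ℝ)) (σ τ : Bool)
    (v : V) : Prop extends Layout emb C c n side K F where
  ne : σ ≠ τ
  minor : MinorFaceH emb C (F σ 0)
  segment : MinorSegment G c n side σ v 0 4
  mem : ∀ j, F σ j = F σ 0 ↔ ∃ r : ℤ, 0 ≤ j + r * n ∧ j + r * n < 4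

/-- The net flow out of a face across its `j`-th edge, when the flow to each opposite face is
spread evenly over the common edges. -/
def share (emb : PlaneEmbedding G) (C : G.Walk x x) (F : Bool → ℤ → Set (ℝ × ℝ)) (σ τ : Bool)
    (j : ℤ) : ℚ :=
  netFlow emb C (F σ 0) (F τ j) / mEdges emb C (F σ 0) (F τ j)

namespace FourFace

variable {emb : PlaneEmbedding G} {C : G.Walk x x} {c : ℤ → V} {n : ℕ} {side : Bool → V → Prop}
  {K : Bool → V → V → Prop} {F : Bool → ℤ → Set (ℝ × ℝ)} {σ τ : Bool} {v : V}
  (L : FourFace emb C c n side K F σ τ v)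
include L

theorem face_eq {j : ℤ} (h1 : 0 ≤ j) (h2 : j < 4) : F σ j = F σ 0 :=
  Layout.eq_of_mem L.mem h1 h2

theorem reflect : FourFace emb C (fun i => c (4 - i)) n side K (fun ρ i => F ρ (3 - i)) σ τ v where
  toLayout := by simpa using L.toLayout.reflect 4
  ne := L.ne
  minor := by
    rw [L.face_eq (by norm_num) (by norm_num)]
    exact L.minor
  segment := L.segment.reflect 4 (by norm_num) (by norm_num)
  mem := fun j => by
    rw [L.face_eq (j := 3 - 0) (by norm_num) (by norm_num), L.mem]
    constructor
    · rintro ⟨r, h5, h6⟩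
      refine ⟨-r, ?_, ?_⟩ <;> rw [neg_mul] <;> linarith
    · rintro ⟨r, h5, h6⟩
      refine ⟨-r, ?_, ?_⟩ <;> rw [neg_mul] <;> linarith

theorem share_reflect (j : ℤ) :
    share emb C (fun ρ i => F ρ (3 - i)) σ τ j = share emb C F σ τ (3 - j) := by
  rw [share, share, L.face_eq (j := 3 - 0) (by norm_num) (by norm_num)]

theorem numCEdges_eq_four : numCEdges emb C (F σ 0) = 4 := by
  have := L.numCEdges_eq (by norm_num) L.segment.lt_add L.mem
  omega

theorem mEdges_eq_card (k : ℤ) : mEdges emb C (F σ 0) (F τ k) =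
    ((Finset.Ico (0 : ℤ) 4).filter fun j => F τ j = F τ k).card :=
  L.toLayout.mEdges_eq L.segment.lt_add L.mem k

theorem opposite {j : ℤ} (h1 : 0 ≤ j) (h2 : j < 4) : OppositeFaces emb C (F σ 0) (F τ j) :=
  (L.opposite_iff L.ne L.mem (L.isFace _ _)).2 ⟨j, h1, h2, rfl⟩

theorem mEdges_pos {j : ℤ} (h1 : 0 ≤ j) (h2 : j < 4) : 0 < mEdges emb C (F σ 0) (F τ j) := by
  rw [L.mEdges_eq_card, Finset.card_pos]
  exact ⟨j, by simp [h1, h2]⟩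

theorem wFace_eq : wFace emb C (F σ 0) = 4 -
    (share emb C F σ τ 0 + share emb C F σ τ 1 + share emb C F σ τ 2 + share emb C F σ τ 3) := by
  set S : Finset (Set (ℝ × ℝ)) := (Finset.Ico (0 : ℤ) 4).image (F τ) with hS
  have hsupp : ∀ g, OppositeFaces emb C (F σ 0) g → IsFaceOf (drawingH emb C) g → g ∈ S := by
    intro g h1 h2
    obtain ⟨j, h3, h4, rfl⟩ := (L.opposite_iff L.ne L.mem h2).1 h1
    exact Finset.mem_image_of_mem _ (Finset.mem_Ico.2 ⟨h3, h4⟩)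
  rw [wFace, L.numCEdges_eq_four, finsum_eq_sum_of_support_subset (s := S),
    finsum_eq_sum_of_support_subset (s := S), sub_add, ← Finset.sum_sub_distrib]
  · have h1 : ∀ g ∈ S, sendWeight emb C (F σ 0) g - sendWeight emb C g (F σ 0) =
        ((Finset.Ico (0 : ℤ) 4).filter fun j => F τ j = g).card •
          (netFlow emb C (F σ 0) g / mEdges emb C (F σ 0) g) := by
      intro g hg
      obtain ⟨k, hk, rfl⟩ := Finset.mem_image.1 hg
      rw [Finset.mem_Ico] at hk
      have := L.mEdges_pos hk.1 hk.2
      rw [← L.mEdges_eq_card, nsmul_eq_mul, mul_div_cancel₀ _ (by positivity), netFlow]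
    rw [Finset.sum_congr rfl h1,
      ← Finset.sum_comp (fun g => netFlow emb C (F σ 0) g / mEdges emb C (F σ 0) g) (F τ),
      show Finset.Ico (0 : ℤ) 4 = {0, 1, 2, 3} from rfl]
    simp [share]
    ring
  · intro g hg
    obtain ⟨h1, h2, h3⟩ := opposite_of_sendWeight_ne_zero hg
    exact hsupp _ h3.symm h1
  · intro g hg
    obtain ⟨h1, h2, h3⟩ := opposite_of_sendWeight_ne_zero hg
    exact hsupp _ h3 h2

theorem share_of_major {j : ℤ} (h1 : 0 ≤ j) (h2 : j < 4) (h : ¬ MinorFaceH emb C (F τ j)) :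
    share emb C F σ τ j = -1 := by
  have := L.mEdges_pos h1 h2
  rw [share, netFlow_of_major L.minor ⟨L.isFace _ _, h⟩ (L.opposite h1 h2), neg_div,
    div_self (by positivity)]

omit L in
theorem share_congr {i j : ℤ} (h : F τ i = F τ j) : share emb C F σ τ i = share emb C F σ τ j := by
  rw [share, share, h]

omit L in
theorem share_le_div {j : ℤ} {q : ℚ} (h : sendWeight emb C (F σ 0) (F τ j) ≤ q) :
    share emb C F σ τ j ≤ q / mEdges emb C (F σ 0) (F τ j) := by
  rw [share, netFlow]
  have := sendWeight_nonneg (emb := emb) (C := C) (F τ j) (F σ 0)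
  gcongr
  linarith

theorem share_of_two {j : ℤ} (h1 : 0 ≤ j) (h2 : j < 4) (h : numCEdges emb C (F τ j) = 2) :
    share emb C F σ τ j ≤ 2 / 3 := by
  have := L.mEdges_pos h1 h2
  have h3 := share_le_div (sendWeight_of_two (f := F σ 0) L.minor h)
  rwa [mul_div_cancel_right₀ _ (by positivity)] at h3

theorem share_of_four {j : ℤ} (h : 4 ≤ numCEdges emb C (F τ j)) :
    share emb C F σ τ j ≤ 1 / 3 ∧ (mEdges emb C (F σ 0) (F τ j) ≠ 2 → share emb C F σ τ j ≤ 0) := by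
  rcases sendWeight_of_four (f := F σ 0) L.minor h with h3 | ⟨hm, h3⟩
  · have h4 := share_le_div h3
    rw [zero_div] at h4
    exact ⟨h4.trans (by norm_num), fun _ => h4⟩
  · have h4 : sendWeight emb C (F σ 0) (F τ j) ≤ 2 / 3 := by
      rcases h3 with h3 | h3
      · exact h3.1
      · exact h3.1.trans (by norm_num)
    rw [mEdges_comm] at hm
    have h5 := share_le_div h4
    rw [hm] at h5
    exact ⟨h5.trans (by norm_num), fun h => absurd hm h⟩

/-- The segment of an opposite minor face, with the possible sizes. -/
theorem exists_segment {ρ : Bool} {j : ℤ} (h : MinorFaceH emb C (F ρ j)) :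
    ∃ w a b, a ≤ j ∧ j < b ∧ a + 2 ≤ b ∧ b < a + n ∧ (numCEdges emb C (F ρ j) : ℤ) = b - a ∧
      MinorSegment G c n side ρ w a b ∧
      ∀ k, F ρ k = F ρ j ↔ ∃ r : ℤ, a ≤ k + r * n ∧ k + r * n < b := by
  obtain ⟨w, a, b, h1, h2, h3, h4⟩ := L.seg _ _ h
  exact ⟨w, a, b, h1, h2, L.two_le h3, h3.lt_add, L.numCEdges_eq (by omega) h3.lt_add h4, h3, h4⟩

theorem share_of_three {j : ℤ} (h : numCEdges emb C (F τ j) = 3) :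
    share emb C F σ τ j ≤ 1 / mEdges emb C (F σ 0) (F τ j) :=
  share_le_div (sendWeight_of_three (f := F σ 0) L.minor h).1

theorem share_le_one {j : ℤ} (h1 : 0 ≤ j) (h2 : j < 4) : share emb C F σ τ j ≤ 1 := by
  by_cases hm : MinorFaceH emb C (F τ j)
  · obtain ⟨w, a, b, -, -, h5, -, h7, -, -⟩ := L.exists_segment hm
    rcases show numCEdges emb C (F τ j) = 2 ∨ numCEdges emb C (F τ j) = 3 ∨
      4 ≤ numCEdges emb C (F τ j) by omega with h | h | h
    · exact (L.share_of_two h1 h2 h).trans (by norm_num)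
    · have h3 := L.share_of_three h
      have h4 : (1 : ℚ) ≤ mEdges emb C (F σ 0) (F τ j) := by exact_mod_cast L.mEdges_pos h1 h2
      exact h3.trans (div_le_one_of_le₀ h4 (by positivity))
    · exact (L.share_of_four h).1.trans (by norm_num)
  · rw [L.share_of_major h1 h2 hm]
    norm_num

/-- A face meeting the first edge but not the second one receives little. -/
theorem share_zero_le (h : F τ 1 ≠ F τ 0) : share emb C F σ τ 0 ≤ 1 / 3 ∨
    share emb C F σ τ 0 ≤ 2 / 3 ∧ ∃ w, MinorSegment G c n side τ w (-1) 1 := by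
  have hn := L.eight
  by_cases hm : MinorFaceH emb C (F τ 0)
  · obtain ⟨w, a, b, h1, h2, h5, h6, h7, h8, h9⟩ := L.exists_segment hm
    have hb : b = 1 := by
      by_contra hh
      exact h (Layout.eq_of_mem h9 (by omega) (by omega))
    subst hb
    rcases show numCEdges emb C (F τ 0) = 2 ∨ numCEdges emb C (F τ 0) = 3 ∨
      4 ≤ numCEdges emb C (F τ 0) by omega with h | h | h
    · obtain rfl : a = -1 := by omega
      exact Or.inr ⟨L.share_of_two le_rfl (by norm_num) h, w, h8⟩
    · obtain rfl : a = -2 := by omega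
      left
      have h10 : sendWeight emb C (F σ 0) (F τ 0) ≤ 0 := by
        by_contra! hh
        obtain ⟨e, h10, h11⟩ := (sendWeight_of_three L.minor h).2 hh
        have := (L.mem_of_eq L.mem (L.middle_mem h9 h10 h11).symm
          (by omega) (by omega)).1
        omega
      have := share_le_div h10
      rw [zero_div] at this
      exact this.trans (by norm_num)
    · exact Or.inl (L.share_of_four h).1
  · left
    rw [L.share_of_major le_rfl (by norm_num) hm]
    norm_num

end FourFace

end FourFaceShares

section FourFaceWeight

open Set Topology Filter

variable {V : Type*} [Fintype V] {G : SimpleGraph V} {x : V}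

namespace FourFace

variable {emb : PlaneEmbedding G} {C : G.Walk x x} {c : ℤ → V} {n : ℕ} {side : Bool → V → Prop}
  {K : Bool → V → V → Prop} {F : Bool → ℤ → Set (ℝ × ℝ)} {σ τ : Bool} {v : V}
  (L : FourFace emb C c n side K F σ τ v)
include L

theorem sum_share_reflect : share emb C (fun ρ i => F ρ (3 - i)) σ τ 0 +
    share emb C (fun ρ i => F ρ (3 - i)) σ τ 1 + share emb C (fun ρ i => F ρ (3 - i)) σ τ 2 +
    share emb C (fun ρ i => F ρ (3 - i)) σ τ 3 = share emb C F σ τ 0 + share emb C F σ τ 1 +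
    share emb C F σ τ 2 + share emb C F σ τ 3 := by
  simp only [L.share_reflect]
  norm_num
  ring

theorem share_three_le (h : F τ 2 ≠ F τ 3) : share emb C F σ τ 3 ≤ 1 / 3 ∨
    share emb C F σ τ 3 ≤ 2 / 3 ∧ ∃ w, MinorSegment G c n side τ w 3 5 := by
  have h1 := L.reflect.share_zero_le (by simpa using h)
  rw [L.share_reflect] at h1
  rcases h1 with h1 | ⟨h1, w, hw⟩
  · exact Or.inl h1
  · refine Or.inr ⟨h1, w, ?_⟩
    simpa only [sub_sub_cancel] using hw.reflect 4 (a' := 3) (b' := 5) (by norm_num) (by norm_num)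

/-- The segment of a minor face starting at the middle vertex of the `4`-face. -/
theorem exists_right (hm : MinorFaceH emb C (F τ 2)) (hne : F τ 1 ≠ F τ 2) :
    ∃ (w : V) (b : ℤ), 4 ≤ b ∧ b < 2 + n ∧ (numCEdges emb C (F τ 2) : ℤ) = b - 2 ∧
      MinorSegment G c n side τ w 2 b ∧ F τ 3 = F τ 2 ∧
      ∀ k, F τ k = F τ 2 ↔ ∃ r : ℤ, 2 ≤ k + r * n ∧ k + r * n < b := by
  obtain ⟨w, a, b, h1, h2, h3, h4, h5, h6, h7⟩ := L.exists_segment hm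
  obtain rfl : a = 2 := by
    by_contra hh
    exact hne (Layout.eq_of_mem h7 (by omega) (by omega))
  exact ⟨w, b, by omega, h4, h5, h6, Layout.eq_of_mem h7 (by norm_num) (by omega), h7⟩

theorem sum_le_of_major (hm : ¬ MinorFaceH emb C (F τ 1)) : share emb C F σ τ 0 +
    share emb C F σ τ 1 + share emb C F σ τ 2 + share emb C F σ τ 3 ≤ 2 / 3 := by
  have h1 := L.share_of_major (by norm_num) (by norm_num) hm
  have h0 := L.share_le_one (j := 0) (by norm_num) (by norm_num)
  by_cases hm2 : MinorFaceH emb C (F τ 2)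
  · obtain ⟨w, b, hb, -, hnum, hw, h3, hmem⟩ := L.exists_right hm2 fun h => hm (h ▸ hm2)
    rw [share_congr h3, h1]
    by_cases hm0 : MinorFaceH emb C (F τ 0)
    · have h4 := L.share_zero_le fun h => hm (h ▸ hm0)
      rcases show numCEdges emb C (F τ 2) = 2 ∨ numCEdges emb C (F τ 2) = 3 ∨
        4 ≤ numCEdges emb C (F τ 2) by omega with h | h | h
      · obtain rfl : b = 4 := by omega
        have h5 := L.share_of_two (j := 2) (by norm_num) (by norm_num) h
        rcases h4 with h4 | ⟨-, u, hu⟩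
        · linarith
        · exact ((L.toCycleConfig.reflect 4).false_of_zero_two_of_three_five L.ne
            (L.segment.reflect 4 (by norm_num) (by norm_num))
            (hw.reflect 4 (by norm_num) (by norm_num))
            (hu.reflect 4 (by norm_num) (by norm_num))).elim
      · have h5 := L.share_of_three (j := 2) h
        have h6 : 2 ≤ mEdges emb C (F σ 0) (F τ 2) := by
          rw [L.mEdges_eq_card, show (2 : ℕ) = ({2, 3} : Finset ℤ).card from rfl]
          refine Finset.card_le_card fun j hj => ?_
          rw [Finset.mem_insert, Finset.mem_singleton] at hj
          rcases hj with rfl | rfl <;> simp [h3]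
        have h7 : (1 : ℚ) / mEdges emb C (F σ 0) (F τ 2) ≤ 1 / 2 :=
          one_div_le_one_div_of_le (by norm_num) (by exact_mod_cast h6)
        have h8 : share emb C F σ τ 0 ≤ 2 / 3 := by
          rcases h4 with h4 | h4
          · linarith
          · exact h4.1
        linarith
      · have := (L.share_of_four (j := 2) h).1
        linarith
    · have h4 := L.share_of_major (by norm_num) (by norm_num) hm0
      have h5 := L.share_le_one (j := 2) (by norm_num) (by norm_num)
      linarith
  · have h2 := L.share_of_major (by norm_num) (by norm_num) hm2
    have h3 := L.share_le_one (j := 3) (by norm_num) (by norm_num)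
    linarith

theorem sum_le_of_eq (hm : MinorFaceH emb C (F τ 1)) (heq : F τ 2 = F τ 1) : share emb C F σ τ 0 +
    share emb C F σ τ 1 + share emb C F σ τ 2 + share emb C F σ τ 3 ≤ 2 / 3 := by
  have hn := L.eight
  obtain ⟨w, a, b, h1, h2, h3, h4, h5, h6, h7⟩ := L.exists_segment hm
  have h8 := (L.mem_of_eq h7 heq (by omega) (by omega)).2
  have h9 : ¬ (a = 1 ∧ b = 3) := by
    rintro ⟨rfl, rfl⟩
    exact L.false_of_one_three L.ne L.segment h6
  have h10 : ¬ (a = 1 ∧ b = 4) := by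
    rintro ⟨rfl, rfl⟩
    exact L.false_of_one_four L.ne L.segment h6
  have h11 : ¬ (a = 0 ∧ b = 3) := by
    rintro ⟨rfl, rfl⟩
    exact (L.toCycleConfig.reflect 4).false_of_one_four L.ne
      (L.segment.reflect 4 (by norm_num) (by norm_num)) (h6.reflect 4 (by norm_num) (by norm_num))
  have h12 : ∃ k, (k = 0 ∨ k = 3) ∧ F τ k = F τ 1 := by
    rcases le_or_gt a 0 with h | h
    · exact ⟨0, Or.inl rfl, Layout.eq_of_mem h7 (by omega) (by omega)⟩
    · exact ⟨3, Or.inr rfl, Layout.eq_of_mem h7 (by omega) (by omega)⟩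
  obtain ⟨k, hk, hk1⟩ := h12
  have h13 : mEdges emb C (F σ 0) (F τ 1) ≠ 2 := by
    have : 3 ≤ mEdges emb C (F σ 0) (F τ 1) := by
      rw [L.mEdges_eq_card, show 3 = ({k, 1, 2} : Finset ℤ).card by
        rcases hk with rfl | rfl <;> rfl]
      refine Finset.card_le_card fun j hj => ?_
      simp only [Finset.mem_insert, Finset.mem_singleton] at hj
      rcases hj with rfl | rfl | rfl
      · rcases hk with rfl | rfl <;> simp [hk1]
      · simp
      · simp [heq]
    omega
  have h14 := (L.share_of_four (j := 1) (by omega)).2 h13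
  rw [share_congr heq]
  have h15 : share emb C F σ τ 0 ≤ 2 / 3 := by
    by_cases h : F τ 1 = F τ 0
    · rw [← share_congr h]
      linarith
    · rcases L.share_zero_le h with h | h
      · linarith
      · exact h.1
  have h16 : share emb C F σ τ 3 ≤ 2 / 3 := by
    by_cases h : F τ 2 = F τ 3
    · rw [← share_congr h, share_congr heq]
      linarith
    · rcases L.share_three_le h with h | h
      · linarith
      · exact h.1
  rcases hk with rfl | rfl <;> rw [share_congr hk1] <;> linarith

/-- A large opposite face starting at the middle vertex receives weight only in the presence of
short segments of the side of the `4`-face beyond it. -/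
theorem sendWeight_right {b : ℤ} (hb : b < 2 + n) (hnum : (numCEdges emb C (F τ 2) : ℤ) = b - 2)
    (h4 : 4 ≤ numCEdges emb C (F τ 2))
    (hmem : ∀ k, F τ k = F τ 2 ↔ ∃ r : ℤ, 2 ≤ k + r * n ∧ k + r * n < b) :
    sendWeight emb C (F σ 0) (F τ 2) ≤ 0 ∨
    (sendWeight emb C (F σ 0) (F τ 2) ≤ 2 / 3 ∧ b = 6 ∧
      ∃ z, MinorSegment G c n side σ z 4 6 ∨ MinorSegment G c n side σ z 4 7) ∨
    (sendWeight emb C (F σ 0) (F τ 2) ≤ 1 / 3 ∧ b = 7 ∧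
      ∃ z₁ z₂, MinorSegment G c n side σ z₁ 4 6 ∧ MinorSegment G c n side σ z₂ 6 8) := by
  have hn := L.eight
  have hfour := L.numCEdges_eq_four
  have hopp : ∀ g, MinorFaceH emb C g → OppositeFaces emb C (F τ 2) g → numCEdges emb C g < 4 →
      ∃ k, 4 ≤ k ∧ k < b ∧ g = F σ k := by
    intro g hg h1 h2
    obtain ⟨k, h3, h5, rfl⟩ := (L.opposite_iff L.ne.symm hmem hg.1).1 h1
    refine ⟨k, ?_, h5, rfl⟩
    by_contra hh
    rw [L.face_eq (j := k) (by omega) (by omega)] at h2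
    omega
  have hlow : ∀ {k a' b' : ℤ}, a' ≤ k → k < b' → 4 ≤ k →
      numCEdges emb C (F σ k) < 4 →
      (∀ j, F σ j = F σ k ↔ ∃ r : ℤ, a' ≤ j + r * n ∧ j + r * n < b') → 4 ≤ a' := by
    intro k a' b' h1 h2 h3 h5 h6
    by_contra hh
    rw [← Layout.eq_of_mem h6 (j := 3) (by omega) (by omega),
      L.face_eq (by norm_num) (by norm_num)] at h5
    omega
  rcases sendWeight_of_four (f := F σ 0) L.minor h4 with h | ⟨-, ⟨h, h5, f₂, h6, h7, h8, h9⟩ |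
    ⟨h, h5, g₁, g₂, h12, h6, h7, h8, h9, h10, h11⟩⟩
  · exact Or.inl h
  · right
    left
    obtain rfl : b = 6 := by omega
    refine ⟨h, rfl, ?_⟩
    obtain ⟨k, hk1, hk2, rfl⟩ := hopp f₂ h6 h8 (by omega)
    have h45 : F σ 4 = F σ k ∧ F σ 5 = F σ k := by
      rw [L.toLayout.mEdges_eq hb hmem, show Finset.Ico (2 : ℤ) 6 = {2, 3, 4, 5} from rfl] at h9
      have h2 : F σ 2 ≠ F σ k := fun hh => by
        rw [← hh, L.face_eq (by norm_num) (by norm_num)] at h7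
        omega
      have h3 : F σ 3 ≠ F σ k := fun hh => by
        rw [← hh, L.face_eq (by norm_num) (by norm_num)] at h7
        omega
      by_contra hh
      have h13 : (Finset.filter (fun j => F σ j = F σ k) {2, 3, 4, 5}).card ≤
          ({k} : Finset ℤ).card := by
        refine Finset.card_le_card fun j hj => ?_
        simp only [Finset.mem_filter, Finset.mem_insert, Finset.mem_singleton] at hj ⊢
        obtain ⟨rfl | rfl | rfl | rfl, hj⟩ := hj
        · exact absurd hj h2
        · exact absurd hj h3
        · by_contra hne
          obtain rfl : k = 5 := by omega
          exact hh ⟨hj, rfl⟩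
        · by_contra hne
          obtain rfl : k = 4 := by omega
          exact hh ⟨rfl, hj⟩
      rw [h9, Finset.card_singleton] at h13
      omega
    rw [← h45.1] at h6 h7 h45
    obtain ⟨z, a', b', h13, h14, h15, h16, h17, h18, h19⟩ := L.exists_segment h6
    have h20 := hlow h13 h14 le_rfl (by omega) h19
    obtain rfl : a' = 4 := by omega
    refine ⟨z, ?_⟩
    rcases h7 with h7 | h7
    · obtain rfl : b' = 6 := by omega
      exact Or.inl h18
    · obtain rfl : b' = 7 := by omega
      exact Or.inr h18
  · right
    right
    obtain rfl : b = 7 := by omega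
    refine ⟨h, rfl, ?_⟩
    obtain ⟨k₁, hk1, hk2, rfl⟩ := hopp g₁ h6 h8 (by omega)
    obtain ⟨k₂, hk3, hk4, rfl⟩ := hopp g₂ h9 h11 (by omega)
    obtain ⟨z₁, a₁, b₁, h13, h14, h15, h16, h17, h18, h19⟩ := L.exists_segment h6
    obtain ⟨z₂, a₂, b₂, h23, h24, h25, h26, h27, h28, h29⟩ := L.exists_segment h9
    have h20 := hlow h13 h14 hk1 (by omega) h19
    have h30 := hlow h23 h24 hk3 (by omega) h29
    have key : ∀ m, a₁ ≤ m → m < b₁ → a₂ ≤ m → m < b₂ → False := fun m i1 i2 i3 i4 =>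
      h12 ((Layout.eq_of_mem h19 i1 i2).symm.trans (Layout.eq_of_mem h29 i3 i4))
    have i1 : ¬ (a₂ ≤ a₁ ∧ a₁ < b₂) := fun h => key a₁ le_rfl (by omega) h.1 h.2
    have i2 : ¬ (a₁ ≤ a₂ ∧ a₂ < b₁) := fun h => key a₂ h.1 h.2 le_rfl (by omega)
    rcases show a₁ = 4 ∧ a₂ = 6 ∨ a₁ = 6 ∧ a₂ = 4 by omega with ⟨rfl, rfl⟩ | ⟨rfl, rfl⟩
    · obtain rfl : b₁ = 6 := by omega
      obtain rfl : b₂ = 8 := by omega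
      exact ⟨z₁, z₂, h18, h28⟩
    · obtain rfl : b₁ = 8 := by omega
      obtain rfl : b₂ = 6 := by omega
      exact ⟨z₂, z₁, h28, h18⟩

theorem mEdges_right (h0 : F τ 0 = F τ 1) (h3 : F τ 3 = F τ 2) (hne : F τ 1 ≠ F τ 2) :
    mEdges emb C (F σ 0) (F τ 2) = 2 := by
  rw [L.mEdges_eq_card, show Finset.Ico (0 : ℤ) 4 = {0, 1, 2, 3} from rfl]
  simp [Finset.filter_insert, Finset.filter_singleton, h0, h3, hne]

theorem sum_le_of_big (hm₁ : MinorFaceH emb C (F τ 1)) (hm₂ : MinorFaceH emb C (F τ 2))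
    (hne : F τ 1 ≠ F τ 2) (hbig : 4 ≤ numCEdges emb C (F τ 2)) : share emb C F σ τ 0 +
    share emb C F σ τ 1 + share emb C F σ τ 2 + share emb C F σ τ 3 ≤ 2 / 3 := by
  have hn := L.eight
  have R := L.reflect
  obtain ⟨w, b, hb4, hbn, hnum, hw, h3, hmem⟩ := L.exists_right hm₂ hne
  obtain ⟨u, a, ha4, han, hnum', hu, h0, hmem'⟩ := R.exists_right hm₁ hne.symm
  have h5 := L.sendWeight_right hbn hnum hbig hmem
  have h6 := R.sendWeight_right han hnum'
  have hf : F σ (3 - 0) = F σ 0 := L.face_eq (by norm_num) (by norm_num)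
  simp only [hf, show (3 : ℤ) - 2 = 1 by norm_num, sub_self] at h0 hnum' h6
  replace h6 := fun h => h6 h hmem'
  have hm2 := L.mEdges_right h0 h3 hne
  have hm1 : mEdges emb C (F σ 0) (F τ 1) = 2 := by
    have := R.mEdges_right (by simpa using h3) (by simpa using h0) (by simpa using hne.symm)
    simpa only [hf, show (3 : ℤ) - 2 = 1 by norm_num] using this
  rw [share_congr h0, share_congr h3, share, share, hm1, hm2, netFlow, netFlow]
  have t1 := sendWeight_nonneg (emb := emb) (C := C) (F τ 1) (F σ 0)
  have t2 := sendWeight_nonneg (emb := emb) (C := C) (F τ 2) (F σ 0)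
  have hback : ∀ {w s p q p' q'}, MinorSegment G (fun i => c (4 - i)) n side s w p q → 4 - q = p' →
      4 - p = q' → MinorSegment G c n side s w p' q' := by
    rintro w s p q p' q' h rfl rfl
    simpa only [sub_sub_cancel] using h.reflect 4 (a' := 4 - q) (b' := 4 - p) (by ring) (by ring)
  have hsmall : numCEdges emb C (F τ 1) = 2 ∨ numCEdges emb C (F τ 1) = 3 →
      2 / 3 ≤ sendWeight emb C (F τ 2) (F σ 0) := fun h =>
    two_thirds_le_sendWeight L.minor L.numCEdges_eq_four hm₂ hbig
      (L.opposite (by norm_num) (by norm_num)) hm2 hm₁ h (L.opposite (by norm_num) (by norm_num))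
      hm1
  rcases show numCEdges emb C (F τ 1) = 2 ∨ numCEdges emb C (F τ 1) = 3 ∨
    4 ≤ numCEdges emb C (F τ 1) by omega with h | h | h
  · obtain rfl : a = 4 := by omega
    have hu' := hback (p' := 0) (q' := 2) hu (by norm_num) (by norm_num)
    have s1 := sendWeight_of_two (f := F σ 0) L.minor h
    rw [hm1] at s1
    have s2 := hsmall (Or.inl h)
    rcases h5 with h5 | ⟨-, rfl, z, hz | hz⟩ | ⟨-, rfl, z₁, z₂, hz₁, hz₂⟩
    · norm_num at s1
      linarith
    · exact (L.false_of_two_four L.ne L.segment hu' hw hz (Or.inl rfl)).elim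
    · exact (L.false_of_two_four L.ne L.segment hu' hw hz (Or.inr rfl)).elim
    · exact (L.false_of_two_five L.ne L.segment hu' hw hz₁ hz₂).elim
  · obtain rfl : a = 5 := by omega
    have hu' := hback (p' := -1) (q' := 2) hu (by norm_num) (by norm_num)
    have s1 := (sendWeight_of_three (f := F σ 0) L.minor h).1
    have s2 := hsmall (Or.inr h)
    rcases h5 with h5 | ⟨-, rfl, z, hz | hz⟩ | ⟨h5, -⟩
    · linarith
    · exact ((L.toCycleConfig.reflect 6).false_of_two_four L.ne.symm
        (hw.reflect 6 (by norm_num) (by norm_num)) (hz.reflect 6 (by norm_num) (by norm_num))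
        (L.segment.reflect 6 (by norm_num) (by norm_num))
        (hu'.reflect 6 (a' := 4) (b' := 7) (by norm_num) (by norm_num)) (Or.inr rfl)).elim
    · exact (L.false_of_three_four L.ne L.segment hu' hw hz).elim
    · linarith
  · rcases h6 h with h6 | ⟨h6, rfl, y, hy⟩ | ⟨h6, rfl, y₁, y₂, hy₁, hy₂⟩
    · rcases h5 with h5 | ⟨h5, -⟩ | ⟨h5, -⟩ <;> linarith
    · have hu' := hback (p' := -2) (q' := 2) hu (by norm_num) (by norm_num)
      obtain ⟨p, hp, hy'⟩ : ∃ p, (p = -2 ∨ p = -3) ∧ MinorSegment G c n side σ y p 0 := by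
        rcases hy with hy | hy
        · exact ⟨-2, Or.inl rfl, hback hy (by norm_num) (by norm_num)⟩
        · exact ⟨-3, Or.inr rfl, hback hy (by norm_num) (by norm_num)⟩
      rcases h5 with h5 | ⟨h5, hz⟩ | ⟨h5, hz⟩
      · linarith
      · exact (L.false_of_four_four L.ne L.segment hp hy' hu' hw (Or.inl hz)).elim
      · exact (L.false_of_four_four L.ne L.segment hp hy' hu' hw (Or.inr hz)).elim
    · rcases h5 with h5 | ⟨h5, rfl, z, hz⟩ | ⟨h5, -⟩
      · linarith
      · obtain ⟨p, hp, hz'⟩ : ∃ p, (p = -2 ∨ p = -3) ∧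
            MinorSegment G (fun i => c (4 - i)) n side σ z p 0 := by
          rcases hz with hz | hz
          · exact ⟨-2, Or.inl rfl, hz.reflect 4 (by norm_num) (by norm_num)⟩
          · exact ⟨-3, Or.inr rfl, hz.reflect 4 (by norm_num) (by norm_num)⟩
        exact (R.false_of_four_four L.ne R.segment hp hz'
          (hw.reflect 4 (by norm_num) (by norm_num)) hu
          (Or.inr ⟨rfl, y₁, y₂, hy₁, hy₂⟩)).elim
      · linarith

theorem sum_le : share emb C F σ τ 0 + share emb C F σ τ 1 + share emb C F σ τ 2 +
    share emb C F σ τ 3 ≤ 2 / 3 := by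
  have R := L.reflect
  by_cases hm₁ : MinorFaceH emb C (F τ 1)
  swap
  · exact L.sum_le_of_major hm₁
  by_cases hm₂ : MinorFaceH emb C (F τ 2)
  swap
  · rw [← L.sum_share_reflect]
    exact R.sum_le_of_major hm₂
  by_cases hne : F τ 1 = F τ 2
  · exact L.sum_le_of_eq hm₁ hne.symm
  by_cases hbig : 4 ≤ numCEdges emb C (F τ 2)
  · exact L.sum_le_of_big hm₁ hm₂ hne hbig
  by_cases hbig' : 4 ≤ numCEdges emb C (F τ 1)
  · rw [← L.sum_share_reflect]
    exact R.sum_le_of_big hm₂ hm₁ (Ne.symm hne) hbig'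
  exfalso
  obtain ⟨w, b, hb4, -, hnum, hw, -⟩ := L.exists_right hm₂ hne
  obtain ⟨u, a, ha4, -, hnum', hu, -⟩ := R.exists_right hm₁ (Ne.symm hne)
  have hnum'' : (numCEdges emb C (F τ 1) : ℤ) = a - 2 := hnum'
  have hu' : MinorSegment G c n side τ u (4 - a) 2 := by
    simpa only [sub_sub_cancel] using hu.reflect 4 (a' := 4 - a) (b' := 2) (by ring) (by norm_num)
  have hw' : MinorSegment G (fun i => c (4 - i)) n side τ w (4 - b) 2 :=
    hw.reflect 4 (by ring) (by norm_num)
  rcases show a = 4 ∨ a = 5 by omega with rfl | rfl <;>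
    rcases show b = 4 ∨ b = 5 by omega with rfl | rfl
  · exact L.false_of_two_two L.ne L.segment hu' hw
  · exact L.false_of_two_three L.ne L.segment hu' hw
  · exact R.false_of_two_three L.ne R.segment hw' hu
  · exact L.false_of_three_three L.ne L.segment hu' hw

end FourFace

end FourFaceWeight

section FourFaceExistence

open Set Topology Filter

variable {V : Type*} [Fintype V] {G : SimpleGraph V} {x : V}

theorem exists_fourFace (h4 : ThreeConnected G) (emb : PlaneEmbedding G) {C : G.Walk x x}
    (hC : IsLongestIsolatingCycle G C) (hc : 8 ≤ C.length) {f : Set (ℝ × ℝ)}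
    (hf : MinorFaceH emb C f) (hf4 : numCEdges emb C f = 4) :
    ∃ c n side K F σ τ v, FourFace emb C c n side K F σ τ v ∧ F σ 0 = f := by
  obtain ⟨c, n, side, K, F, L⟩ := exists_layout h4 emb hC hc
  have hpos : 0 < numCEdges emb C f := by omega
  obtain ⟨e, he⟩ := Finset.card_pos.1 hpos
  rw [Finset.mem_filter, List.mem_toFinset] at he
  obtain ⟨i, rfl⟩ := (L.mem_edges e).1 he.1
  obtain ⟨σ, rfl⟩ := (L.inc f hf.1 i).1 he.2
  obtain ⟨v, a, b, h1, h2, h3, h5⟩ := L.seg σ i hf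
  have h6 := L.numCEdges_eq (by omega) h3.lt_add h5
  have h7 : F σ a = F σ i := Layout.eq_of_mem h5 le_rfl (by omega)
  refine ⟨_, n, side, K, _, σ, !σ, v, ⟨L.shift a, by cases σ <;> decide, ?_,
    h3.shift a (by ring) (by omega), fun j => ?_⟩, ?_⟩
  · simpa only [zero_add, h7] using hf
  · rw [zero_add, h7, h5]
    exact exists_congr fun r => by constructor <;> rintro ⟨h8, h9⟩ <;> constructor <;> linarith
  · rw [zero_add, h7]

end FourFaceExistence

/-- After discharging by rules R1–R5, every minor 4-face of `H` has weight `≥ 10/3`. -/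
theorem stmt10_minor_4face
    {V : Type*} [Fintype V] {G : SimpleGraph V}
    (hn : 11 ≤ Fintype.card V) (h4 : EssentiallyFourConnected G)
    (emb : PlaneEmbedding G) {x : V} (C : G.Walk x x)
    (hC : IsLongestIsolatingCycle G C) (hc : 8 ≤ C.length)
    (hVm : (Vminus emb C).Nonempty) (hVp : (Vplus emb C).Nonempty) :
    ∀ f : Set (ℝ × ℝ), MinorFaceH emb C f → numCEdges emb C f = 4 →
      (10 : ℚ) / 3 ≤ wFace emb C f := by
  intro f hf hf4
  obtain ⟨c, n, side, K, F, σ, τ, v, L, rfl⟩ := exists_fourFace h4.1 emb hC hc hf hf4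
  rw [L.wFace_eq]
  linarith [L.sum_le]

end
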